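/- arXiv:2605.03265 — 2 statements merged into one kernel-verified Lean document; each statement's English description precedes it below -/
import Mathlib

section
/- Under the null hypothesis θ_1 = θ_2 and Assumptions (A1), (A2), (A4), (A5), the diagonal-deleted oracle statistic U_n satisfies sup_{t∈R} | P(U_n/τ_n ≤ t) − P(Γ_n/τ_n ≤ t) | → 0, where Γ_n = Σ_{r=1}^{2p} λ_{nr}(χ²_{1r} − 1) with independent χ²_1 random variables χ²_{1r} and λ_{nr} the eigenvalues of B_n; moreover U_n/τ_n converges in distribution to (1/√2) Σ_{r≥1} ρ_r(χ²_{1r} − 1) + ρ_0 Z, where Z ~ N(0,1) is independent of the χ²_{1r}. -/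
open MeasureTheory ProbabilityTheory Matrix Filter

noncomputable section

namespace PDQ

/-- Euclidean norm of a vector in `ℝ^p`. -/
def enorm {p : ℕ} (v : Fin p → ℝ) : ℝ := Real.sqrt (∑ j, v j ^ 2)

/-- The spatial sign `U(x) = x/‖x‖` (`U(0) = 0`). -/
def sgn {p : ℕ} (v : Fin p → ℝ) : Fin p → ℝ := (enorm v)⁻¹ • v

/-- Operator (spectral) norm of a real matrix. -/
def opNorm {p q : ℕ} (A : Matrix (Fin p) (Fin q) ℝ) : ℝ :=
  sSup ((fun v => enorm (A.mulVec v)) '' {v : Fin q → ℝ | enorm v ≤ 1})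

/-- Symmetrization `sym(A) = (A + Aᵀ)/2`. -/
def symPart {p : ℕ} (A : Matrix (Fin p) (Fin p) ℝ) : Matrix (Fin p) (Fin p) ℝ :=
  (2 : ℝ)⁻¹ • (A + Aᵀ)

/-- The two-sample elliptical model
`X_{ki} = θ_k + (D_k°)^{1/2} R_k^{1/2} ξ_{ki} u_{ki}`, `k = 0, 1` (samples 1 and 2),
with i.i.d. observations within each sample, mutual independence of all the pairs
`(ξ_{ki}, u_{ki})`, `u_{ki}` uniform on the unit sphere `S^{p−1}` (characterized by unit
norm and rotation invariance of its law) independent of the positive radial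
variable `ξ_{ki}`, `D_k°` a positive diagonal matrix, and `R_k` a positive definite
correlation matrix given through a square root `Rhalf k`. -/
structure Model (Ω : Type) [MeasurableSpace Ω] where
  p : ℕ
  hp : 0 < p
  n : Fin 2 → ℕ
  hn : ∀ k, 2 ≤ n k
  μ : Measure Ω
  hμ : IsProbabilityMeasure μ
  θ : Fin 2 → Fin p → ℝ
  d0 : Fin 2 → Fin p → ℝ
  hd0 : ∀ k j, 0 < d0 k j
  Rhalf : Fin 2 → Matrix (Fin p) (Fin p) ℝ
  hRdiag : ∀ k j, (Rhalf k * (Rhalf k)ᵀ) j j = 1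
  hRpd : ∀ k, (Rhalf k * (Rhalf k)ᵀ).PosDef
  ξ : (k : Fin 2) → Fin (n k) → Ω → ℝ
  u : (k : Fin 2) → Fin (n k) → Ω → Fin p → ℝ
  hmξ : ∀ k i, Measurable (ξ k i)
  hmu : ∀ k i, Measurable (u k i)
  hξpos : ∀ k i, ∀ᵐ ω ∂μ, 0 < ξ k i ω
  hunit : ∀ k i, ∀ᵐ ω ∂μ, ∑ j, u k i ω j ^ 2 = 1
  hrot : ∀ k i (Q : Matrix (Fin p) (Fin p) ℝ), Q * Qᵀ = 1 →
    μ.map (fun ω => Q.mulVec (u k i ω)) = μ.map (u k i)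
  hξu : ∀ k i, IndepFun (ξ k i) (u k i) μ
  hindep : iIndepFun
    (fun ki : (k : Fin 2) × Fin (n k) => fun ω => (ξ ki.1 ki.2 ω, u ki.1 ki.2 ω)) μ
  hident : ∀ k i i', IdentDistrib (fun ω => (ξ k i ω, u k i ω))
    (fun ω => (ξ k i' ω, u k i' ω)) μ μ

namespace Model

variable {Ω : Type} [MeasurableSpace Ω] (M : Model Ω)

/-- The null hypothesis `θ_1 = θ_2`. -/
def H0 : Prop := M.θ 0 = M.θ 1

/-- First observation index in sample `k`. -/
def o0 (k : Fin 2) : Fin (M.n k) := ⟨0, lt_of_lt_of_le (by norm_num) (M.hn k)⟩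

/-- Second observation index in sample `k`. -/
def o1 (k : Fin 2) : Fin (M.n k) := ⟨1, lt_of_lt_of_le (by norm_num) (M.hn k)⟩

/-- First coordinate index. -/
def j0 : Fin M.p := ⟨0, M.hp⟩

/-- The observations: `X_{ki} = θ_k + (D_k°)^{1/2} R_k^{1/2} (ξ_{ki} u_{ki})`. -/
def X (k : Fin 2) (i : Fin (M.n k)) (ω : Ω) : Fin M.p → ℝ := fun j =>
  M.θ k j + Real.sqrt (M.d0 k j) * (M.Rhalf k).mulVec (fun m => M.ξ k i ω * M.u k i ω m) j

/-- `Z_{ki} = ξ_{ki} e₁ᵀ u_{ki}`. -/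
def Z (k : Fin 2) (i : Fin (M.n k)) (ω : Ω) : ℝ := M.ξ k i ω * M.u k i ω M.j0

/-- `F_{k,Δ}(t) = P(|Z_{k1} − Z_{k2}| ≤ t)` for independent copies of `ξ e₁ᵀu`. -/
def Fdelta (k : Fin 2) (t : ℝ) : ℝ :=
  (M.μ {ω | |M.Z k (M.o0 k) ω - M.Z k (M.o1 k) ω| ≤ t}).toReal

/-- The population `α`-quantile `q_{k,α} = F_{k,Δ}^{−1}(α)`. -/
def qA (α : ℝ) (k : Fin 2) : ℝ := sInf {t : ℝ | 0 ≤ t ∧ α ≤ M.Fdelta k t}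

/-- The diagonal target `d_{kj} = q_{k,α}² d°_{kj}`. -/
def dT (α : ℝ) (k : Fin 2) (j : Fin M.p) : ℝ := (M.qA α k) ^ 2 * M.d0 k j

/-- Empirical pairwise-difference CDF `F̂_{kj}`. -/
def Fhat (k : Fin 2) (j : Fin M.p) (t : ℝ) (ω : Ω) : ℝ :=
  ((M.n k).choose 2 : ℝ)⁻¹ *
    ∑ i : Fin (M.n k), ∑ l : Fin (M.n k),
      if i < l then (if |M.X k i ω j - M.X k l ω j| ≤ t then (1 : ℝ) else 0) else 0

/-- The pairwise-difference quantile estimator `q̂_{kj,α}`. -/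
def qhat (α : ℝ) (k : Fin 2) (j : Fin M.p) (ω : Ω) : ℝ :=
  sInf {t : ℝ | 0 ≤ t ∧ α ≤ M.Fhat k j t ω}

/-- The diagonal scale estimator `d̂_{kj} = q̂_{kj,α}²`. -/
def dhat (α : ℝ) (k : Fin 2) (j : Fin M.p) (ω : Ω) : ℝ := (M.qhat α k j ω) ^ 2

/-- `N = n₁ + n₂`. -/
def NN : ℕ := M.n 0 + M.n 1

/-- `n₀ = min(n₁, n₂)`. -/
def n0 : ℕ := min (M.n 0) (M.n 1)

/-- `x_N = log(8 p N)`. -/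
def xN : ℝ := Real.log (8 * M.p * M.NN)

/-- `r_D = (x_N / n₀)^{1/2}`. -/
def rD : ℝ := Real.sqrt (M.xN / M.n0)

end Model

/-- Assumption (A1): `n₁/N → κ ∈ (0,1)` and `x_N/n₀ → 0`. -/
def A1 {Ω : Type} [MeasurableSpace Ω] (Ms : ℕ → Model Ω) : Prop :=
  (∃ κ : ℝ, 0 < κ ∧ κ < 1 ∧
    Tendsto (fun ν => ((Ms ν).n 0 : ℝ) / ((Ms ν).NN : ℝ)) atTop (nhds κ)) ∧
  Tendsto (fun ν => (Ms ν).xN / ((Ms ν).n0 : ℝ)) atTop (nhds 0)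

/-- Assumption (A2): uniformly bounded positive diagonal entries
(the i.i.d. elliptical sampling scheme is part of `Model`). -/
def A2 {Ω : Type} [MeasurableSpace Ω] (Ms : ℕ → Model Ω) : Prop :=
  ∃ dlo dhi : ℝ, 0 < dlo ∧
    ∀ ν k j, dlo ≤ (Ms ν).d0 k j ∧ (Ms ν).d0 k j ≤ dhi

/-- Assumption (A3): quantile regularity, uniformly along the sequence. -/
def A3 {Ω : Type} [MeasurableSpace Ω] (α : ℝ) (Ms : ℕ → Model Ω) : Prop :=
  ∃ qlo qhi cF CF εF : ℝ, 0 < qlo ∧ qlo < qhi ∧ 0 < cF ∧ 0 < εF ∧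
    ∀ ν k, (qlo ≤ (Ms ν).qA α k ∧ (Ms ν).qA α k ≤ qhi) ∧
      ∀ t : ℝ, |t - (Ms ν).qA α k| ≤ εF →
        cF * |t - (Ms ν).qA α k| ≤ |(Ms ν).Fdelta k t - α| ∧
        |(Ms ν).Fdelta k t - α| ≤ CF * |t - (Ms ν).qA α k|

namespace Model

variable {Ω : Type} [MeasurableSpace Ω] (M : Model Ω)

/-- Oracle standardized observations `Y_{ki} = D_k^{−1/2}(X_{ki} − θ_k)`. -/
def Y (α : ℝ) (k : Fin 2) (i : Fin (M.n k)) (ω : Ω) : Fin M.p → ℝ := fun j =>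
  (M.X k i ω j - M.θ k j) / Real.sqrt (M.dT α k j)

/-- Oracle spatial signs `S_{ki} = U(Y_{ki})`. -/
def S (α : ℝ) (k : Fin 2) (i : Fin (M.n k)) (ω : Ω) : Fin M.p → ℝ := sgn (M.Y α k i ω)

/-- Sign averages `S̄_k`. -/
def Sbar (α : ℝ) (k : Fin 2) (ω : Ω) : Fin M.p → ℝ :=
  (M.n k : ℝ)⁻¹ • ∑ i : Fin (M.n k), M.S α k i ω

/-- Angular covariance `Ω_k = E(S_{ki} S_{ki}ᵀ)`. -/
def Omat (α : ℝ) (k : Fin 2) : Matrix (Fin M.p) (Fin M.p) ℝ :=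
  Matrix.of fun a b => ∫ ω, M.S α k (M.o0 k) ω a * M.S α k (M.o0 k) ω b ∂M.μ

/-- Population Jacobian `G_k = E[‖Y_{ki}‖⁻¹ (I_p − S_{ki}S_{ki}ᵀ)]`. -/
def Gmat (α : ℝ) (k : Fin 2) : Matrix (Fin M.p) (Fin M.p) ℝ :=
  Matrix.of fun a b => ∫ ω,
    (enorm (M.Y α k (M.o0 k) ω))⁻¹ *
      ((if a = b then (1 : ℝ) else 0) - M.S α k (M.o0 k) ω a * M.S α k (M.o0 k) ω b) ∂M.μ

/-- `A_{12} = D_1^{−1/2} D_2^{1/2}`. -/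
def A12 (α : ℝ) : Matrix (Fin M.p) (Fin M.p) ℝ :=
  Matrix.diagonal fun j => Real.sqrt (M.dT α 1 j) / Real.sqrt (M.dT α 0 j)

/-- `A_{21} = D_2^{−1/2} D_1^{1/2}`. -/
def A21 (α : ℝ) : Matrix (Fin M.p) (Fin M.p) ℝ :=
  Matrix.diagonal fun j => Real.sqrt (M.dT α 0 j) / Real.sqrt (M.dT α 1 j)

/-- `K_1 = sym(G_2 A_{21} G_1^{−1})`. -/
def K1 (α : ℝ) : Matrix (Fin M.p) (Fin M.p) ℝ :=
  symPart (M.Gmat α 1 * M.A21 α * (M.Gmat α 0)⁻¹)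

/-- `K_2 = sym(G_2^{−1} A_{12}ᵀ G_1)`. -/
def K2 (α : ℝ) : Matrix (Fin M.p) (Fin M.p) ℝ :=
  symPart ((M.Gmat α 1)⁻¹ * (M.A12 α)ᵀ * M.Gmat α 0)

/-- `C_{12} = G_2^{−1} A_{12}ᵀ G_1 G_2 A_{21} G_1^{−1}` and `K_3 = I_p + C_{12}ᵀ`. -/
def K3 (α : ℝ) : Matrix (Fin M.p) (Fin M.p) ℝ :=
  1 + ((M.Gmat α 1)⁻¹ * (M.A12 α)ᵀ * M.Gmat α 0 * M.Gmat α 1 * M.A21 α * (M.Gmat α 0)⁻¹)ᵀ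

/-- `L_{K,n} = 1 + max(‖K_1‖, ‖K_2‖, ‖K_3‖)`. -/
def LK (α : ℝ) : ℝ :=
  1 + max (opNorm (M.K1 α)) (max (opNorm (M.K2 α)) (opNorm (M.K3 α)))

/-- The curvature factor `𝔠_n` (given `M_{Y,n}` and the square roots `Ω_k^{1/2}`). -/
def curv (α : ℝ) (MY : ℝ) (Oh : Fin 2 → Matrix (Fin M.p) (Fin M.p) ℝ) : ℝ :=
  1 + MY ^ 2 +
    max
      ((opNorm ((Real.sqrt M.p : ℝ) • M.Gmat α 0) +
          opNorm (((Real.sqrt M.p : ℝ) • M.Gmat α 0)⁻¹)) ^ 4 +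
        sSup ((fun a => ∫ ω, (Matrix.vecMul a (Oh 0)⁻¹ ⬝ᵥ M.S α 0 (M.o0 0) ω) ^ 4 ∂M.μ) ''
          {a : Fin M.p → ℝ | enorm a = 1}))
      ((opNorm ((Real.sqrt M.p : ℝ) • M.Gmat α 1) +
          opNorm (((Real.sqrt M.p : ℝ) • M.Gmat α 1)⁻¹)) ^ 4 +
        sSup ((fun a => ∫ ω, (Matrix.vecMul a (Oh 1)⁻¹ ⬝ᵥ M.S α 1 (M.o0 1) ω) ^ 4 ∂M.μ) ''
          {a : Fin M.p → ℝ | enorm a = 1}))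

/-- `q_{θ,n} = 𝔠_n p^{1/2} x_N / n₀`. -/
def qθ (α : ℝ) (MY : ℝ) (Oh : Fin 2 → Matrix (Fin M.p) (Fin M.p) ℝ) : ℝ :=
  M.curv α MY Oh * Real.sqrt M.p * M.xN / M.n0

/-- `a_{S,n} = 𝔠_n {r_D + n₀^{−1/2} + x_N/n₀}`. -/
def aS (α : ℝ) (MY : ℝ) (Oh : Fin 2 → Matrix (Fin M.p) (Fin M.p) ℝ) : ℝ :=
  M.curv α MY Oh * (M.rD + (Real.sqrt M.n0)⁻¹ + M.xN / M.n0)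

/-- `a_{K,n} = 𝔠_n {r_D + (x_N/n₀)^{1/2} + a_{S,n}}`. -/
def aK (α : ℝ) (MY : ℝ) (Oh : Fin 2 → Matrix (Fin M.p) (Fin M.p) ℝ) : ℝ :=
  M.curv α MY Oh * (M.rD + Real.sqrt (M.xN / M.n0) + M.aS α MY Oh)

/-- Objective function of the standardized spatial median (using `D̂_k`). -/
def medObj (α : ℝ) (k : Fin 2) (ω : Ω) (t : Fin M.p → ℝ) : ℝ :=
  ∑ i : Fin (M.n k), enorm fun j => (M.X k i ω j - t j) / Real.sqrt (M.dhat α k j ω)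

/-- Fitted standardized residuals `Ŷ_{ki}` (for a given median estimate `th`). -/
def Yhat (α : ℝ) (th : Fin 2 → Ω → Fin M.p → ℝ) (k : Fin 2) (i : Fin (M.n k)) (ω : Ω) :
    Fin M.p → ℝ := fun j => (M.X k i ω j - th k ω j) / Real.sqrt (M.dhat α k j ω)

/-- Fitted spatial signs `Ŝ_{ki}`. -/
def Shat (α : ℝ) (th : Fin 2 → Ω → Fin M.p → ℝ) (k : Fin 2) (i : Fin (M.n k)) (ω : Ω) :
    Fin M.p → ℝ := sgn (M.Yhat α th k i ω)

/-- Plug-in angular covariance `Ω̂_k`. -/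
def Ohat (α : ℝ) (th : Fin 2 → Ω → Fin M.p → ℝ) (k : Fin 2) (ω : Ω) :
    Matrix (Fin M.p) (Fin M.p) ℝ :=
  Matrix.of fun a b =>
    (M.n k : ℝ)⁻¹ * ∑ i : Fin (M.n k), M.Shat α th k i ω a * M.Shat α th k i ω b

/-- Plug-in Jacobian `Ĝ_k`. -/
def Ghat (α : ℝ) (th : Fin 2 → Ω → Fin M.p → ℝ) (k : Fin 2) (ω : Ω) :
    Matrix (Fin M.p) (Fin M.p) ℝ :=
  Matrix.of fun a b =>
    (M.n k : ℝ)⁻¹ * ∑ i : Fin (M.n k), (enorm (M.Yhat α th k i ω))⁻¹ *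
      ((if a = b then (1 : ℝ) else 0) - M.Shat α th k i ω a * M.Shat α th k i ω b)

/-- Plug-in `Â_{12}`. -/
def A12hat (α : ℝ) (ω : Ω) : Matrix (Fin M.p) (Fin M.p) ℝ :=
  Matrix.diagonal fun j => Real.sqrt (M.dhat α 1 j ω) / Real.sqrt (M.dhat α 0 j ω)

/-- Plug-in `Â_{21}`. -/
def A21hat (α : ℝ) (ω : Ω) : Matrix (Fin M.p) (Fin M.p) ℝ :=
  Matrix.diagonal fun j => Real.sqrt (M.dhat α 0 j ω) / Real.sqrt (M.dhat α 1 j ω)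

/-- Plug-in `K̂_1`. -/
def K1hat (α : ℝ) (th : Fin 2 → Ω → Fin M.p → ℝ) (ω : Ω) : Matrix (Fin M.p) (Fin M.p) ℝ :=
  symPart (M.Ghat α th 1 ω * M.A21hat α ω * (M.Ghat α th 0 ω)⁻¹)

/-- Plug-in `K̂_2`. -/
def K2hat (α : ℝ) (th : Fin 2 → Ω → Fin M.p → ℝ) (ω : Ω) : Matrix (Fin M.p) (Fin M.p) ℝ :=
  symPart ((M.Ghat α th 1 ω)⁻¹ * (M.A12hat α ω)ᵀ * M.Ghat α th 0 ω)

/-- Plug-in `K̂_3`. -/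
def K3hat (α : ℝ) (th : Fin 2 → Ω → Fin M.p → ℝ) (ω : Ω) : Matrix (Fin M.p) (Fin M.p) ℝ :=
  1 + ((M.Ghat α th 1 ω)⁻¹ * (M.A12hat α ω)ᵀ * M.Ghat α th 0 ω * M.Ghat α th 1 ω *
        M.A21hat α ω * (M.Ghat α th 0 ω)⁻¹)ᵀ

/-- `K̂_r`, `r = 0,1,2` (for `K̂_1, K̂_2, K̂_3`). -/
def Khat (α : ℝ) (th : Fin 2 → Ω → Fin M.p → ℝ) (r : Fin 3) (ω : Ω) :
    Matrix (Fin M.p) (Fin M.p) ℝ :=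
  if r = 0 then M.K1hat α th ω else if r = 1 then M.K2hat α th ω else M.K3hat α th ω

/-- `K_r`, `r = 0,1,2` (for `K_1, K_2, K_3`). -/
def Kmat (α : ℝ) (r : Fin 3) : Matrix (Fin M.p) (Fin M.p) ℝ :=
  if r = 0 then M.K1 α else if r = 1 then M.K2 α else M.K3 α

/-- The diagonal-deleted oracle statistic `U_n`. -/
def Un (α : ℝ) (ω : Ω) : ℝ :=
  ((M.n 0 : ℝ) ^ 2)⁻¹ * (∑ i : Fin (M.n 0), ∑ l : Fin (M.n 0),
      if i ≠ l then M.S α 0 i ω ⬝ᵥ (M.K1 α).mulVec (M.S α 0 l ω) else 0) +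
  ((M.n 1 : ℝ) ^ 2)⁻¹ * (∑ i : Fin (M.n 1), ∑ l : Fin (M.n 1),
      if i ≠ l then M.S α 1 i ω ⬝ᵥ (M.K2 α).mulVec (M.S α 1 l ω) else 0) -
  ((M.n 0 : ℝ) * (M.n 1 : ℝ))⁻¹ * ∑ i : Fin (M.n 0), ∑ j : Fin (M.n 1),
      M.S α 0 i ω ⬝ᵥ (M.K3 α).mulVec (M.S α 1 j ω)

/-- The `2p × 2p` matrix `B_n` (given symmetric square roots `Ω_k^{1/2} = Oh k`). -/
def Bn (α : ℝ) (Oh : Fin 2 → Matrix (Fin M.p) (Fin M.p) ℝ) :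
    Matrix (Fin M.p ⊕ Fin M.p) (Fin M.p ⊕ Fin M.p) ℝ :=
  Matrix.fromBlocks
    ((M.n 0 : ℝ)⁻¹ • (Oh 0 * M.K1 α * Oh 0))
    ((-(2 * Real.sqrt ((M.n 0 : ℝ) * (M.n 1 : ℝ)))⁻¹) • (Oh 0 * M.K3 α * Oh 1))
    ((-(2 * Real.sqrt ((M.n 0 : ℝ) * (M.n 1 : ℝ)))⁻¹) • (Oh 1 * (M.K3 α)ᵀ * Oh 0))
    ((M.n 1 : ℝ)⁻¹ • (Oh 1 * M.K2 α * Oh 1))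

/-- `τ_n² = 2 tr(B_n²)`. -/
def τsq (α : ℝ) (Oh : Fin 2 → Matrix (Fin M.p) (Fin M.p) ℝ) : ℝ :=
  2 * (M.Bn α Oh * M.Bn α Oh).trace

/-- `τ_n = (2 tr(B_n²))^{1/2}`. -/
def τ (α : ℝ) (Oh : Fin 2 → Matrix (Fin M.p) (Fin M.p) ℝ) : ℝ :=
  Real.sqrt (M.τsq α Oh)

/-- The angular row-leverage quantity `Δ_{row,n}`. -/
def Δrow (α : ℝ) (Oh : Fin 2 → Matrix (Fin M.p) (Fin M.p) ℝ) : ℝ :=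
  (M.τsq α Oh)⁻¹ *
    max (opNorm (M.K1 α * M.Omat α 0 * M.K1 α) / (M.n 0 : ℝ) ^ 3)
      (max (opNorm (M.K2 α * M.Omat α 1 * M.K2 α) / (M.n 1 : ℝ) ^ 3)
        (max (opNorm (M.K3 α * M.Omat α 1 * (M.K3 α)ᵀ) / ((M.n 0 : ℝ) ^ 2 * (M.n 1 : ℝ)))
          (opNorm ((M.K3 α)ᵀ * M.Omat α 0 * M.K3 α) / ((M.n 0 : ℝ) * (M.n 1 : ℝ) ^ 2))))

/-- `δ_{H,n} = a_{K,n}² + L_{K,n}² a_{S,n}² + Δ_{row,n} + n₀⁻¹`. -/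
def δH (α : ℝ) (MY : ℝ) (Oh : Fin 2 → Matrix (Fin M.p) (Fin M.p) ℝ) : ℝ :=
  M.aK α MY Oh ^ 2 + M.LK α ^ 2 * M.aS α MY Oh ^ 2 + M.Δrow α Oh + (M.n0 : ℝ)⁻¹

/-- `δ_{dJ,n} = 𝔠_n Δ_{row,n}`. -/
def δdJ (α : ℝ) (MY : ℝ) (Oh : Fin 2 → Matrix (Fin M.p) (Fin M.p) ℝ) : ℝ :=
  M.curv α MY Oh * M.Δrow α Oh

/-- The normalized eigenvalue sequence `ρ_{nr} = λ_{nr}/tr(B_n²)^{1/2}`, extended by `0`. -/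
def ρn (α : ℝ) (Oh : Fin 2 → Matrix (Fin M.p) (Fin M.p) ℝ)
    (lam : Fin M.p ⊕ Fin M.p → ℝ) (r : ℕ) : ℝ :=
  if h : r < M.p then lam (Sum.inl ⟨r, h⟩) / Real.sqrt ((M.Bn α Oh * M.Bn α Oh).trace)
  else if h2 : r - M.p < M.p then
    lam (Sum.inr ⟨r - M.p, h2⟩) / Real.sqrt ((M.Bn α Oh * M.Bn α Oh).trace)
  else 0

end Model

/-- Assumption (A4): inverse-radius moments and a small-ball condition for the
standardized radius, with deterministic bound `M_{Y,n} ≥ 1`. -/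
def A4 {Ω : Type} [MeasurableSpace Ω] (α : ℝ) (Ms : ℕ → Model Ω) (MY : ℕ → ℝ) : Prop :=
  (∀ ν, 1 ≤ MY ν) ∧
  (∀ ν k,
    Real.sqrt ((Ms ν).p) * (∫ ω, (enorm ((Ms ν).Y α k ((Ms ν).o0 k) ω))⁻¹ ∂(Ms ν).μ) +
      ((Ms ν).p : ℝ) * (∫ ω, (enorm ((Ms ν).Y α k ((Ms ν).o0 k) ω) ^ 2)⁻¹ ∂(Ms ν).μ) +
      ((Ms ν).p : ℝ) ^ 2 *
        (∫ ω, (enorm ((Ms ν).Y α k ((Ms ν).o0 k) ω) ^ 4)⁻¹ ∂(Ms ν).μ) ≤ MY ν) ∧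
  (∀ ν k, ∀ t : ℝ, 0 < t → t ≤ 1 →
    t ^ (-2 : ℤ) *
      ((Ms ν).μ {ω | enorm ((Ms ν).Y α k ((Ms ν).o0 k) ω)
        ≤ t * Real.sqrt ((Ms ν).p)}).toReal ≤ MY ν)

namespace Model

variable {Ω : Type} [MeasurableSpace Ω] (M : Model Ω)

/-- The feasible full-sample spatial-sign statistic `R̂_n^{PDQ}` (for a given
median estimate `th`). -/
def Rpdq (α : ℝ) (th : Fin 2 → Ω → Fin M.p → ℝ) (ω : Ω) : ℝ :=
  -(((M.n 0 : ℝ) * (M.n 1 : ℝ))⁻¹ * ∑ i : Fin (M.n 0), ∑ j : Fin (M.n 1),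
    (sgn fun jj => (M.X 0 i ω jj - th 1 ω jj) / Real.sqrt (M.dhat α 0 jj ω)) ⬝ᵥ
      (sgn fun jj => (M.X 1 j ω jj - th 0 ω jj) / Real.sqrt (M.dhat α 1 jj ω)))

/-- The empirical diagonal-deletion correction
`b̂_n = Σ_k n_k⁻² Σ_i Ŝ_{ki}ᵀ K̂_k Ŝ_{ki} = Σ_k n_k⁻¹ tr(K̂_k Ω̂_k)`. -/
def bhat (α : ℝ) (th : Fin 2 → Ω → Fin M.p → ℝ) (ω : Ω) : ℝ :=
  ((M.n 0 : ℝ) ^ 2)⁻¹ * (∑ i : Fin (M.n 0),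
      M.Shat α th 0 i ω ⬝ᵥ (M.K1hat α th ω).mulVec (M.Shat α th 0 i ω)) +
  ((M.n 1 : ℝ) ^ 2)⁻¹ * (∑ i : Fin (M.n 1),
      M.Shat α th 1 i ω ⬝ᵥ (M.K2hat α th ω).mulVec (M.Shat α th 1 i ω))

/-- The feasible diagonal-deleted statistic `T_n^{PDQ} = R̂_n^{PDQ} − b̂_n`. -/
def Tpdq (α : ℝ) (th : Fin 2 → Ω → Fin M.p → ℝ) (ω : Ω) : ℝ :=
  M.Rpdq α th ω - M.bhat α th ω

/-- The bootstrap kernel matrix `Ĥ_n` (an `N × N` symmetric matrix, indexed by the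
disjoint union of the two samples). -/
def Hhat (α : ℝ) (th : Fin 2 → Ω → Fin M.p → ℝ) (ω : Ω) :
    Matrix (Fin (M.n 0) ⊕ Fin (M.n 1)) (Fin (M.n 0) ⊕ Fin (M.n 1)) ℝ :=
  Matrix.of fun a b =>
    match a, b with
    | Sum.inl i, Sum.inl l => ((M.n 0 : ℝ) ^ 2)⁻¹ *
        (M.Shat α th 0 i ω ⬝ᵥ (M.K1hat α th ω).mulVec (M.Shat α th 0 l ω))
    | Sum.inl i, Sum.inr j => -((2 * (M.n 0 : ℝ) * (M.n 1 : ℝ))⁻¹) *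
        (M.Shat α th 0 i ω ⬝ᵥ (M.K3hat α th ω).mulVec (M.Shat α th 1 j ω))
    | Sum.inr j, Sum.inl i => -((2 * (M.n 0 : ℝ) * (M.n 1 : ℝ))⁻¹) *
        (M.Shat α th 0 i ω ⬝ᵥ (M.K3hat α th ω).mulVec (M.Shat α th 1 j ω))
    | Sum.inr j, Sum.inr l => ((M.n 1 : ℝ) ^ 2)⁻¹ *
        (M.Shat α th 1 j ω ⬝ᵥ (M.K2hat α th ω).mulVec (M.Shat α th 1 l ω))

/-- `Ĥ_{n,0}`: `Ĥ_n` with its diagonal set to zero. -/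
def Hhat0 (α : ℝ) (th : Fin 2 → Ω → Fin M.p → ℝ) (ω : Ω) :
    Matrix (Fin (M.n 0) ⊕ Fin (M.n 1)) (Fin (M.n 0) ⊕ Fin (M.n 1)) ℝ :=
  Matrix.of fun a b => if a = b then 0 else M.Hhat α th ω a b

/-- `τ̂_{*,n} = (2 tr(Ĥ_{n,0}²))^{1/2}`. -/
def τhat (α : ℝ) (th : Fin 2 → Ω → Fin M.p → ℝ) (ω : Ω) : ℝ :=
  Real.sqrt (2 * (M.Hhat0 α th ω * M.Hhat0 α th ω).trace)

end Model

/-- Coding of the `2p` indices `Fin p ⊕ Fin p` into `ℕ`. -/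
def sumCode (p : ℕ) : Fin p ⊕ Fin p → ℕ :=
  Sum.elim (fun i => (i : ℕ)) fun i => p + (i : ℕ)

/-- The comparison variable `Γ_n = Σ_{r=1}^{2p} λ_{nr} (χ²_{1r} − 1)`, realized from a
sequence `g` of i.i.d. standard Gaussians (so that the `χ²_{1r} = g_r²` are independent
`χ²_1` variables). -/
def GammaStat {p : ℕ} {Ω' : Type} (lam : Fin p ⊕ Fin p → ℝ) (g : ℕ → Ω' → ℝ)
    (ω' : Ω') : ℝ :=
  ∑ r : Fin p ⊕ Fin p, lam r * ((g (sumCode p r + 1) ω') ^ 2 - 1)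

/-- Assumption (A5): spectral regularity of `B_n` (whose eigenvalues are `lam ν`) and
convergence of all the approximation rates.  Here `ρ r` stands for `ρ_{r+1}` of the
paper and `ρ0` for `ρ_0`. -/
def A5 {Ω : Type} [MeasurableSpace Ω] (α : ℝ) (Ms : ℕ → Model Ω) (MY : ℕ → ℝ)
    (Oh : (ν : ℕ) → Fin 2 → Matrix (Fin (Ms ν).p) (Fin (Ms ν).p) ℝ)
    (lam : (ν : ℕ) → Fin (Ms ν).p ⊕ Fin (Ms ν).p → ℝ)
    (ρ : ℕ → ℝ) (ρ0 : ℝ) : Prop :=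
  (∀ ν, ∃ Q : Matrix (Fin (Ms ν).p ⊕ Fin (Ms ν).p) (Fin (Ms ν).p ⊕ Fin (Ms ν).p) ℝ,
      Q * Qᵀ = 1 ∧ (Ms ν).Bn α (Oh ν) = Qᵀ * Matrix.diagonal (lam ν) * Q) ∧
  (∀ ν, 0 < ((Ms ν).Bn α (Oh ν) * (Ms ν).Bn α (Oh ν)).trace) ∧
  Summable (fun r => ρ r ^ 2) ∧
  0 ≤ ρ0 ∧ ρ0 ^ 2 = 1 - ∑' r, ρ r ^ 2 ∧
  Tendsto (fun ν => ∑' r : ℕ, ((Ms ν).ρn α (Oh ν) (lam ν) r - ρ r) ^ 2) atTop (nhds 0) ∧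
  Tendsto (fun ν => (Ms ν).rD) atTop (nhds 0) ∧
  Tendsto (fun ν => (Ms ν).qθ α (MY ν) (Oh ν)) atTop (nhds 0) ∧
  Tendsto (fun ν => (Ms ν).xN / (((Ms ν).n0 : ℝ) ^ 2 * (Ms ν).τ α (Oh ν))) atTop (nhds 0) ∧
  Tendsto (fun ν => (Ms ν).aK α (MY ν) (Oh ν)) atTop (nhds 0) ∧
  Tendsto (fun ν => (Ms ν).Δrow α (Oh ν)) atTop (nhds 0) ∧
  Tendsto (fun ν => (Ms ν).δH α (MY ν) (Oh ν)) atTop (nhds 0) ∧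
  Tendsto (fun ν => (Ms ν).δdJ α (MY ν) (Oh ν)) atTop (nhds 0)

/-- Second-order Taylor bound for the complex exponential on the imaginary axis. -/
theorem norm_exp_I_mul_sub_taylor_le (x : ℝ) :
    ‖Complex.exp (Complex.I * x) - (1 + Complex.I * x - (x : ℂ) ^ 2 / 2)‖ ≤ 4 * |x| ^ 3 := by
  have hn : ‖Complex.I * (x : ℂ)‖ = |x| := by simp
  rcases le_or_gt |x| 1 with h | h
  · have h1 := Complex.exp_bound (x := Complex.I * x) (by rw [hn]; exact h) (n := 3) (by norm_num)
    rw [hn] at h1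
    have e : ∑ m ∈ Finset.range 3, (Complex.I * (x : ℂ)) ^ m / (m.factorial : ℂ)
        = 1 + Complex.I * x - (x : ℂ) ^ 2 / 2 := by
      simp [Finset.sum_range_succ, mul_pow]; ring
    rw [e] at h1
    refine h1.trans ?_
    have : 0 ≤ |x| ^ 3 := by positivity
    norm_num [Nat.factorial]
    nlinarith
  · have h1 : ‖Complex.exp (Complex.I * x)‖ = 1 := by
      rw [mul_comm]; exact Complex.norm_exp_ofReal_mul_I x
    have h2 : ‖1 + Complex.I * x - (x : ℂ) ^ 2 / 2‖ ≤ 1 + |x| + |x| ^ 2 / 2 := by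
      refine (norm_sub_le _ _).trans (add_le_add ((norm_add_le _ _).trans ?_) ?_)
      · simp
      · simp
    refine (norm_sub_le _ _).trans ?_
    rw [h1]
    nlinarith [mul_pos (sub_pos.2 h) (sub_pos.2 h), pow_pos (lt_trans one_pos h) 2,
      pow_pos (lt_trans one_pos h) 3, mul_pos (pow_pos (lt_trans one_pos h) 2) (sub_pos.2 h)]

theorem integrable_pow_of_memLp_four {Ω : Type*} [MeasurableSpace Ω] {P : Measure Ω}
    [IsProbabilityMeasure P] {X : Ω → ℝ} (h : MemLp X 4 P) {k : ℕ} (hk : k ≤ 4) :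
    Integrable (fun ω => X ω ^ k) P := by
  rcases Nat.eq_zero_or_pos k with rfl | hk0
  · simp
  have h1 : MemLp X k P := h.mono_exponent (by exact_mod_cast hk)
  have h2 := h1.integrable_norm_pow hk0.ne'
  refine h2.mono' (h.aestronglyMeasurable.pow k) (ae_of_all _ fun ω => ?_)
  simp

theorem integral_add_sq_of_indepFun {Ω : Type*} [MeasurableSpace Ω] {P : Measure Ω}
    [IsProbabilityMeasure P] {X Y : Ω → ℝ} (hi : IndepFun X Y P) (hX : MemLp X 4 P)
    (hY : MemLp Y 4 P) (hX0 : ∫ ω, X ω ∂P = 0) :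
    ∫ ω, (X ω + Y ω) ^ 2 ∂P = ∫ ω, X ω ^ 2 ∂P + ∫ ω, Y ω ^ 2 ∂P := by
  have iX := fun k hk => integrable_pow_of_memLp_four hX (k := k) hk
  have iY := fun k hk => integrable_pow_of_memLp_four hY (k := k) hk
  have iXY : Integrable (fun ω => X ω * Y ω) P :=
    hi.integrable_mul (by simpa using iX 1 (by norm_num)) (by simpa using iY 1 (by norm_num))
  have eXY : ∫ ω, X ω * Y ω ∂P = 0 := by
    rw [hi.integral_fun_mul_eq_mul_integral hX.aestronglyMeasurable hY.aestronglyMeasurable,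
      hX0, zero_mul]
  have e : ∀ ω, (X ω + Y ω) ^ 2 = X ω ^ 2 + 2 * (X ω * Y ω) + Y ω ^ 2 := fun ω => by ring
  simp_rw [e]
  rw [integral_add ((iX 2 (by norm_num)).fun_add (iXY.const_mul 2)) (iY 2 (by norm_num)),
    integral_add (iX 2 (by norm_num)) (iXY.const_mul 2), integral_const_mul, eXY]
  ring

theorem integral_add_pow_four_of_indepFun {Ω : Type*} [MeasurableSpace Ω] {P : Measure Ω}
    [IsProbabilityMeasure P] {X Y : Ω → ℝ} (hi : IndepFun X Y P) (hX : MemLp X 4 P)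
    (hY : MemLp Y 4 P) (hX0 : ∫ ω, X ω ∂P = 0) (hY0 : ∫ ω, Y ω ∂P = 0) :
    ∫ ω, (X ω + Y ω) ^ 4 ∂P = ∫ ω, X ω ^ 4 ∂P + 6 * (∫ ω, X ω ^ 2 ∂P) * (∫ ω, Y ω ^ 2 ∂P)
      + ∫ ω, Y ω ^ 4 ∂P := by
  have iX := fun k hk => integrable_pow_of_memLp_four hX (k := k) hk
  have iY := fun k hk => integrable_pow_of_memLp_four hY (k := k) hk
  have hij : ∀ i j : ℕ, IndepFun (fun ω => X ω ^ i) (fun ω => Y ω ^ j) P := fun i j =>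
    hi.comp (measurable_id.pow_const i) (measurable_id.pow_const j)
  have iXY : ∀ i j : ℕ, i ≤ 4 → j ≤ 4 → Integrable (fun ω => X ω ^ i * Y ω ^ j) P :=
    fun i j h1 h2 => (hij i j).integrable_mul (iX i h1) (iY j h2)
  have eXY : ∀ i j : ℕ, i ≤ 4 → j ≤ 4 → ∫ ω, X ω ^ i * Y ω ^ j ∂P
      = (∫ ω, X ω ^ i ∂P) * ∫ ω, Y ω ^ j ∂P := fun i j h1 h2 =>
    (hij i j).integral_fun_mul_eq_mul_integral (iX i h1).aestronglyMeasurable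
      (iY j h2).aestronglyMeasurable
  have e : ∀ ω, (X ω + Y ω) ^ 4 = X ω ^ 4 + (4 * (X ω ^ 3 * Y ω ^ 1) + (6 * (X ω ^ 2 * Y ω ^ 2)
      + (4 * (X ω ^ 1 * Y ω ^ 3) + Y ω ^ 4))) := fun ω => by ring
  have i31 := (iXY 3 1 (by norm_num) (by norm_num)).const_mul 4
  have i22 := (iXY 2 2 (by norm_num) (by norm_num)).const_mul 6
  have i13 := (iXY 1 3 (by norm_num) (by norm_num)).const_mul 4
  have i4X := iX 4 le_rfl
  have i4Y := iY 4 le_rfl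
  simp_rw [e]
  rw [integral_add i4X (i31.fun_add (i22.fun_add (i13.fun_add i4Y))),
    integral_add i31 (i22.fun_add (i13.fun_add i4Y)), integral_add i22 (i13.fun_add i4Y),
    integral_add i13 i4Y, integral_const_mul, integral_const_mul, integral_const_mul,
    eXY 3 1 (by norm_num) (by norm_num), eXY 2 2 (by norm_num) (by norm_num),
    eXY 1 3 (by norm_num) (by norm_num)]
  simp only [pow_one, hX0, hY0]
  ring

/-- A sum of independent centred variables with kurtosis at most `κ` has kurtosis at most `κ`,
provided that `3 ≤ κ`. -/
theorem moments_sum_of_iIndepFun {Ω ι : Type*} [MeasurableSpace Ω] {P : Measure Ω}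
    [IsProbabilityMeasure P] {X : ι → Ω → ℝ} (hi : iIndepFun X P) (hX : ∀ b, MemLp (X b) 4 P)
    (hX0 : ∀ b, ∫ ω, X b ω ∂P = 0) {κ : ℝ} (hκ : 3 ≤ κ)
    (hk : ∀ b, ∫ ω, X b ω ^ 4 ∂P ≤ κ * (∫ ω, X b ω ^ 2 ∂P) ^ 2) (s : Finset ι) :
    ∫ ω, ∑ b ∈ s, X b ω ∂P = 0 ∧
      ∫ ω, (∑ b ∈ s, X b ω) ^ 2 ∂P = ∑ b ∈ s, ∫ ω, X b ω ^ 2 ∂P ∧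
      ∫ ω, (∑ b ∈ s, X b ω) ^ 4 ∂P ≤ κ * (∑ b ∈ s, ∫ ω, X b ω ^ 2 ∂P) ^ 2 := by
  classical
  induction s using Finset.induction_on with
  | empty => simp
  | insert a s ha ih =>
    obtain ⟨ih0, ih2, ih4⟩ := ih
    have hS : MemLp (fun ω => ∑ b ∈ s, X b ω) 4 P := memLp_finsetSum s fun b _ => hX b
    have hind : IndepFun (X a) (fun ω => ∑ b ∈ s, X b ω) P := by
      have := (hi.indepFun_finsetSum_of_notMem₀ (fun b => (hX b).aestronglyMeasurable.aemeasurable)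
        ha).symm
      convert this using 1
      ext ω; simp
    have hone : (1 : ENNReal) ≤ 4 := by norm_num
    simp only [Finset.sum_insert ha]
    refine ⟨?_, ?_, ?_⟩
    · rw [integral_add ((hX a).integrable hone) (hS.integrable hone), hX0, ih0, add_zero]
    · rw [integral_add_sq_of_indepFun hind (hX a) hS (hX0 a), ih2]
    · rw [integral_add_pow_four_of_indepFun hind (hX a) hS (hX0 a) ih0, ih2]
      have h1 : 0 ≤ ∫ ω, X a ω ^ 2 ∂P := integral_nonneg fun ω => sq_nonneg _
      have h2 : 0 ≤ ∑ b ∈ s, ∫ ω, X b ω ^ 2 ∂P :=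
        Finset.sum_nonneg fun b _ => integral_nonneg fun ω => sq_nonneg _
      nlinarith [hk a, mul_nonneg (mul_nonneg h1 h2) (sub_nonneg.2 hκ)]

/-- Minkowski-type bound: fourth moments of the coordinates control that of the length. -/
theorem integral_sum_sq_sq_le {Ω J : Type*} [Fintype J] [MeasurableSpace Ω] {P : Measure Ω}
    [IsProbabilityMeasure P] {L : J → Ω → ℝ} (hL : ∀ j, MemLp (L j) 4 P) {s : J → ℝ}
    (hs : ∀ j, 0 ≤ s j) {κ : ℝ} (hκ : 0 ≤ κ) (h4 : ∀ j, ∫ ω, L j ω ^ 4 ∂P ≤ κ * s j ^ 2) :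
    Integrable (fun ω => (∑ j, L j ω ^ 2) ^ 2) P ∧
      ∫ ω, (∑ j, L j ω ^ 2) ^ 2 ∂P ≤ κ * (∑ j, s j) ^ 2 := by
  have i4 : ∀ j, Integrable (fun ω => L j ω ^ 4) P := fun j =>
    integrable_pow_of_memLp_four (hL j) le_rfl
  have key : ∀ δ : ℝ, 0 < δ → ∀ ω, (∑ j, L j ω ^ 2) ^ 2
      ≤ (∑ j, (s j + δ)) * ∑ j, L j ω ^ 4 / (s j + δ) := by
    intro δ hδ ω
    refine Finset.sum_sq_le_sum_mul_sum_of_sq_le_mul _ (fun j _ => ?_) (fun j _ => ?_)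
      (fun j _ => ?_)
    · linarith [hs j]
    · have := hs j; positivity
    · have : s j + δ ≠ 0 := by linarith [hs j]
      refine le_of_eq ?_
      field_simp
  have iB : ∀ δ : ℝ, Integrable (fun ω => (∑ j, (s j + δ)) * ∑ j, L j ω ^ 4 / (s j + δ)) P :=
    fun δ => (integrable_finsetSum _ fun j _ => (i4 j).div_const _).const_mul _
  have hmeas : AEStronglyMeasurable (fun ω => (∑ j, L j ω ^ 2) ^ 2) P :=
    (Finset.aestronglyMeasurable_fun_sum _ fun j _ => (hL j).aestronglyMeasurable.pow 2).pow 2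
  have hint : Integrable (fun ω => (∑ j, L j ω ^ 2) ^ 2) P :=
    (iB 1).mono' hmeas (ae_of_all _ fun ω => by
      rw [Real.norm_of_nonneg (sq_nonneg _)]; exact key 1 one_pos ω)
  refine ⟨hint, ?_⟩
  have hδ : ∀ δ : ℝ, 0 < δ → ∫ ω, (∑ j, L j ω ^ 2) ^ 2 ∂P ≤ κ * (∑ j, (s j + δ)) ^ 2 := by
    intro δ hδ
    refine (integral_mono hint (iB δ) (key δ hδ)).trans ?_
    rw [integral_const_mul, integral_finsetSum _ fun j _ => (i4 j).div_const _]
    have h1 : ∑ j, ∫ ω, L j ω ^ 4 / (s j + δ) ∂P ≤ ∑ j, κ * (s j + δ) := by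
      refine Finset.sum_le_sum fun j _ => ?_
      rw [integral_div]
      have hp : 0 < s j + δ := by linarith [hs j]
      rw [div_le_iff₀ hp]
      refine (h4 j).trans ?_
      rw [mul_assoc]
      refine mul_le_mul_of_nonneg_left ?_ hκ
      nlinarith [hs j]
    have h2 : 0 ≤ ∑ j, (s j + δ) := Finset.sum_nonneg fun j _ => by linarith [hs j]
    refine (mul_le_mul_of_nonneg_left h1 h2).trans (le_of_eq ?_)
    rw [← Finset.mul_sum]; ring
  have hlim : Tendsto (fun δ : ℝ => κ * (∑ j, (s j + δ)) ^ 2) (nhdsWithin 0 (Set.Ioi 0))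
      (nhds (κ * (∑ j, (s j + 0)) ^ 2)) := by
    refine Tendsto.mono_left ?_ nhdsWithin_le_nhds
    exact Continuous.tendsto (by fun_prop) 0
  simp only [add_zero] at hlim
  exact ge_of_tendsto hlim (eventually_nhdsWithin_of_forall fun δ h => hδ δ h)

/-- A law on `J → ℝ` that is centred and isotropic, whose linear forms have kurtosis at
most `κ`. -/
structure Isotropic {J : Type*} [Fintype J] (κ : ℝ) (m : Measure (J → ℝ)) : Prop where
  prob : IsProbabilityMeasure m
  memLp : ∀ v : J → ℝ, MemLp (fun x => v ⬝ᵥ x) 4 m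
  mean : ∀ v : J → ℝ, ∫ x, v ⬝ᵥ x ∂m = 0
  second : ∀ v : J → ℝ, ∫ x, (v ⬝ᵥ x) ^ 2 ∂m = v ⬝ᵥ v
  fourth : ∀ v : J → ℝ, ∫ x, (v ⬝ᵥ x) ^ 4 ∂m ≤ κ * (v ⬝ᵥ v) ^ 2

theorem abs_pow_three_le (z : ℝ) {ε : ℝ} (hε : 0 < ε) :
    |z| ^ 3 ≤ (ε * z ^ 2 + z ^ 4 / ε) / 2 := by
  have h : z ^ 4 / ε = ε * (z ^ 2 / ε) ^ 2 := by field_simp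
  have h2 : |z| ^ 3 = ε * (|z| * (z ^ 2 / ε)) := by
    rw [← sq_abs z]; field_simp
  rw [h, h2, ← sq_abs z]
  nlinarith [mul_nonneg hε.le (sq_nonneg (|z| - |z| ^ 2 / ε))]

theorem dotProduct_self_nonneg' {J : Type*} [Fintype J] (v : J → ℝ) : 0 ≤ v ⬝ᵥ v :=
  Finset.sum_nonneg fun _ _ => mul_self_nonneg _

theorem continuous_const_dotProduct {J : Type*} [Fintype J] (v : J → ℝ) :
    Continuous fun x : J → ℝ => v ⬝ᵥ x :=
  continuous_const.dotProduct continuous_id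

/-- The characteristic function of a linear form of an isotropic law is approximately that of
its second-order expansion. -/
theorem Isotropic.norm_integral_exp_sub_le {J : Type*} [Fintype J] {κ : ℝ} {m : Measure (J → ℝ)}
    (hm : Isotropic κ m) (t : ℝ) (L : J → ℝ) {ε : ℝ} (hε : 0 < ε) :
    ‖∫ y, Complex.exp (Complex.I * ((t * (L ⬝ᵥ y) : ℝ) : ℂ)) ∂m
        - ((1 - t ^ 2 * (L ⬝ᵥ L) / 2 : ℝ) : ℂ)‖
      ≤ 2 * |t| ^ 3 * (ε * (L ⬝ᵥ L) + κ * (L ⬝ᵥ L) ^ 2 / ε) := by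
  have := hm.prob
  have i1 : Integrable (fun y => L ⬝ᵥ y) m := (hm.memLp L).integrable (by norm_num)
  have i2 := integrable_pow_of_memLp_four (hm.memLp L) (k := 2) (by norm_num)
  have i4 := integrable_pow_of_memLp_four (hm.memLp L) (k := 4) le_rfl
  have j1 : Integrable (fun y => Complex.I * ((t * (L ⬝ᵥ y) : ℝ) : ℂ)) m :=
    ((i1.const_mul t).ofReal).const_mul _
  have j2 : Integrable (fun y => ((t * (L ⬝ᵥ y) : ℝ) : ℂ) ^ 2 / 2) m := by
    have : Integrable (fun y => ((t ^ 2 * (L ⬝ᵥ y) ^ 2 : ℝ) : ℂ) / 2) m :=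
      ((i2.const_mul (t ^ 2)).ofReal (𝕜 := ℂ)).div_const 2
    refine this.congr (ae_of_all _ fun y => ?_)
    push_cast; ring
  have hmain : ∫ y, (1 + Complex.I * ((t * (L ⬝ᵥ y) : ℝ) : ℂ)
      - ((t * (L ⬝ᵥ y) : ℝ) : ℂ) ^ 2 / 2) ∂m = ((1 - t ^ 2 * (L ⬝ᵥ L) / 2 : ℝ) : ℂ) := by
    rw [integral_sub ((integrable_const _).fun_add j1) j2, integral_add (integrable_const _) j1,
      integral_const_mul, integral_div]
    have e2 : ∫ y, ((t * (L ⬝ᵥ y) : ℝ) : ℂ) ^ 2 ∂m = ((t ^ 2 * (L ⬝ᵥ L) : ℝ) : ℂ) := by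
      rw [← hm.second L, ← integral_const_mul, ← integral_complex_ofReal]
      refine integral_congr_ae (ae_of_all _ fun y => ?_)
      push_cast; ring
    rw [e2, integral_complex_ofReal, integral_const_mul, hm.mean L]
    simp
  have iexp : Integrable (fun y => Complex.exp (Complex.I * ((t * (L ⬝ᵥ y) : ℝ) : ℂ))) m := by
    refine Integrable.of_bound (C := 1) ?_ (ae_of_all _ fun y => ?_)
    · have := continuous_const_dotProduct L
      exact Continuous.aestronglyMeasurable (by fun_prop)
    · rw [mul_comm, Complex.norm_exp_ofReal_mul_I]
  have ipoly : Integrable (fun y => (1 + Complex.I * ((t * (L ⬝ᵥ y) : ℝ) : ℂ)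
      - ((t * (L ⬝ᵥ y) : ℝ) : ℂ) ^ 2 / 2)) m :=
    ((integrable_const _).fun_add j1).sub j2
  rw [← hmain, ← integral_sub iexp ipoly]
  have ibd : Integrable (fun y => 2 * |t| ^ 3 * (ε * (L ⬝ᵥ y) ^ 2 + (L ⬝ᵥ y) ^ 4 / ε)) m :=
    ((i2.const_mul ε).add (i4.div_const ε)).const_mul _
  refine (norm_integral_le_of_norm_le ibd (ae_of_all _ fun y => ?_)).trans ?_
  · refine (norm_exp_I_mul_sub_taylor_le _).trans ?_
    rw [abs_mul, mul_pow]
    have := abs_pow_three_le (L ⬝ᵥ y) hε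
    have ht : 0 ≤ |t| ^ 3 := by positivity
    nlinarith [mul_le_mul_of_nonneg_left this ht]
  · rw [integral_const_mul, integral_add (i2.const_mul ε) (i4.div_const ε), integral_const_mul,
      hm.second, integral_div]
    have := hm.fourth L
    gcongr

/-- Off-diagonal quadratic form with blocks `H a b`. -/
def offdiag {ι J : Type*} [Fintype ι] [DecidableEq ι] [Fintype J] (H : ι → ι → Matrix J J ℝ)
    (x : ι → J → ℝ) : ℝ :=
  ∑ a, ∑ b, if a ≠ b then x a ⬝ᵥ (H a b) *ᵥ (x b) else 0

/-- The coefficient vector of the `a`-th variable in `offdiag H`. -/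
def linPart {ι J : Type*} [Fintype ι] [DecidableEq ι] [Fintype J] (H : ι → ι → Matrix J J ℝ)
    (a : ι) (x : ι → J → ℝ) : J → ℝ := fun j =>
  ∑ b ∈ Finset.univ.erase a, ((2 : ℝ) • H a b j) ⬝ᵥ x b

/-- The influence `∑_{b ≠ a} ‖H a b‖²` of the `a`-th variable. -/
def influence {ι J : Type*} [Fintype ι] [DecidableEq ι] [Fintype J] (H : ι → ι → Matrix J J ℝ)
    (a : ι) : ℝ := ∑ b ∈ Finset.univ.erase a, ∑ j, H a b j ⬝ᵥ H a b j

section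
variable {ι J : Type*} [Fintype ι] [DecidableEq ι] [Fintype J]

theorem influence_nonneg (H : ι → ι → Matrix J J ℝ) (a : ι) : 0 ≤ influence H a :=
  Finset.sum_nonneg fun _ _ => Finset.sum_nonneg fun _ _ => dotProduct_self_nonneg' _

theorem continuous_offdiag (H : ι → ι → Matrix J J ℝ) : Continuous (offdiag H) := by
  unfold offdiag
  refine continuous_finsetSum _ fun a _ => continuous_finsetSum _ fun b _ => ?_
  split_ifs
  · exact (continuous_apply a).dotProduct (continuous_const.matrix_mulVec (continuous_apply b))
  · exact continuous_const

theorem offdiag_update {H : ι → ι → Matrix J J ℝ} (hH : ∀ a b, H b a = (H a b)ᵀ) (a : ι)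
    (x : ι → J → ℝ) (y : J → ℝ) :
    offdiag H (Function.update x a y) = offdiag H (Function.update x a 0)
      + linPart H a x ⬝ᵥ y := by
  have split : ∀ z : ι → J → ℝ, offdiag H z = 2 * ∑ b ∈ Finset.univ.erase a,
      z a ⬝ᵥ (H a b) *ᵥ (z b) + ∑ c ∈ Finset.univ.erase a, ∑ b ∈ Finset.univ.erase a,
        if c ≠ b then z c ⬝ᵥ (H c b) *ᵥ (z b) else 0 := by
    intro z
    unfold offdiag
    rw [← Finset.add_sum_erase _ _ (Finset.mem_univ a), ← Finset.add_sum_erase _ _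
      (Finset.mem_univ a)]
    have h1 : ∀ c ∈ Finset.univ.erase a, (∑ b, if c ≠ b then z c ⬝ᵥ (H c b) *ᵥ (z b) else 0)
        = z a ⬝ᵥ (H a c) *ᵥ (z c) + ∑ b ∈ Finset.univ.erase a,
          if c ≠ b then z c ⬝ᵥ (H c b) *ᵥ (z b) else 0 := by
      intro c hc
      rw [← Finset.add_sum_erase _ _ (Finset.mem_univ a), if_pos (Finset.ne_of_mem_erase hc)]
      congr 1
      rw [hH a c, mulVec_transpose, dotProduct_comm, dotProduct_mulVec]
    rw [Finset.sum_congr rfl h1, Finset.sum_add_distrib]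
    have h2 : ∀ b ∈ Finset.univ.erase a, (if a ≠ b then z a ⬝ᵥ (H a b) *ᵥ (z b) else 0)
        = z a ⬝ᵥ (H a b) *ᵥ (z b) := fun b hb => if_pos (Finset.ne_of_mem_erase hb).symm
    rw [Finset.sum_congr rfl h2]
    simp only [ne_eq, not_true_eq_false, if_false]
    ring
  have hne : ∀ (w : J → ℝ), ∀ b ∈ Finset.univ.erase a, Function.update x a w b = x b :=
    fun w b hb => Function.update_of_ne (Finset.ne_of_mem_erase hb) _ _
  have hsecond : ∀ w : J → ℝ, (∑ c ∈ Finset.univ.erase a, ∑ b ∈ Finset.univ.erase a,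
        if c ≠ b then Function.update x a w c ⬝ᵥ (H c b) *ᵥ (Function.update x a w b) else 0)
      = ∑ c ∈ Finset.univ.erase a, ∑ b ∈ Finset.univ.erase a,
        if c ≠ b then x c ⬝ᵥ (H c b) *ᵥ (x b) else 0 := fun w =>
    Finset.sum_congr rfl fun c hc => Finset.sum_congr rfl fun b hb => by
      rw [hne w c hc, hne w b hb]
  rw [split, split, hsecond, hsecond]
  simp only [Function.update_self, zero_dotProduct, Finset.sum_const_zero, mul_zero, zero_add]
  rw [add_comm]
  congr 1
  have e : linPart H a x = ∑ b ∈ Finset.univ.erase a, (2 : ℝ) • ((H a b) *ᵥ (x b)) := by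
    ext j
    simp only [linPart, Finset.sum_apply, Pi.smul_apply, smul_dotProduct, mulVec]
  rw [e, sum_dotProduct, Finset.mul_sum]
  refine Finset.sum_congr rfl fun b hb => ?_
  rw [hne y b hb, smul_dotProduct, dotProduct_comm]
  simp

theorem map_update_pi_prod {V : Type*} [MeasurableSpace V] (m : ι → Measure V)
    [∀ a, IsProbabilityMeasure (m a)] (a : ι) (m' : Measure V) [IsProbabilityMeasure m'] :
    ((Measure.pi m).prod m').map (fun z : (ι → V) × V => Function.update z.1 a z.2)
      = Measure.pi (Function.update m a m') := by
  have : ∀ b, IsProbabilityMeasure (Function.update m a m' b) := by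
    intro b
    by_cases h : b = a
    · subst h; simpa using ‹IsProbabilityMeasure m'›
    · simpa [Function.update_of_ne h] using ‹∀ a, IsProbabilityMeasure (m a)› b
  have hmeas : Measurable (fun z : (ι → V) × V => Function.update z.1 a z.2) := by
    refine measurable_pi_lambda _ fun b => ?_
    by_cases h : b = a
    · subst h; simpa using measurable_snd
    · simp only [Function.update_of_ne h]
      exact (measurable_pi_apply b).comp measurable_fst
  symm
  refine Measure.pi_eq fun s hs => ?_
  rw [Measure.map_apply hmeas (MeasurableSet.univ_pi hs)]
  have hpre : (fun z : (ι → V) × V => Function.update z.1 a z.2) ⁻¹' Set.univ.pi s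
      = (Set.univ.pi (Function.update s a Set.univ)) ×ˢ s a := by
    ext z
    simp only [Set.mem_preimage, Set.mem_univ_pi, Set.mem_prod]
    constructor
    · intro h
      refine ⟨fun b => ?_, by simpa using h a⟩
      by_cases hb : b = a
      · subst hb; simp
      · simpa [Function.update_of_ne hb] using h b
    · rintro ⟨h1, h2⟩ b
      by_cases hb : b = a
      · subst hb; simpa using h2
      · simpa [Function.update_of_ne hb] using h1 b
  rw [hpre, Measure.prod_prod, Measure.pi_pi,
    ← Finset.mul_prod_erase _ _ (Finset.mem_univ a),
    ← Finset.mul_prod_erase _ (fun i => Function.update m a m' i (s i)) (Finset.mem_univ a)]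
  simp only [Function.update_self, measure_univ, one_mul]
  rw [mul_comm]
  congr 1
  refine Finset.prod_congr rfl fun b hb => ?_
  rw [Function.update_of_ne (Finset.ne_of_mem_erase hb),
    Function.update_of_ne (Finset.ne_of_mem_erase hb)]

end

theorem integral_pi_eval {ι V : Type*} [Fintype ι] [MeasurableSpace V] (m : ι → Measure V)
    [∀ a, IsProbabilityMeasure (m a)] (b : ι) {f : V → ℝ} (hf : AEStronglyMeasurable f (m b)) :
    ∫ x, f (x b) ∂(Measure.pi m) = ∫ y, f y ∂(m b) := by
  have hmp := measurePreserving_eval m b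
  rw [← hmp.map_eq, integral_map hmp.measurable.aemeasurable (by rwa [hmp.map_eq])]

section
variable {ι J : Type*} [Fintype ι] [Fintype J]

theorem moments_sum_dotProduct {κ : ℝ} (hκ : 3 ≤ κ) {m : ι → Measure (J → ℝ)}
    (hm : ∀ a, Isotropic κ (m a)) (s : Finset ι) (v : ι → J → ℝ) :
    MemLp (fun x : ι → J → ℝ => ∑ b ∈ s, v b ⬝ᵥ x b) 4 (Measure.pi m) ∧
    ∫ x, ∑ b ∈ s, v b ⬝ᵥ x b ∂(Measure.pi m) = 0 ∧
    ∫ x, (∑ b ∈ s, v b ⬝ᵥ x b) ^ 2 ∂(Measure.pi m) = ∑ b ∈ s, v b ⬝ᵥ v b ∧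
    ∫ x, (∑ b ∈ s, v b ⬝ᵥ x b) ^ 4 ∂(Measure.pi m) ≤ κ * (∑ b ∈ s, v b ⬝ᵥ v b) ^ 2 := by
  have : ∀ a, IsProbabilityMeasure (m a) := fun a => (hm a).prob
  have hmeas : ∀ b, Measurable (fun y : J → ℝ => v b ⬝ᵥ y) := fun b =>
    (continuous_const_dotProduct (v b)).measurable
  have hmem : ∀ b, MemLp (fun x : ι → J → ℝ => v b ⬝ᵥ x b) 4 (Measure.pi m) := fun b =>
    ((hm b).memLp (v b)).comp_measurePreserving (measurePreserving_eval m b)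
  have hind : iIndepFun (fun b (x : ι → J → ℝ) => v b ⬝ᵥ x b) (Measure.pi m) :=
    iIndepFun_pi (X := fun b (y : J → ℝ) => v b ⬝ᵥ y) fun b => (hmeas b).aemeasurable
  have e1 : ∀ b, ∫ x, v b ⬝ᵥ x b ∂(Measure.pi m) = 0 := fun b => by
    rw [integral_pi_eval m b (f := fun y => v b ⬝ᵥ y) (hmeas b).aestronglyMeasurable, (hm b).mean]
  have e2 : ∀ b, ∫ x, (v b ⬝ᵥ x b) ^ 2 ∂(Measure.pi m) = v b ⬝ᵥ v b := fun b => by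
    rw [integral_pi_eval m b (f := fun y => (v b ⬝ᵥ y) ^ 2)
      ((hmeas b).pow_const 2).aestronglyMeasurable, (hm b).second]
  have e4 : ∀ b, ∫ x, (v b ⬝ᵥ x b) ^ 4 ∂(Measure.pi m)
      ≤ κ * (∫ x, (v b ⬝ᵥ x b) ^ 2 ∂(Measure.pi m)) ^ 2 := fun b => by
    rw [e2, integral_pi_eval m b (f := fun y => (v b ⬝ᵥ y) ^ 4)
      ((hmeas b).pow_const 4).aestronglyMeasurable]
    exact (hm b).fourth _
  obtain ⟨h0, h2, h4⟩ := moments_sum_of_iIndepFun hind hmem e1 hκ e4 s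
  simp only [e2] at h2 h4
  exact ⟨memLp_finsetSum s fun b _ => hmem b, h0, h2, h4⟩

variable [DecidableEq ι]

theorem linPart_moments {κ : ℝ} (hκ : 3 ≤ κ) {m : ι → Measure (J → ℝ)}
    (hm : ∀ a, Isotropic κ (m a)) (H : ι → ι → Matrix J J ℝ) (a : ι) :
    Integrable (fun x => linPart H a x ⬝ᵥ linPart H a x) (Measure.pi m) ∧
    Integrable (fun x => (linPart H a x ⬝ᵥ linPart H a x) ^ 2) (Measure.pi m) ∧
    ∫ x, linPart H a x ⬝ᵥ linPart H a x ∂(Measure.pi m) = 4 * influence H a ∧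
    ∫ x, (linPart H a x ⬝ᵥ linPart H a x) ^ 2 ∂(Measure.pi m) ≤ κ * (4 * influence H a) ^ 2 := by
  have : ∀ a, IsProbabilityMeasure (m a) := fun a => (hm a).prob
  have hj := fun j => moments_sum_dotProduct hκ hm (Finset.univ.erase a)
    (fun b => (2 : ℝ) • H a b j)
  have hdot : ∀ x, linPart H a x ⬝ᵥ linPart H a x = ∑ j, linPart H a x j ^ 2 := fun x => by
    simp only [dotProduct, sq]
  have hsum : ∑ j, ∑ b ∈ Finset.univ.erase a, ((2 : ℝ) • H a b j) ⬝ᵥ ((2 : ℝ) • H a b j)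
      = 4 * influence H a := by
    rw [Finset.sum_comm, influence, Finset.mul_sum]
    refine Finset.sum_congr rfl fun b _ => ?_
    rw [Finset.mul_sum]
    refine Finset.sum_congr rfl fun j _ => ?_
    rw [smul_dotProduct, dotProduct_smul, smul_eq_mul, smul_eq_mul]; ring
  have i2 : ∀ j, Integrable (fun x => linPart H a x j ^ 2) (Measure.pi m) := fun j =>
    integrable_pow_of_memLp_four (hj j).1 (by norm_num)
  have hV := integral_sum_sq_sq_le (P := Measure.pi m) (L := fun j x => linPart H a x j)
    (fun j => (hj j).1) (s := fun j => ∑ b ∈ Finset.univ.erase a,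
      ((2 : ℝ) • H a b j) ⬝ᵥ ((2 : ℝ) • H a b j))
    (fun j => Finset.sum_nonneg fun _ _ => dotProduct_self_nonneg' _)
    (le_trans (by norm_num) hκ) (fun j => (hj j).2.2.2)
  simp only [hdot]
  rw [hsum] at hV
  refine ⟨integrable_finsetSum _ fun j _ => i2 j, hV.1, ?_, hV.2⟩
  rw [integral_finsetSum _ fun j _ => i2 j, ← hsum]
  exact Finset.sum_congr rfl fun j _ => (hj j).2.2.1

theorem integrable_exp_I_mul {Ω : Type*} [MeasurableSpace Ω] {P : Measure Ω}
    [IsProbabilityMeasure P] {f : Ω → ℝ} (hf : Measurable f) :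
    Integrable (fun ω => Complex.exp (Complex.I * (f ω : ℂ))) P := by
  refine Integrable.of_bound (C := 1) (Measurable.aestronglyMeasurable (by fun_prop))
    (ae_of_all _ fun y => ?_)
  rw [mul_comm, Complex.norm_exp_ofReal_mul_I]

/-- Replacing one coordinate of a product of isotropic laws changes the characteristic function
of an off-diagonal quadratic form by an amount controlled by the influence. -/
theorem norm_charFun_offdiag_update_sub_le {κ : ℝ} (hκ : 3 ≤ κ) {m : ι → Measure (J → ℝ)}
    (hm : ∀ a, Isotropic κ (m a)) {H : ι → ι → Matrix J J ℝ} (hH : ∀ a b, H b a = (H a b)ᵀ)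
    (a : ι) {m' : Measure (J → ℝ)} (hm' : Isotropic κ m') (t : ℝ) {ε : ℝ} (hε : 0 < ε) :
    ‖∫ x, Complex.exp (Complex.I * ((t * offdiag H x : ℝ) : ℂ)) ∂(Measure.pi m)
        - ∫ x, Complex.exp (Complex.I * ((t * offdiag H x : ℝ) : ℂ))
            ∂(Measure.pi (Function.update m a m'))‖
      ≤ 16 * |t| ^ 3 * (ε * influence H a + 4 * κ ^ 2 * influence H a ^ 2 / ε) := by
  have : ∀ a, IsProbabilityMeasure (m a) := fun a => (hm a).prob
  have hcont := continuous_offdiag H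
  have hupd : Measurable (fun z : (ι → J → ℝ) × (J → ℝ) => Function.update z.1 a z.2) := by
    refine (Continuous.update continuous_fst a continuous_snd).measurable
  have fub : ∀ m'' : Measure (J → ℝ), Isotropic κ m'' →
      Integrable (fun x => Complex.exp (Complex.I *
          ((t * offdiag H (Function.update x a 0) : ℝ) : ℂ))
        * ∫ y, Complex.exp (Complex.I * ((t * (linPart H a x ⬝ᵥ y) : ℝ) : ℂ)) ∂m'')
        (Measure.pi m) ∧
      ∫ x, Complex.exp (Complex.I * ((t * offdiag H x : ℝ) : ℂ))
        ∂(Measure.pi (Function.update m a m''))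
      = ∫ x, Complex.exp (Complex.I * ((t * offdiag H (Function.update x a 0) : ℝ) : ℂ))
        * ∫ y, Complex.exp (Complex.I * ((t * (linPart H a x ⬝ᵥ y) : ℝ) : ℂ)) ∂m''
          ∂(Measure.pi m) := by
    intro m'' h''
    have := h''.prob
    have hint : Integrable (fun z : (ι → J → ℝ) × (J → ℝ) => Complex.exp (Complex.I *
        ((t * offdiag H (Function.update z.1 a z.2) : ℝ) : ℂ))) ((Measure.pi m).prod m'') :=
      integrable_exp_I_mul ((hcont.measurable.comp hupd).const_mul t)
    have hfac : ∀ x y, Complex.exp (Complex.I *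
        ((t * offdiag H (Function.update x a y) : ℝ) : ℂ))
        = Complex.exp (Complex.I * ((t * offdiag H (Function.update x a 0) : ℝ) : ℂ))
          * Complex.exp (Complex.I * ((t * (linPart H a x ⬝ᵥ y) : ℝ) : ℂ)) := by
      intro x y
      rw [offdiag_update hH, ← Complex.exp_add]
      congr 1
      push_cast; ring
    have hinner : (fun x => ∫ y, Complex.exp (Complex.I *
        ((t * offdiag H (Function.update x a y) : ℝ) : ℂ)) ∂m'')
        = fun x => Complex.exp (Complex.I * ((t * offdiag H (Function.update x a 0) : ℝ) : ℂ))
          * ∫ y, Complex.exp (Complex.I * ((t * (linPart H a x ⬝ᵥ y) : ℝ) : ℂ)) ∂m'' := by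
      funext x
      rw [← integral_const_mul]
      exact integral_congr_ae (ae_of_all _ fun y => hfac x y)
    constructor
    · rw [← hinner]
      exact hint.integral_prod_left
    · rw [← map_update_pi_prod m a m'', integral_map hupd.aemeasurable
        (Continuous.aestronglyMeasurable (by fun_prop)), integral_prod _ hint, hinner]
  have h1 := fub (m a) (hm a)
  rw [Function.update_eq_self] at h1
  have h2 := fub m' hm'
  obtain ⟨iL, iL2, eL, eL2⟩ := linPart_moments hκ hm H a
  rw [h1.2, h2.2, ← integral_sub h1.1 h2.1]
  have ibd : Integrable (fun x => 4 * |t| ^ 3 * (ε * (linPart H a x ⬝ᵥ linPart H a x)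
      + κ * (linPart H a x ⬝ᵥ linPart H a x) ^ 2 / ε)) (Measure.pi m) :=
    ((iL.const_mul ε).add ((iL2.const_mul κ).div_const ε)).const_mul _
  refine (norm_integral_le_of_norm_le ibd (ae_of_all _ fun x => ?_)).trans ?_
  · rw [← mul_sub, norm_mul]
    have e1 : ‖Complex.exp (Complex.I * ((t * offdiag H (Function.update x a 0) : ℝ) : ℂ))‖
        = 1 := by
      rw [mul_comm, Complex.norm_exp_ofReal_mul_I]
    rw [e1, one_mul]
    have b1 := (hm a).norm_integral_exp_sub_le t (linPart H a x) hε
    have b2 := hm'.norm_integral_exp_sub_le t (linPart H a x) hε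
    rw [norm_sub_rev] at b2
    refine (norm_sub_le_norm_sub_add_norm_sub _ _ _).trans ((add_le_add b1 b2).trans ?_)
    linarith
  · rw [integral_const_mul, integral_add (iL.const_mul ε) ((iL2.const_mul κ).div_const ε),
      integral_const_mul, integral_div, integral_const_mul, eL]
    have hκ0 : 0 ≤ κ := le_trans (by norm_num) hκ
    have : κ * ∫ x, (linPart H a x ⬝ᵥ linPart H a x) ^ 2 ∂(Measure.pi m)
        ≤ κ * (κ * (4 * influence H a) ^ 2) := mul_le_mul_of_nonneg_left eL2 hκ0
    calc 4 * |t| ^ 3 * (ε * (4 * influence H a)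
          + κ * (∫ x, (linPart H a x ⬝ᵥ linPart H a x) ^ 2 ∂(Measure.pi m)) / ε)
        ≤ 4 * |t| ^ 3 * (ε * (4 * influence H a)
          + κ * (κ * (4 * influence H a) ^ 2) / ε) := by gcongr
      _ = _ := by ring

/-- Lindeberg replacement of all coordinates. -/
theorem norm_charFun_offdiag_sub_le {κ : ℝ} (hκ : 3 ≤ κ) {m m' : ι → Measure (J → ℝ)}
    (hm : ∀ a, Isotropic κ (m a)) (hm' : ∀ a, Isotropic κ (m' a)) {H : ι → ι → Matrix J J ℝ}
    (hH : ∀ a b, H b a = (H a b)ᵀ) (t : ℝ) {ε : ℝ} (hε : 0 < ε) :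
    ‖∫ x, Complex.exp (Complex.I * ((t * offdiag H x : ℝ) : ℂ)) ∂(Measure.pi m)
        - ∫ x, Complex.exp (Complex.I * ((t * offdiag H x : ℝ) : ℂ)) ∂(Measure.pi m')‖
      ≤ ∑ a, 16 * |t| ^ 3 * (ε * influence H a + 4 * κ ^ 2 * influence H a ^ 2 / ε) := by
  have key : ∀ s : Finset ι,
      ‖∫ x, Complex.exp (Complex.I * ((t * offdiag H x : ℝ) : ℂ)) ∂(Measure.pi m)
        - ∫ x, Complex.exp (Complex.I * ((t * offdiag H x : ℝ) : ℂ))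
            ∂(Measure.pi fun a => if a ∈ s then m' a else m a)‖
      ≤ ∑ a ∈ s, 16 * |t| ^ 3 * (ε * influence H a + 4 * κ ^ 2 * influence H a ^ 2 / ε) := by
    intro s
    induction s using Finset.induction_on with
    | empty => simp
    | insert a s ha ih =>
      have hfam : ∀ b, Isotropic κ ((fun a => if a ∈ s then m' a else m a) b) := by
        intro b
        by_cases hb : b ∈ s
        · simpa [hb] using hm' b
        · simpa [hb] using hm b
      have hins : (fun b => if b ∈ insert a s then m' b else m b)
          = Function.update (fun a => if a ∈ s then m' a else m a) a (m' a) := by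
        ext b : 1
        by_cases hb : b = a
        · subst hb; simp
        · simp [hb]
      have hstep := norm_charFun_offdiag_update_sub_le hκ hfam hH a (hm' a) t hε
      rw [hins, Finset.sum_insert ha, add_comm]
      exact (norm_sub_le_norm_sub_add_norm_sub _ _ _).trans (add_le_add ih hstep)
  simpa using key Finset.univ

/-- Lindeberg replacement under uniformly small influences. -/
theorem norm_charFun_offdiag_sub_le_of_influence_le {κ : ℝ} (hκ : 3 ≤ κ)
    {m m' : ι → Measure (J → ℝ)}
    (hm : ∀ a, Isotropic κ (m a)) (hm' : ∀ a, Isotropic κ (m' a)) {H : ι → ι → Matrix J J ℝ}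
    (hH : ∀ a b, H b a = (H a b)ᵀ) (t : ℝ) {δ : ℝ} (hδ : 0 < δ)
    (hsmall : ∀ a, influence H a ≤ δ ^ 2) (htot : ∑ a, influence H a ≤ 1) :
    ‖∫ x, Complex.exp (Complex.I * ((t * offdiag H x : ℝ) : ℂ)) ∂(Measure.pi m)
        - ∫ x, Complex.exp (Complex.I * ((t * offdiag H x : ℝ) : ℂ)) ∂(Measure.pi m')‖
      ≤ 80 * |t| ^ 3 * (κ * δ) := by
  have hκ0 : 0 < κ := by linarith
  refine (norm_charFun_offdiag_sub_le hκ hm hm' hH t (ε := κ * δ) (by positivity)).trans ?_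
  have h1 : ∀ a, 16 * |t| ^ 3 * (κ * δ * influence H a + 4 * κ ^ 2 * influence H a ^ 2 / (κ * δ))
      ≤ 80 * |t| ^ 3 * (κ * δ) * influence H a := by
    intro a
    have h0 := influence_nonneg H a
    have h2 : 4 * κ ^ 2 * influence H a ^ 2 / (κ * δ) ≤ 4 * (κ * δ) * influence H a := by
      rw [div_le_iff₀ (by positivity)]
      have := mul_le_mul_of_nonneg_left (hsmall a) h0
      nlinarith [mul_le_mul_of_nonneg_left this (by positivity : 0 ≤ 4 * κ ^ 2)]
    have h3 : 0 ≤ 16 * |t| ^ 3 := by positivity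
    nlinarith [mul_le_mul_of_nonneg_left h2 h3]
  refine (Finset.sum_le_sum fun a _ => h1 a).trans ?_
  rw [← Finset.mul_sum]
  exact mul_le_of_le_one_right (by positivity) htot

end

/-- The standard Gaussian law on `J → ℝ`. -/
abbrev stdPi (J : Type*) [Fintype J] : Measure (J → ℝ) := Measure.pi fun _ => gaussianReal 0 1

theorem integral_exp_I_mul_gaussianReal (c : ℝ) :
    ∫ x, Complex.exp (Complex.I * ((c * x : ℝ) : ℂ)) ∂(gaussianReal 0 1)
      = Complex.exp (((-(c * c) / 2 : ℝ)) : ℂ) := by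
  have h := charFun_gaussianReal (μ := 0) (v := 1) c
  rw [charFun_apply_real] at h
  rw [show (∫ x, Complex.exp (Complex.I * ((c * x : ℝ) : ℂ)) ∂(gaussianReal 0 1))
    = ∫ x : ℝ, Complex.exp (c * x * Complex.I) ∂(gaussianReal 0 1) from
      integral_congr_ae (ae_of_all _ fun x => by push_cast; ring_nf), h]
  congr 1
  push_cast; simp; ring

section
variable {J R : Type*} [Fintype J] [Fintype R]

theorem integral_exp_I_mul_stdPi (v : J → ℝ) :
    ∫ x, Complex.exp (Complex.I * ((v ⬝ᵥ x : ℝ) : ℂ)) ∂(stdPi J)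
      = Complex.exp ((-(v ⬝ᵥ v) / 2 : ℝ) : ℂ) := by
  have h : ∀ x : J → ℝ, Complex.exp (Complex.I * ((v ⬝ᵥ x : ℝ) : ℂ))
      = ∏ j, Complex.exp (Complex.I * ((v j * x j : ℝ) : ℂ)) := fun x => by
    rw [← Complex.exp_sum, ← Finset.mul_sum, dotProduct]; push_cast; rfl
  simp only [h]
  rw [integral_fintype_prod_eq_prod
    (f := fun j (y : ℝ) => Complex.exp (Complex.I * ((v j * y : ℝ) : ℂ)))]
  simp only [integral_exp_I_mul_gaussianReal]
  rw [← Complex.exp_sum, dotProduct]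
  congr 1
  push_cast
  rw [neg_div, Finset.sum_div, ← Finset.sum_neg_distrib]
  simp [neg_div]

/-- A random vector with the characteristic function of the standard Gaussian law has that law. -/
theorem map_eq_stdPi {E : Type*} [MeasurableSpace E] {P : Measure E} [IsProbabilityMeasure P]
    {Z : E → R → ℝ} (hZ : Measurable Z)
    (h : ∀ c : R → ℝ, ∫ e, Complex.exp (Complex.I * ((c ⬝ᵥ Z e : ℝ) : ℂ)) ∂P
      = Complex.exp ((-(c ⬝ᵥ c) / 2 : ℝ) : ℂ)) :
    P.map Z = stdPi R := by
  classical
  have := Measure.isProbabilityMeasure_map (μ := P) hZ.aemeasurable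
  refine Measure.ext_of_charFunDual ?_
  ext L
  have hL : ∀ x : R → ℝ, L x = (fun r => L (Pi.single r 1)) ⬝ᵥ x := fun x => by
    conv_lhs => rw [← Finset.univ_sum_single x]
    rw [map_sum, dotProduct]
    refine Finset.sum_congr rfl fun r _ => ?_
    rw [show (Pi.single r (x r) : R → ℝ) = x r • Pi.single r 1 by
      rw [← Pi.single_smul, smul_eq_mul, mul_one], map_smul, smul_eq_mul, mul_comm]
  have hLc : ∀ Q : Measure (R → ℝ), charFunDual Q L
      = ∫ x, Complex.exp (Complex.I * (((fun r => L (Pi.single r 1)) ⬝ᵥ x : ℝ) : ℂ)) ∂Q :=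
    fun Q => by
      rw [charFunDual_apply]
      refine integral_congr_ae (ae_of_all _ fun x => ?_)
      simp only [hL x, mul_comm Complex.I]
  rw [hLc, hLc, integral_exp_I_mul_stdPi, integral_map hZ.aemeasurable, h]
  have := continuous_const_dotProduct (fun r => L (Pi.single r 1))
  exact Continuous.aestronglyMeasurable (by fun_prop)

/-- Orthonormal linear forms of a Gaussian array form a standard Gaussian vector. -/
theorem map_pi_stdPi_eq [DecidableEq R] {ι : Type*} [Fintype ι] {T : R → ι → J → ℝ}
    (hT : ∀ r s, ∑ a, T r a ⬝ᵥ T s a = if r = s then 1 else 0) :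
    (Measure.pi fun _ : ι => stdPi J).map (fun x r => ∑ a, T r a ⬝ᵥ x a) = stdPi R := by
  refine map_eq_stdPi ?_ fun c => ?_
  · refine measurable_pi_lambda _ fun r => Finset.measurable_sum _ fun a _ => ?_
    exact (continuous_const_dotProduct (T r a)).measurable.comp (measurable_pi_apply a)
  set v : ι → J → ℝ := fun a => ∑ r, c r • T r a with hv
  have hlin : ∀ x : ι → J → ℝ, (c ⬝ᵥ fun r => ∑ a, T r a ⬝ᵥ x a) = ∑ a, v a ⬝ᵥ x a := fun x => by
    simp only [hv, sum_dotProduct, smul_dotProduct, smul_eq_mul]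
    rw [Finset.sum_comm]
    simp only [dotProduct, Finset.mul_sum]
  have hexp : ∀ x : ι → J → ℝ, Complex.exp (Complex.I * ((∑ a, v a ⬝ᵥ x a : ℝ) : ℂ))
      = ∏ a, Complex.exp (Complex.I * ((v a ⬝ᵥ x a : ℝ) : ℂ)) := fun x => by
    rw [← Complex.exp_sum, ← Finset.mul_sum]; push_cast; rfl
  have hvv : ∑ a, v a ⬝ᵥ v a = c ⬝ᵥ c := by
    simp only [hv, sum_dotProduct, dotProduct_sum, smul_dotProduct, dotProduct_smul, smul_eq_mul]
    rw [Finset.sum_comm, dotProduct]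
    refine Finset.sum_congr rfl fun r _ => ?_
    rw [← Finset.mul_sum, Finset.sum_comm]
    simp only [← Finset.mul_sum, hT]
    simp
  simp only [hlin, hexp]
  rw [integral_fintype_prod_eq_prod
    (f := fun a (y : J → ℝ) => Complex.exp (Complex.I * ((v a ⬝ᵥ y : ℝ) : ℂ)))]
  simp only [integral_exp_I_mul_stdPi]
  rw [← Complex.exp_sum, ← hvv]
  congr 1
  push_cast
  rw [neg_div, Finset.sum_div, ← Finset.sum_neg_distrib]
  simp [neg_div]

end

theorem integral_sum_sq_of_iIndepFun {Ω ι : Type*} [MeasurableSpace Ω] {P : Measure Ω}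
    [IsProbabilityMeasure P] {X : ι → Ω → ℝ} (hi : iIndepFun X P) (hX : ∀ b, MemLp (X b) 2 P)
    (hX0 : ∀ b, ∫ ω, X b ω ∂P = 0) (s : Finset ι) :
    ∫ ω, (∑ b ∈ s, X b ω) ^ 2 ∂P = ∑ b ∈ s, ∫ ω, X b ω ^ 2 ∂P := by
  have hv := IndepFun.variance_sum (s := s) (fun b _ => hX b)
    (fun a _ b _ hab => hi.indepFun hab)
  have hS : MemLp (fun ω => ∑ b ∈ s, X b ω) 2 P := memLp_finsetSum s fun b _ => hX b
  have e0 : ∫ ω, ∑ b ∈ s, X b ω ∂P = 0 := by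
    rw [integral_finsetSum _ fun b _ => (hX b).integrable (by norm_num)]
    exact Finset.sum_eq_zero fun b _ => hX0 b
  rw [show (∑ b ∈ s, X b) = fun ω => ∑ b ∈ s, X b ω by ext ω; simp,
    variance_of_integral_eq_zero hS.aestronglyMeasurable.aemeasurable e0] at hv
  rw [hv]
  exact Finset.sum_congr rfl fun b _ =>
    variance_of_integral_eq_zero (hX b).aestronglyMeasurable.aemeasurable (hX0 b)

theorem integral_sq_gaussianReal : ∫ x, x ^ 2 ∂(gaussianReal 0 1) = 1 := by
  have h := variance_id_gaussianReal (μ := 0) (v := 1)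
  rw [variance_of_integral_eq_zero aemeasurable_id (by simp)] at h
  simpa using h

/-- The fourth moment of the standard Gaussian law. -/
def gaussFour : ℝ := ∫ x, x ^ 4 ∂(gaussianReal 0 1)

/-- The variance of the chi-square law with one degree of freedom. -/
def chiVar : ℝ := ∫ x, (x ^ 2 - 1) ^ 2 ∂(gaussianReal 0 1)

theorem chiVar_nonneg : 0 ≤ chiVar := integral_nonneg fun _ => sq_nonneg _

theorem memLp_sq_sub_one_gaussianReal : MemLp (fun x : ℝ => x ^ 2 - 1) 2 (gaussianReal 0 1) := by
  have h4 : MemLp (id : ℝ → ℝ) 4 (gaussianReal 0 1) := memLp_id_gaussianReal' 4 (by norm_num)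
  refine MemLp.sub ?_ (memLp_const 1)
  rw [memLp_two_iff_integrable_sq (by fun_prop)]
  refine (integrable_pow_of_memLp_four h4 (k := 4) le_rfl).congr (ae_of_all _ fun x => ?_)
  simp only [id]; ring

theorem integral_sq_sub_one_gaussianReal : ∫ x, (x ^ 2 - 1) ∂(gaussianReal 0 1) = 0 := by
  have h4 : MemLp (id : ℝ → ℝ) 4 (gaussianReal 0 1) := memLp_id_gaussianReal' 4 (by norm_num)
  have h2 : Integrable (fun x : ℝ => x ^ 2) (gaussianReal 0 1) :=
    integrable_pow_of_memLp_four h4 (by norm_num)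
  rw [integral_sub h2 (integrable_const _)]
  have := integral_sq_gaussianReal
  simp [this]

section
variable {Ω R : Type*} [MeasurableSpace Ω] {P : Measure Ω} {g : R → Ω → ℝ}

theorem memLp_sq_sub_one (hg : ∀ r, Measurable (g r)) (hlaw : ∀ r, P.map (g r) = gaussianReal 0 1)
    (r : R) : MemLp (fun ω => g r ω ^ 2 - 1) 2 P := by
  have h := memLp_sq_sub_one_gaussianReal
  rw [← hlaw r] at h
  exact h.comp_of_map (hg r).aemeasurable

theorem integral_sq_sub_one (hg : ∀ r, Measurable (g r))
    (hlaw : ∀ r, P.map (g r) = gaussianReal 0 1) (r : R) : ∫ ω, (g r ω ^ 2 - 1) ∂P = 0 := by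
  rw [← integral_sq_sub_one_gaussianReal, ← hlaw r, integral_map (hg r).aemeasurable]
  exact Continuous.aestronglyMeasurable (by fun_prop)

/-- The second moment of a weighted centred chi-square sum. -/
theorem integral_weighted_chisq_sq [IsProbabilityMeasure P] (hi : iIndepFun g P)
    (hg : ∀ r, Measurable (g r)) (hlaw : ∀ r, P.map (g r) = gaussianReal 0 1) (c : R → ℝ)
    (s : Finset R) :
    ∫ ω, (∑ r ∈ s, c r * (g r ω ^ 2 - 1)) ^ 2 ∂P = chiVar * ∑ r ∈ s, c r ^ 2 := by
  have hind : iIndepFun (fun r ω => c r * (g r ω ^ 2 - 1)) P :=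
    hi.comp (fun r x => c r * (x ^ 2 - 1)) fun r => by fun_prop
  rw [integral_sum_sq_of_iIndepFun hind (fun r => (memLp_sq_sub_one hg hlaw r).const_mul _)
    (fun r => by rw [integral_const_mul, integral_sq_sub_one hg hlaw, mul_zero]), Finset.mul_sum]
  refine Finset.sum_congr rfl fun r _ => ?_
  simp only [mul_pow]
  rw [integral_const_mul, chiVar, ← hlaw r, integral_map (hg r).aemeasurable
    (Continuous.aestronglyMeasurable (by fun_prop)), mul_comm]

end

section
variable {J : Type*} [Fintype J]

theorem map_eval_stdPi (j : J) : (stdPi J).map (fun x => x j) = gaussianReal 0 1 :=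
  (measurePreserving_eval _ j).map_eq

theorem iIndepFun_stdPi : iIndepFun (fun j (x : J → ℝ) => x j) (stdPi J) :=
  iIndepFun_pi (X := fun _ (y : ℝ) => y) fun _ => aemeasurable_id

theorem isotropic_stdPi {κ : ℝ} (h3 : 3 ≤ κ) (h4 : gaussFour ≤ κ) : Isotropic κ (stdPi J) := by
  have hm4 : MemLp (id : ℝ → ℝ) 4 (gaussianReal 0 1) := memLp_id_gaussianReal' 4 (by norm_num)
  have hmem : ∀ (v : J → ℝ) j, MemLp (fun x : J → ℝ => v j * x j) 4 (stdPi J) := fun v j =>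
    (hm4.comp_measurePreserving (measurePreserving_eval _ j)).const_mul _
  have hev : ∀ (f : ℝ → ℝ) (_ : Continuous f) (j : J),
      ∫ x, f (x j) ∂(stdPi J) = ∫ y, f y ∂(gaussianReal 0 1) := fun f hf j =>
    integral_pi_eval _ j hf.aestronglyMeasurable
  have hind : ∀ v : J → ℝ, iIndepFun (fun j (x : J → ℝ) => v j * x j) (stdPi J) := fun v =>
    iIndepFun_stdPi.comp (fun j y => v j * y) fun j => by fun_prop
  have e2 : ∀ (v : J → ℝ) j, ∫ x, (v j * x j) ^ 2 ∂(stdPi J) = v j * v j := fun v j => by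
    rw [hev (fun y => (v j * y) ^ 2) (by fun_prop)]
    simp only [mul_pow]
    rw [integral_const_mul, integral_sq_gaussianReal, mul_one, sq]
  have main : ∀ v : J → ℝ, _ := fun v => moments_sum_of_iIndepFun (hind v) (hmem v)
    (fun j => by
      rw [hev (fun y => v j * y) (by fun_prop), integral_const_mul, integral_id_gaussianReal,
        mul_zero]) h3
    (fun j => by
      rw [e2, hev (fun y => (v j * y) ^ 4) (by fun_prop)]
      simp only [mul_pow]
      rw [integral_const_mul, ← gaussFour]
      nlinarith [mul_le_mul_of_nonneg_left h4 (by positivity : 0 ≤ v j ^ 4)]) Finset.univ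
  simp only [e2] at main
  exact ⟨inferInstance, fun v => memLp_finsetSum _ fun j _ => hmem v j, fun v => (main v).1,
    fun v => (main v).2.1, fun v => (main v).2.2⟩

/-- The centred quadratic form of a standard Gaussian vector: integrability, mean and second
moment. -/
theorem quadForm_stdPi [DecidableEq J] {B : Matrix J J ℝ} (hB : B.IsHermitian) :
    MemLp (fun x : J → ℝ => x ⬝ᵥ B *ᵥ x - B.trace) 2 (stdPi J) ∧
    ∫ x, (x ⬝ᵥ B *ᵥ x - B.trace) ∂(stdPi J) = 0 ∧
    ∫ x, (x ⬝ᵥ B *ᵥ x - B.trace) ^ 2 ∂(stdPi J) = chiVar * (B * B).trace := by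
  set U : Matrix J J ℝ := (hB.eigenvectorUnitary : Matrix J J ℝ) with hU
  set l := hB.eigenvalues with hl
  have hUU : Uᵀ * U = 1 := by
    have := Unitary.coe_star_mul_self hB.eigenvectorUnitary
    simpa [star_eq_conjTranspose] using this
  have hBU : B = U * diagonal l * Uᵀ := by
    have h := hB.spectral_theorem
    rw [Unitary.conjStarAlgAut_apply] at h
    simpa [star_eq_conjTranspose] using h
  have hmap : (stdPi J).map (fun x => Uᵀ *ᵥ x) = stdPi J := by
    refine map_eq_stdPi ?_ fun c => ?_
    · exact (Continuous.matrix_mulVec continuous_const continuous_id).measurable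
    · have : ∀ x : J → ℝ, c ⬝ᵥ Uᵀ *ᵥ x = (U *ᵥ c) ⬝ᵥ x := fun x => by
        rw [dotProduct_mulVec, vecMul_transpose]
      simp only [this]
      rw [integral_exp_I_mul_stdPi, ← this, mulVec_mulVec, hUU, one_mulVec]
  have htr : B.trace = ∑ r, l r := by
    rw [hBU, trace_mul_comm, ← Matrix.mul_assoc, hUU, Matrix.one_mul, trace_diagonal]
  have htr2 : (B * B).trace = ∑ r, l r ^ 2 := by
    have : B * B = U * (diagonal l * diagonal l) * Uᵀ := by
      rw [hBU]
      simp only [Matrix.mul_assoc]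
      rw [← Matrix.mul_assoc Uᵀ U, hUU, Matrix.one_mul]
    rw [this, trace_mul_comm, ← Matrix.mul_assoc, hUU, Matrix.one_mul, diagonal_mul_diagonal,
      trace_diagonal]
    simp only [sq]
  have hform : ∀ x : J → ℝ, x ⬝ᵥ B *ᵥ x - B.trace
      = ∑ r, l r * ((Uᵀ *ᵥ x) r ^ 2 - 1) := fun x => by
    rw [htr, hBU, ← mulVec_mulVec, ← mulVec_mulVec, dotProduct_mulVec, ← mulVec_transpose]
    simp only [dotProduct, mulVec_diagonal, mul_sub, mul_one, Finset.sum_sub_distrib]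
    congr 1
    exact Finset.sum_congr rfl fun r _ => by ring
  have hmeas : ∀ r, Measurable fun x : J → ℝ => (Uᵀ *ᵥ x) r := fun r =>
    (continuous_apply r).measurable.comp
      (Continuous.matrix_mulVec continuous_const continuous_id).measurable
  have hmU : Measurable fun x : J → ℝ => Uᵀ *ᵥ x := measurable_pi_lambda _ hmeas
  have hlaw : ∀ r, (stdPi J).map (fun x => (Uᵀ *ᵥ x) r) = gaussianReal 0 1 := fun r => by
    rw [← map_eval_stdPi r]
    conv_rhs => rw [← hmap]
    exact (Measure.map_map (measurable_pi_apply r) hmU).symm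
  have hind : iIndepFun (fun r (x : J → ℝ) => (Uᵀ *ᵥ x) r) (stdPi J) := by
    rw [iIndepFun_iff_map_fun_eq_pi_map fun r => (hmeas r).aemeasurable]
    simp only [hlaw]
    exact hmap
  simp only [hform]
  refine ⟨memLp_finsetSum _ fun r _ => (memLp_sq_sub_one hmeas hlaw r).const_mul _, ?_, ?_⟩
  · rw [integral_finsetSum _ fun r _ =>
      ((memLp_sq_sub_one hmeas hlaw r).const_mul _).integrable (by norm_num)]
    refine Finset.sum_eq_zero fun r _ => ?_
    rw [integral_const_mul, integral_sq_sub_one hmeas hlaw, mul_zero]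
  · rw [integral_weighted_chisq_sq hind hmeas hlaw, htr2]

/-- The diagonal part of a Gaussian quadratic form has second moment controlled by its diagonal
blocks. -/
theorem integral_diagPart_sq [DecidableEq J] {ι : Type*} [Fintype ι] {B : ι → Matrix J J ℝ}
    (hB : ∀ a, (B a).IsHermitian) :
    MemLp (fun x : ι → J → ℝ => ∑ a, (x a ⬝ᵥ B a *ᵥ x a - (B a).trace)) 2
      (Measure.pi fun _ => stdPi J) ∧
    ∫ x, (∑ a, (x a ⬝ᵥ B a *ᵥ x a - (B a).trace)) ^ 2 ∂(Measure.pi fun _ : ι => stdPi J)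
      = chiVar * ∑ a, (B a * B a).trace := by
  have hq := fun a => quadForm_stdPi (hB a)
  have hcont : ∀ a, Continuous fun y : J → ℝ => y ⬝ᵥ B a *ᵥ y - (B a).trace := fun a =>
    (continuous_id.dotProduct (Continuous.matrix_mulVec continuous_const continuous_id)).sub
      continuous_const
  have hmem : ∀ a, MemLp (fun x : ι → J → ℝ => x a ⬝ᵥ B a *ᵥ x a - (B a).trace) 2
      (Measure.pi fun _ => stdPi J) := fun a =>
    (hq a).1.comp_measurePreserving (measurePreserving_eval _ a)
  have hind : iIndepFun (fun a (x : ι → J → ℝ) => x a ⬝ᵥ B a *ᵥ x a - (B a).trace)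
      (Measure.pi fun _ => stdPi J) :=
    iIndepFun_pi (X := fun a (y : J → ℝ) => y ⬝ᵥ B a *ᵥ y - (B a).trace)
      fun a => (hcont a).measurable.aemeasurable
  refine ⟨memLp_finsetSum _ fun a _ => hmem a, ?_⟩
  rw [integral_sum_sq_of_iIndepFun hind hmem fun a => by
    rw [integral_pi_eval _ a (f := fun y : J → ℝ => y ⬝ᵥ B a *ᵥ y - (B a).trace)
      (hcont a).aestronglyMeasurable, (hq a).2.1], Finset.mul_sum]
  refine Finset.sum_congr rfl fun a _ => ?_
  rw [← (hq a).2.2, integral_pi_eval _ a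
    (f := fun y : J → ℝ => (y ⬝ᵥ B a *ᵥ y - (B a).trace) ^ 2)
    ((hcont a).pow 2).aestronglyMeasurable]

end

theorem integral_abs_le_of_integral_sq_le {Ω : Type*} [MeasurableSpace Ω] {P : Measure Ω}
    [IsProbabilityMeasure P] {f : Ω → ℝ} (hf : MemLp f 2 P) {c : ℝ} (hc : 0 ≤ c)
    (h : ∫ ω, f ω ^ 2 ∂P ≤ c ^ 2) : ∫ ω, |f ω| ∂P ≤ c := by
  have hv := variance_nonneg (fun ω => |f ω|) P
  rw [variance_eq_sub (X := fun ω => |f ω|) hf.abs] at hv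
  have he : ∫ ω, ((fun ω => |f ω|) ^ 2) ω ∂P = ∫ ω, f ω ^ 2 ∂P := by simp
  rw [he] at hv
  exact le_of_sq_le_sq (by linarith) hc

theorem norm_exp_I_mul_sub_le (x y : ℝ) :
    ‖Complex.exp (Complex.I * (x : ℂ)) - Complex.exp (Complex.I * (y : ℂ))‖ ≤ |x - y| := by
  have h : Complex.exp (Complex.I * (x : ℂ)) - Complex.exp (Complex.I * (y : ℂ))
      = Complex.exp (Complex.I * (y : ℂ)) * (Complex.exp (Complex.I * ((x - y : ℝ) : ℂ)) - 1) := by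
    rw [mul_sub, ← Complex.exp_add, mul_one]
    congr 2
    push_cast; ring
  rw [h, norm_mul, mul_comm Complex.I (y : ℂ), Complex.norm_exp_ofReal_mul_I, one_mul]
  exact Real.norm_exp_I_mul_ofReal_sub_one_le

section
variable {ι J R : Type*} [Fintype ι] [DecidableEq ι] [Fintype J] [Fintype R] [DecidableEq R]

/-- A spectral representation turns the full quadratic form into a weighted sum of squares. -/
theorem offdiag_eq_of_spectral {T : R → ι → J → ℝ}
    (hT : ∀ r s, ∑ a, T r a ⬝ᵥ T s a = if r = s then 1 else 0) {l : R → ℝ}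
    {H : ι → ι → Matrix J J ℝ}
    (hH : ∀ a b j j', H a b j j' = ∑ r, l r * (T r a j * T r b j')) (x : ι → J → ℝ) :
    offdiag H x = ∑ r, l r * ((∑ a, T r a ⬝ᵥ x a) ^ 2 - 1)
      - ∑ a, (x a ⬝ᵥ H a a *ᵥ x a - (H a a).trace) := by
  have hentry : ∀ a b, x a ⬝ᵥ H a b *ᵥ x b = ∑ r, l r * ((T r a ⬝ᵥ x a) * (T r b ⬝ᵥ x b)) := by
    intro a b
    simp only [dotProduct, mulVec, hH, Finset.mul_sum, Finset.sum_mul]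
    rw [Finset.sum_congr rfl fun j _ => Finset.sum_comm, Finset.sum_comm]
    refine Finset.sum_congr rfl fun r _ => ?_
    rw [Finset.sum_comm]
    refine Finset.sum_congr rfl fun j _ => Finset.sum_congr rfl fun j' _ => ?_
    ring
  have hfull : ∑ a, ∑ b, x a ⬝ᵥ H a b *ᵥ x b = ∑ r, l r * (∑ a, T r a ⬝ᵥ x a) ^ 2 := by
    simp only [hentry]
    rw [Finset.sum_congr rfl fun a _ => Finset.sum_comm, Finset.sum_comm]
    refine Finset.sum_congr rfl fun r _ => ?_
    rw [sq, Finset.sum_mul_sum, Finset.mul_sum]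
    simp only [Finset.mul_sum]
  have htr : ∑ a, (H a a).trace = ∑ r, l r := by
    simp only [trace, diag, hH]
    rw [Finset.sum_congr rfl fun a _ => Finset.sum_comm, Finset.sum_comm]
    refine Finset.sum_congr rfl fun r _ => ?_
    have h := hT r r
    simp only [dotProduct, if_true] at h
    simp only [← Finset.mul_sum, h, mul_one]
  have hsplit : ∑ a, ∑ b, x a ⬝ᵥ H a b *ᵥ x b
      = offdiag H x + ∑ a, x a ⬝ᵥ H a a *ᵥ x a := by
    rw [offdiag, ← Finset.sum_add_distrib]
    refine Finset.sum_congr rfl fun a _ => ?_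
    rw [← Finset.add_sum_erase _ _ (Finset.mem_univ a),
      ← Finset.add_sum_erase Finset.univ (fun b => if a ≠ b then x a ⬝ᵥ H a b *ᵥ x b else 0)
        (Finset.mem_univ a)]
    simp only [ne_eq, not_true_eq_false, if_false, zero_add]
    rw [add_comm]
    congr 1
    refine Finset.sum_congr rfl fun b hb => ?_
    rw [if_pos fun h => (Finset.ne_of_mem_erase hb) h.symm]
  simp only [mul_sub, mul_one, Finset.sum_sub_distrib, htr, ← hfull, hsplit]
  ring

/-- Comparison of an off-diagonal quadratic form of independent isotropic vectors with a weighted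
chi-square sum. -/
theorem norm_charFun_offdiag_sub_chisq_le {κ : ℝ} (h3 : 3 ≤ κ) (h4 : gaussFour ≤ κ)
    {m : ι → Measure (J → ℝ)} (hm : ∀ a, Isotropic κ (m a)) {T : R → ι → J → ℝ}
    (hT : ∀ r s, ∑ a, T r a ⬝ᵥ T s a = if r = s then 1 else 0) {l : R → ℝ}
    {H : ι → ι → Matrix J J ℝ}
    (hH : ∀ a b j j', H a b j j' = ∑ r, l r * (T r a j * T r b j')) (t : ℝ) {δ : ℝ} (hδ : 0 < δ)
    (hrow : ∀ a, ∑ b, ∑ j, H a b j ⬝ᵥ H a b j ≤ δ ^ 2)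
    (htot : ∑ a, ∑ b, ∑ j, H a b j ⬝ᵥ H a b j ≤ 1)
    (hdiag : ∑ a, ∑ j, H a a j ⬝ᵥ H a a j ≤ δ ^ 2) :
    ‖∫ x, Complex.exp (Complex.I * ((t * offdiag H x : ℝ) : ℂ)) ∂(Measure.pi m)
        - ∫ z, Complex.exp (Complex.I * ((t * ∑ r, l r * (z r ^ 2 - 1) : ℝ) : ℂ)) ∂(stdPi R)‖
      ≤ 80 * |t| ^ 3 * (κ * δ) + |t| * (Real.sqrt chiVar * δ) := by
  classical
  have hsymm : ∀ a b, H b a = (H a b)ᵀ := fun a b => by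
    ext j j'
    rw [transpose_apply, hH, hH]
    exact Finset.sum_congr rfl fun r _ => by ring
  have hinf : ∀ a, influence H a ≤ ∑ b, ∑ j, H a b j ⬝ᵥ H a b j := fun a =>
    Finset.sum_le_sum_of_subset_of_nonneg (Finset.erase_subset _ _) fun b _ _ =>
      Finset.sum_nonneg fun _ _ => dotProduct_self_nonneg' _
  have hL := norm_charFun_offdiag_sub_le_of_influence_le h3 hm
    (m' := fun _ => stdPi J) (fun _ => isotropic_stdPi h3 h4) hsymm t hδ
    (fun a => (hinf a).trans (hrow a)) ((Finset.sum_le_sum fun a _ => hinf a).trans htot)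
  refine (norm_sub_le_norm_sub_add_norm_sub _ _ _).trans (add_le_add hL ?_)
  have hZ : Measurable fun (x : ι → J → ℝ) r => ∑ a, T r a ⬝ᵥ x a := by
    refine measurable_pi_lambda _ fun r => Finset.measurable_sum _ fun a _ => ?_
    exact (continuous_const_dotProduct (T r a)).measurable.comp (measurable_pi_apply a)
  rw [← map_pi_stdPi_eq hT, integral_map hZ.aemeasurable
    (Continuous.aestronglyMeasurable (by fun_prop))]
  have hherm : ∀ a, (H a a).IsHermitian := fun a => by
    rw [IsHermitian, conjTranspose_eq_transpose_of_trivial]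
    exact (hsymm a a).symm
  obtain ⟨hDm, hD2⟩ := integral_diagPart_sq hherm
  have htr : ∀ a, (H a a * H a a).trace = ∑ j, H a a j ⬝ᵥ H a a j := fun a => by
    rw [trace]
    refine Finset.sum_congr rfl fun j _ => ?_
    rw [diag_apply, mul_apply, dotProduct]
    refine Finset.sum_congr rfl fun j' _ => ?_
    conv_lhs => rw [hsymm a a]
    rw [transpose_apply, transpose_apply, ← transpose_apply (H a a), ← hsymm a a]
  have hDbd := integral_abs_le_of_integral_sq_le hDm
    (c := Real.sqrt chiVar * δ) (by positivity) (by
      rw [hD2, mul_pow, Real.sq_sqrt chiVar_nonneg]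
      refine mul_le_mul_of_nonneg_left ?_ chiVar_nonneg
      simpa only [htr] using hdiag)
  have hq : Measurable fun x : ι → J → ℝ => t * ∑ r, l r * ((∑ a, T r a ⬝ᵥ x a) ^ 2 - 1) := by
    refine (Finset.measurable_sum _ fun r _ => ?_).const_mul t
    exact (((measurable_pi_apply r).comp hZ).pow_const 2 |>.sub_const 1).const_mul _
  rw [← integral_sub (integrable_exp_I_mul ((continuous_offdiag H).measurable.const_mul t))
    (integrable_exp_I_mul hq)]
  refine (norm_integral_le_of_norm_le ((hDm.integrable (by norm_num)).abs.const_mul |t|)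
    (ae_of_all _ fun x => ?_)).trans ?_
  · refine (norm_exp_I_mul_sub_le _ _).trans (le_of_eq ?_)
    rw [← abs_mul, offdiag_eq_of_spectral hT hH, ← abs_neg]
    congr 1
    ring
  · rw [integral_const_mul]
    exact mul_le_mul_of_nonneg_left hDbd (abs_nonneg t)

end

theorem enorm_nonneg {p : ℕ} (v : Fin p → ℝ) : 0 ≤ enorm v := Real.sqrt_nonneg _

theorem enorm_sq {p : ℕ} (v : Fin p → ℝ) : enorm v ^ 2 = v ⬝ᵥ v := by
  rw [enorm, Real.sq_sqrt (Finset.sum_nonneg fun _ _ => sq_nonneg _)]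
  simp only [dotProduct, sq]

theorem enorm_smul {p : ℕ} (c : ℝ) (v : Fin p → ℝ) : enorm (c • v) = |c| * enorm v := by
  simp only [enorm, Pi.smul_apply, smul_eq_mul, mul_pow]
  rw [← Finset.mul_sum, Real.sqrt_mul (sq_nonneg c), Real.sqrt_sq_eq_abs]

theorem enorm_eq_zero {p : ℕ} {v : Fin p → ℝ} : enorm v = 0 ↔ v = 0 := by
  rw [← sq_eq_zero_iff, enorm_sq, dotProduct_self_eq_zero]

theorem continuous_enorm {p : ℕ} : Continuous (enorm : (Fin p → ℝ) → ℝ) := by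
  unfold enorm
  fun_prop

theorem measurable_sgn {p : ℕ} : Measurable (sgn : (Fin p → ℝ) → Fin p → ℝ) := by
  unfold sgn
  exact continuous_enorm.measurable.inv.smul measurable_id

theorem sgn_smul {p : ℕ} {c : ℝ} (hc : 0 < c) (v : Fin p → ℝ) : sgn (c • v) = sgn v := by
  rw [sgn, sgn, enorm_smul, abs_of_pos hc, smul_smul]
  congr 1
  field_simp

theorem sgn_neg {p : ℕ} (v : Fin p → ℝ) : sgn (-v) = -sgn v := by
  have h : enorm (-v) = enorm v := by simp [enorm]
  rw [sgn, sgn, h, smul_neg]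

theorem abs_le_enorm {p : ℕ} (v : Fin p → ℝ) (j : Fin p) : |v j| ≤ enorm v := by
  rw [← Real.sqrt_sq_eq_abs, enorm]
  exact Real.sqrt_le_sqrt (Finset.single_le_sum (f := fun j => v j ^ 2)
    (fun _ _ => sq_nonneg _) (Finset.mem_univ j))

theorem abs_sgn_le_one {p : ℕ} (v : Fin p → ℝ) (j : Fin p) : |sgn v j| ≤ 1 := by
  rw [sgn, Pi.smul_apply, smul_eq_mul, abs_mul, abs_inv, abs_of_nonneg (enorm_nonneg v)]
  exact (mul_le_mul_of_nonneg_left (abs_le_enorm v j) (by simpa using enorm_nonneg v)).trans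
    (inv_mul_le_one)

theorem abs_dotProduct_sgn_le {p : ℕ} (v w : Fin p → ℝ) : |v ⬝ᵥ sgn w| ≤ ∑ j, |v j| := by
  refine (Finset.abs_sum_le_sum_abs _ _).trans (Finset.sum_le_sum fun j _ => ?_)
  rw [abs_mul]
  exact mul_le_of_le_one_right (abs_nonneg _) (abs_sgn_le_one w j)

theorem dotProduct_eq_zero_of_dotProduct_sgn {p : ℕ} {v w : Fin p → ℝ} (h : v ⬝ᵥ sgn w = 0) :
    v ⬝ᵥ w = 0 := by
  rw [sgn, dotProduct_smul, smul_eq_mul, mul_eq_zero, inv_eq_zero, enorm_eq_zero] at h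
  rcases h with h | h
  · rw [h, dotProduct_zero]
  · exact h

namespace Model

variable {Ω : Type} [MeasurableSpace Ω] (M : Model Ω)

theorem Y_eq (α : ℝ) (k : Fin 2) (i : Fin (M.n k)) (ω : Ω) :
    M.Y α k i ω = (M.ξ k i ω / |M.qA α k|) • (M.Rhalf k *ᵥ M.u k i ω) := by
  ext j
  have hd : Real.sqrt (M.d0 k j) ≠ 0 := (Real.sqrt_pos.2 (M.hd0 k j)).ne'
  have hξ : (fun m => M.ξ k i ω * M.u k i ω m) = M.ξ k i ω • M.u k i ω := rfl
  rw [Y, X, dT, Real.sqrt_mul (sq_nonneg _), Real.sqrt_sq_eq_abs, hξ, mulVec_smul]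
  simp only [Pi.smul_apply, smul_eq_mul]
  rw [add_sub_cancel_left, mul_comm (|M.qA α k|), mul_div_mul_left _ _ hd]
  ring

/-- The sign of a scaled elliptical vector, as a function of its radius and direction. -/
def signMap (α : ℝ) (k : Fin 2) (z : ℝ × (Fin M.p → ℝ)) : Fin M.p → ℝ :=
  sgn ((z.1 / |M.qA α k|) • (M.Rhalf k *ᵥ z.2))

theorem S_eq (α : ℝ) (k : Fin 2) (i : Fin (M.n k)) (ω : Ω) :
    M.S α k i ω = M.signMap α k (M.ξ k i ω, M.u k i ω) := by
  rw [S, Y_eq, signMap]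

theorem measurable_signMap (α : ℝ) (k : Fin 2) : Measurable (M.signMap α k) := by
  refine measurable_sgn.comp ?_
  exact (measurable_fst.div_const _).smul
    ((Continuous.matrix_mulVec continuous_const continuous_id).measurable.comp measurable_snd)

theorem measurable_S (α : ℝ) (k : Fin 2) (i : Fin (M.n k)) : Measurable (M.S α k i) := by
  rw [show M.S α k i = fun ω => M.signMap α k (M.ξ k i ω, M.u k i ω) from funext (M.S_eq α k i)]
  exact (M.measurable_signMap α k).comp ((M.hmξ k i).prodMk (M.hmu k i))

theorem identDistrib_S (α : ℝ) (k : Fin 2) (i i' : Fin (M.n k)) :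
    IdentDistrib (M.S α k i) (M.S α k i') M.μ M.μ := by
  have h := (M.hident k i i').comp (M.measurable_signMap α k)
  rw [show M.S α k i = fun ω => M.signMap α k (M.ξ k i ω, M.u k i ω) from funext (M.S_eq α k i),
    show M.S α k i' = fun ω => M.signMap α k (M.ξ k i' ω, M.u k i' ω) from funext (M.S_eq α k i')]
  exact h

theorem iIndepFun_S (α : ℝ) :
    iIndepFun (fun (ki : (k : Fin 2) × Fin (M.n k)) ω => M.S α ki.1 ki.2 ω) M.μ := by
  have h := M.hindep.comp (fun ki => M.signMap α ki.1) fun ki => M.measurable_signMap α ki.1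
  simp only [S_eq]
  exact h

theorem S_ae_eq {α : ℝ} {k : Fin 2} (hq : M.qA α k ≠ 0) (i : Fin (M.n k)) :
    ∀ᵐ ω ∂M.μ, M.S α k i ω = sgn (M.Rhalf k *ᵥ M.u k i ω) := by
  filter_upwards [M.hξpos k i] with ω hω
  rw [S_eq, signMap, sgn_smul (div_pos hω (abs_pos.2 hq))]

theorem abs_dotProduct_S_le (α : ℝ) (k : Fin 2) (i : Fin (M.n k)) (v : Fin M.p → ℝ) (ω : Ω) :
    |v ⬝ᵥ M.S α k i ω| ≤ ∑ j, |v j| := abs_dotProduct_sgn_le _ _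

theorem measurable_dotProduct_S (α : ℝ) (k : Fin 2) (i : Fin (M.n k)) (v : Fin M.p → ℝ) :
    Measurable fun ω => v ⬝ᵥ M.S α k i ω :=
  (continuous_const_dotProduct v).measurable.comp (M.measurable_S α k i)

theorem memLp_dotProduct_S (α : ℝ) (k : Fin 2) (i : Fin (M.n k)) (v : Fin M.p → ℝ) (q : ENNReal) :
    MemLp (fun ω => v ⬝ᵥ M.S α k i ω) q M.μ := by
  have := M.hμ
  exact MemLp.of_bound (M.measurable_dotProduct_S α k i v).aestronglyMeasurable (∑ j, |v j|)
    (ae_of_all _ fun ω => M.abs_dotProduct_S_le α k i v ω)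

theorem integral_dotProduct_S {α : ℝ} {k : Fin 2} (hq : M.qA α k ≠ 0) (i : Fin (M.n k))
    (v : Fin M.p → ℝ) : ∫ ω, v ⬝ᵥ M.S α k i ω ∂M.μ = 0 := by
  have hm : Measurable fun u : Fin M.p → ℝ => v ⬝ᵥ sgn (M.Rhalf k *ᵥ u) :=
    (continuous_const_dotProduct v).measurable.comp (measurable_sgn.comp
      (Continuous.matrix_mulVec continuous_const continuous_id).measurable)
  have hneg : ∀ u : Fin M.p → ℝ, v ⬝ᵥ sgn (M.Rhalf k *ᵥ (-u)) = -(v ⬝ᵥ sgn (M.Rhalf k *ᵥ u)) :=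
    fun u => by rw [mulVec_neg, sgn_neg, dotProduct_neg]
  have hrot := M.hrot k i (-1) (by simp)
  simp only [neg_mulVec, one_mulVec] at hrot
  have h1 : ∫ ω, v ⬝ᵥ M.S α k i ω ∂M.μ = ∫ ω, v ⬝ᵥ sgn (M.Rhalf k *ᵥ M.u k i ω) ∂M.μ := by
    refine integral_congr_ae ?_
    filter_upwards [M.S_ae_eq hq i] with ω hω
    rw [hω]
  have h2 : ∫ ω, v ⬝ᵥ sgn (M.Rhalf k *ᵥ M.u k i ω) ∂M.μ
      = -∫ ω, v ⬝ᵥ sgn (M.Rhalf k *ᵥ M.u k i ω) ∂M.μ := by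
    conv_lhs => rw [← integral_map (φ := M.u k i) (M.hmu k i).aemeasurable
      (f := fun u => v ⬝ᵥ sgn (M.Rhalf k *ᵥ u)) hm.aestronglyMeasurable, ← hrot,
      integral_map (φ := fun ω => -M.u k i ω) (M.hmu k i).neg.aemeasurable
        hm.aestronglyMeasurable]
    rw [← integral_neg]
    exact integral_congr_ae (ae_of_all _ fun ω => hneg _)
  rw [h1]
  linarith

theorem integral_dotProduct_S_sq (α : ℝ) (k : Fin 2) (i : Fin (M.n k)) (v : Fin M.p → ℝ) :
    ∫ ω, (v ⬝ᵥ M.S α k i ω) ^ 2 ∂M.μ = v ⬝ᵥ M.Omat α k *ᵥ v := by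
  have hid : IdentDistrib (fun ω => (v ⬝ᵥ M.S α k i ω) ^ 2)
      (fun ω => (v ⬝ᵥ M.S α k (M.o0 k) ω) ^ 2) M.μ M.μ :=
    (M.identDistrib_S α k i (M.o0 k)).comp ((continuous_const_dotProduct v).measurable.pow_const 2)
  rw [hid.integral_eq]
  have hint : ∀ a b, Integrable
      (fun ω => M.S α k (M.o0 k) ω a * M.S α k (M.o0 k) ω b) M.μ := fun a b => by
    have := M.hμ
    have hc : ∀ c, Measurable fun ω => M.S α k (M.o0 k) ω c := fun c =>
      (measurable_pi_apply c).comp (M.measurable_S α k _)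
    refine Integrable.of_bound (C := 1) ((hc a).mul (hc b)).aestronglyMeasurable
      (ae_of_all _ fun ω => ?_)
    rw [Real.norm_eq_abs, abs_mul]
    exact mul_le_one₀ (abs_sgn_le_one _ _) (abs_nonneg _) (abs_sgn_le_one _ _)
  simp only [sq, dotProduct, mulVec, Finset.sum_mul_sum, Omat, of_apply]
  rw [integral_finsetSum _ fun a _ => integrable_finsetSum _ fun b _ =>
    ((hint a b).const_mul (v a * v b)).congr (ae_of_all _ fun ω => by simp only; ring)]
  refine Finset.sum_congr rfl fun a _ => ?_
  rw [integral_finsetSum _ fun b _ =>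
    ((hint a b).const_mul (v a * v b)).congr (ae_of_all _ fun ω => by simp only; ring),
    Finset.mul_sum]
  refine Finset.sum_congr rfl fun b _ => ?_
  rw [← integral_mul_const, ← integral_const_mul]
  exact integral_congr_ae (ae_of_all _ fun ω => by simp only; ring)

end Model

theorem eq_zero_of_mul_self_eq_zero {p : ℕ} {A : Matrix (Fin p) (Fin p) ℝ} (hA : A.PosSemidef)
    (h : A * A = 0) : A = 0 := by
  have h1 : Aᴴ * A = 0 := by rw [hA.isHermitian.eq, h]
  exact conjTranspose_mul_self_eq_zero.1 h1

namespace Model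

variable {Ω : Type} [MeasurableSpace Ω] (M : Model Ω)

/-- A nonzero linear form cannot annihilate a uniform direction. -/
theorem eq_zero_of_dotProduct_u (k : Fin 2) (i : Fin (M.n k)) {w : Fin M.p → ℝ}
    (h : ∀ᵐ ω ∂M.μ, w ⬝ᵥ M.u k i ω = 0) : w = 0 := by
  have := M.hμ
  have hrot : ∀ (v : Fin M.p → ℝ) (Q : Matrix (Fin M.p) (Fin M.p) ℝ), Q * Qᵀ = 1 →
      (∀ᵐ ω ∂M.μ, v ⬝ᵥ M.u k i ω = 0) → ∀ᵐ ω ∂M.μ, v ⬝ᵥ Q *ᵥ M.u k i ω = 0 := by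
    intro v Q hQ hv
    have hset : MeasurableSet {x : Fin M.p → ℝ | v ⬝ᵥ x = 0} :=
      (continuous_const_dotProduct v).measurable (measurableSet_singleton 0)
    have hQm : Measurable fun ω => Q *ᵥ M.u k i ω :=
      (Continuous.matrix_mulVec continuous_const continuous_id).measurable.comp (M.hmu k i)
    have h1 : ∀ᵐ x ∂(M.μ.map (M.u k i)), v ⬝ᵥ x = 0 :=
      (ae_map_iff (M.hmu k i).aemeasurable hset).2 hv
    rw [← M.hrot k i Q hQ] at h1
    exact (ae_map_iff hQm.aemeasurable hset).1 h1
  by_contra hw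
  obtain ⟨j, hj⟩ := Function.ne_iff.1 hw
  have hflip := hrot w (diagonal fun l => if l = j then -1 else 1) (by
    rw [diagonal_transpose, diagonal_mul_diagonal, ← diagonal_one]
    congr 1
    ext l
    split_ifs <;> norm_num) h
  have huj : ∀ᵐ ω ∂M.μ, (Pi.single j 1 : Fin M.p → ℝ) ⬝ᵥ M.u k i ω = 0 := by
    filter_upwards [h, hflip] with ω h1 h2
    have h3 : w ⬝ᵥ (diagonal fun l => if l = j then (-1 : ℝ) else 1) *ᵥ M.u k i ω
        = w ⬝ᵥ M.u k i ω - 2 * (w j * M.u k i ω j) := by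
      have : (diagonal fun l => if l = j then (-1 : ℝ) else 1) *ᵥ M.u k i ω
          = M.u k i ω - Pi.single j (2 * M.u k i ω j) := by
        ext l
        rw [mulVec_diagonal, Pi.sub_apply]
        by_cases hl : l = j
        · subst hl; simp; ring
        · simp [hl]
      rw [this, dotProduct_sub, dotProduct_single]
      ring
    rw [h1, h2] at h3
    rw [single_dotProduct, one_mul]
    have h4 : w j * M.u k i ω j = 0 := by linarith
    exact (mul_eq_zero.1 h4).resolve_left hj
  have hall : ∀ l, ∀ᵐ ω ∂M.μ, M.u k i ω l = 0 := by
    intro l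
    have hsw := hrot (Pi.single j 1) ((Equiv.swap j l).toPEquiv.toMatrix) (by
      rw [← PEquiv.toMatrix_symm, ← Equiv.toPEquiv_symm, ← PEquiv.toMatrix_trans,
        ← Equiv.toPEquiv_trans, Equiv.self_trans_symm, Equiv.toPEquiv_refl,
        PEquiv.toMatrix_refl]) huj
    filter_upwards [hsw] with ω hω
    simpa [single_dotProduct, PEquiv.toMatrix_toPEquiv_mulVec] using hω
  obtain ⟨ω, h1, h2⟩ := ((M.hunit k i).and (ae_all_iff.2 hall)).exists
  simp [h2] at h1

/-- The angular covariance is nondegenerate. -/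
theorem isUnit_sqrt_Omat {α : ℝ} {k : Fin 2} (hq : M.qA α k ≠ 0)
    {A : Matrix (Fin M.p) (Fin M.p) ℝ} (hA : A * A = M.Omat α k) : IsUnit A.det := by
  rw [isUnit_iff_ne_zero]
  intro hdet
  obtain ⟨v, hv0, hv⟩ := exists_mulVec_eq_zero_iff.2 hdet
  refine hv0 ?_
  have h0 : ∫ ω, (v ⬝ᵥ M.S α k (M.o0 k) ω) ^ 2 ∂M.μ = 0 := by
    rw [M.integral_dotProduct_S_sq, ← hA, ← mulVec_mulVec, hv, mulVec_zero, dotProduct_zero]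
  rw [integral_eq_zero_iff_of_nonneg (fun _ => sq_nonneg _)
    (M.memLp_dotProduct_S α k _ v 2).integrable_sq] at h0
  have hw : (M.Rhalf k)ᵀ *ᵥ v = 0 := by
    refine M.eq_zero_of_dotProduct_u k (M.o0 k) ?_
    filter_upwards [h0, M.S_ae_eq hq (M.o0 k)] with ω h1 h2
    have h3 : v ⬝ᵥ M.S α k (M.o0 k) ω = 0 := by simpa using h1
    rw [h2] at h3
    rw [mulVec_transpose, ← dotProduct_mulVec]
    exact dotProduct_eq_zero_of_dotProduct_sgn h3
  by_contra hne
  have := (M.hRpd k).dotProduct_mulVec_pos hne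
  rw [← mulVec_mulVec, hw, mulVec_zero, dotProduct_zero] at this
  exact lt_irrefl _ this

/-- The quantile scale cannot vanish when `B_n` is nonzero. -/
theorem qA_ne_zero {α : ℝ} {Oh : Fin 2 → Matrix (Fin M.p) (Fin M.p) ℝ}
    (hOh : ∀ k, (Oh k).PosSemidef ∧ Oh k * Oh k = M.Omat α k)
    (hB : M.Bn α Oh ≠ 0) (k : Fin 2) : M.qA α k ≠ 0 := by
  intro hq
  refine hB ?_
  have hY : ∀ i ω, M.Y α k i ω = 0 := fun i ω => by rw [Y_eq, hq]; simp
  have hS : ∀ i ω, M.S α k i ω = 0 := fun i ω => by rw [S, hY, sgn, smul_zero]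
  have hO : Oh k = 0 := by
    refine eq_zero_of_mul_self_eq_zero (hOh k).1 ?_
    rw [(hOh k).2]
    ext a b
    simp [Omat, hS]
  have hG : M.Gmat α k = 0 := by
    ext a b
    have : enorm (0 : Fin M.p → ℝ) = 0 := enorm_eq_zero.2 rfl
    simp [Gmat, hY, this]
  match k, hO, hG with
  | 0, hO, hG => simp [Bn, hO, K2, hG, symPart]
  | 1, hO, hG => simp [Bn, hO, K1, hG, symPart]

theorem bddAbove_fourth (α : ℝ) (k : Fin 2) (A : Matrix (Fin M.p) (Fin M.p) ℝ) :
    BddAbove ((fun a => ∫ ω, (vecMul a A ⬝ᵥ M.S α k (M.o0 k) ω) ^ 4 ∂M.μ) ''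
      {a : Fin M.p → ℝ | enorm a = 1}) := by
  have := M.hμ
  refine ⟨(∑ j, ∑ l, |A l j|) ^ 4, ?_⟩
  rintro _ ⟨a, ha, rfl⟩
  have hbd : ∀ ω, (vecMul a A ⬝ᵥ M.S α k (M.o0 k) ω) ^ 4 ≤ (∑ j, ∑ l, |A l j|) ^ 4 := by
    intro ω
    rw [← Even.pow_abs (by decide : Even 4)]
    refine pow_le_pow_left₀ (abs_nonneg _) ((M.abs_dotProduct_S_le α k _ _ ω).trans ?_) 4
    refine Finset.sum_le_sum fun j _ => ?_
    rw [vecMul, dotProduct]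
    refine (Finset.abs_sum_le_sum_abs _ _).trans ?_
    refine Finset.sum_le_sum fun l _ => ?_
    rw [abs_mul]
    exact mul_le_of_le_one_left (abs_nonneg _) ((abs_le_enorm a l).trans (le_of_eq ha))
  have h := integral_mono (integrable_pow_of_memLp_four (M.memLp_dotProduct_S α k (M.o0 k)
    (vecMul a A) 4) (k := 4) le_rfl) (integrable_const _) hbd
  simpa using h

theorem one_le_curv_and (α MY : ℝ) (Oh : Fin 2 → Matrix (Fin M.p) (Fin M.p) ℝ) :
    1 ≤ M.curv α MY Oh ∧ ∀ k, sSup ((fun a => ∫ ω,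
      (vecMul a (Oh k)⁻¹ ⬝ᵥ M.S α k (M.o0 k) ω) ^ 4 ∂M.μ) '' {a : Fin M.p → ℝ | enorm a = 1})
      ≤ M.curv α MY Oh := by
  have hs : ∀ k, 0 ≤ sSup ((fun a => ∫ ω,
      (vecMul a (Oh k)⁻¹ ⬝ᵥ M.S α k (M.o0 k) ω) ^ 4 ∂M.μ) ''
        {a : Fin M.p → ℝ | enorm a = 1}) := fun k => by
    refine Real.sSup_nonneg ?_
    rintro _ ⟨a, _, rfl⟩
    exact integral_nonneg fun ω => by positivity
  have h4 : ∀ x : ℝ, 0 ≤ x ^ 4 := fun x => by positivity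
  constructor
  · have := le_max_of_le_left (c := (opNorm ((Real.sqrt M.p : ℝ) • M.Gmat α 1) +
          opNorm (((Real.sqrt M.p : ℝ) • M.Gmat α 1)⁻¹)) ^ 4 +
        sSup ((fun a => ∫ ω, (Matrix.vecMul a (Oh 1)⁻¹ ⬝ᵥ M.S α 1 (M.o0 1) ω) ^ 4 ∂M.μ) ''
          {a : Fin M.p → ℝ | enorm a = 1})) (add_nonneg (h4 (opNorm ((Real.sqrt M.p : ℝ) •
            M.Gmat α 0) + opNorm (((Real.sqrt M.p : ℝ) • M.Gmat α 0)⁻¹))) (hs 0))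
    rw [curv]
    nlinarith [sq_nonneg MY]
  · intro k
    have h1 : (0 : ℝ) ≤ 1 + MY ^ 2 := by positivity
    rw [curv]
    refine le_add_of_nonneg_of_le h1 ?_
    match k with
    | 0 => exact le_max_of_le_left (le_add_of_nonneg_left (h4 _))
    | 1 => exact le_max_of_le_right (le_add_of_nonneg_left (h4 _))

/-- The law of the whitened signs is isotropic. -/
theorem isotropic_whitened {α MY κ : ℝ} {Oh : Fin 2 → Matrix (Fin M.p) (Fin M.p) ℝ}
    (hOh : ∀ k, (Oh k).PosSemidef ∧ Oh k * Oh k = M.Omat α k) {k : Fin 2} (hq : M.qA α k ≠ 0)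
    (hκ : M.curv α MY Oh ≤ κ) (i : Fin (M.n k)) :
    Isotropic κ (M.μ.map fun ω => (Oh k)⁻¹ *ᵥ M.S α k i ω) := by
  have := M.hμ
  have hdet := M.isUnit_sqrt_Omat hq (hOh k).2
  have hV : Measurable fun ω => (Oh k)⁻¹ *ᵥ M.S α k i ω :=
    (Continuous.matrix_mulVec continuous_const continuous_id).measurable.comp
      (M.measurable_S α k i)
  have hform : ∀ (v : Fin M.p → ℝ) ω,
      v ⬝ᵥ (Oh k)⁻¹ *ᵥ M.S α k i ω = vecMul v (Oh k)⁻¹ ⬝ᵥ M.S α k i ω := fun v ω =>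
    dotProduct_mulVec _ _ _
  have hpow : ∀ (v : Fin M.p → ℝ) (q : ℕ),
      ∫ x, (v ⬝ᵥ x) ^ q ∂(M.μ.map fun ω => (Oh k)⁻¹ *ᵥ M.S α k i ω)
        = ∫ ω, (vecMul v (Oh k)⁻¹ ⬝ᵥ M.S α k i ω) ^ q ∂M.μ := fun v q => by
    rw [integral_map (f := fun x => (v ⬝ᵥ x) ^ q) hV.aemeasurable
      ((continuous_const_dotProduct v).pow q).aestronglyMeasurable]
    simp only [hform]
  refine ⟨Measure.isProbabilityMeasure_map hV.aemeasurable, fun v => ?_, fun v => ?_, fun v => ?_,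
    fun v => ?_⟩
  · rw [memLp_map_measure_iff (continuous_const_dotProduct v).aestronglyMeasurable
      hV.aemeasurable]
    refine (M.memLp_dotProduct_S α k i (vecMul v (Oh k)⁻¹) 4).congr_norm
      ((continuous_const_dotProduct v).measurable.comp hV).aestronglyMeasurable
      (ae_of_all _ fun ω => ?_)
    rw [Function.comp, hform]
  · have h := hpow v 1
    simp only [pow_one] at h
    rw [h, M.integral_dotProduct_S hq]
  · have hT : (Oh k)ᵀ = Oh k := by
      rw [← conjTranspose_eq_transpose_of_trivial]; exact (hOh k).1.isHermitian.eq
    rw [hpow, M.integral_dotProduct_S_sq, ← (hOh k).2]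
    have h1 : vecMul v (Oh k)⁻¹ = (Oh k)⁻¹ *ᵥ v := by
      rw [← mulVec_transpose, transpose_nonsing_inv, hT]
    rw [h1, mulVec_mulVec, Matrix.mul_assoc, mul_nonsing_inv _ hdet, Matrix.mul_one, ← h1,
      ← dotProduct_mulVec, mulVec_mulVec, nonsing_inv_mul _ hdet, one_mulVec]
  · rw [hpow]
    have hid : IdentDistrib (fun ω => (vecMul v (Oh k)⁻¹ ⬝ᵥ M.S α k i ω) ^ 4)
        (fun ω => (vecMul v (Oh k)⁻¹ ⬝ᵥ M.S α k (M.o0 k) ω) ^ 4) M.μ M.μ :=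
      (M.identDistrib_S α k i (M.o0 k)).comp
        ((continuous_const_dotProduct _).measurable.pow_const 4)
    rw [hid.integral_eq]
    by_cases hv : v = 0
    · subst hv; simp
    have hn : enorm v ≠ 0 := fun h => hv (enorm_eq_zero.1 h)
    have hva : v = enorm v • ((enorm v)⁻¹ • v) := by rw [smul_smul, mul_inv_cancel₀ hn, one_smul]
    have ha : enorm ((enorm v)⁻¹ • v) = 1 := by
      rw [enorm_smul, abs_of_nonneg (inv_nonneg.2 (enorm_nonneg v)), inv_mul_cancel₀ hn]
    have hle := (le_csSup (M.bddAbove_fourth α k (Oh k)⁻¹) ⟨_, ha, rfl⟩).trans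
      (((M.one_le_curv_and α MY Oh).2 k).trans hκ)
    have hscale : ∫ ω, (vecMul v (Oh k)⁻¹ ⬝ᵥ M.S α k (M.o0 k) ω) ^ 4 ∂M.μ
        = (enorm v) ^ 4 *
          ∫ ω, (vecMul ((enorm v)⁻¹ • v) (Oh k)⁻¹ ⬝ᵥ M.S α k (M.o0 k) ω) ^ 4 ∂M.μ := by
      rw [← integral_const_mul]
      refine integral_congr_ae (ae_of_all _ fun ω => ?_)
      simp only
      rw [← mul_pow, smul_vecMul, smul_dotProduct, smul_eq_mul, mul_inv_cancel_left₀ hn]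
    rw [hscale, show (v ⬝ᵥ v) ^ 2 = enorm v ^ 4 by rw [← enorm_sq]; ring, mul_comm κ]
    exact mul_le_mul_of_nonneg_left hle (by positivity)

end Model

/-- Coordinate `j` of block `k` among the `2p` coordinates. -/
def blockIdx {p : ℕ} (k : Fin 2) (j : Fin p) : Fin p ⊕ Fin p :=
  if k = 0 then Sum.inl j else Sum.inr j

theorem sum_blockIdx {p : ℕ} (F : Fin p ⊕ Fin p → ℝ) :
    ∑ j, F (blockIdx 0 j) + ∑ j, F (blockIdx 1 j) = ∑ s, F s := by
  simp [blockIdx, Fintype.sum_sum_type]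

theorem trace_mul_self_of_isSymm {ι : Type*} [Fintype ι] {B : Matrix ι ι ℝ} (hB : Bᵀ = B) :
    (B * B).trace = ∑ s, ∑ s', B s s' ^ 2 := by
  simp only [trace, diag_apply, mul_apply]
  refine Finset.sum_congr rfl fun s _ => Finset.sum_congr rfl fun s' _ => ?_
  rw [show B s' s = B s s' by conv_lhs => rw [← hB, transpose_apply]]
  ring

theorem sumCode_injective (p : ℕ) : Function.Injective (sumCode p) := by
  rintro (a | a) (b | b) h <;> simp only [sumCode, Sum.elim_inl, Sum.elim_inr] at h
  · rw [Fin.ext h]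
  · have := a.2; omega
  · have := b.2; omega
  · rw [Fin.ext (by omega : (a : ℕ) = b)]

namespace Model

variable {Ω : Type} [MeasurableSpace Ω] (M : Model Ω)

/-- The weight `n_k^{-1/2}` of an observation from sample `k`. -/
def weight (a : (k : Fin 2) × Fin (M.n k)) : ℝ := (Real.sqrt (M.n a.1))⁻¹

theorem n_pos (k : Fin 2) : (0 : ℝ) < M.n k := by
  have := M.hn k
  exact_mod_cast (by omega : 0 < M.n k)

theorem n0_pos : (0 : ℝ) < M.n0 := by
  have h0 := M.hn 0
  have h1 := M.hn 1
  have : 0 < M.n0 := by rw [n0]; omega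
  exact_mod_cast this

theorem weight_sq (a : (k : Fin 2) × Fin (M.n k)) : M.weight a ^ 2 = (M.n a.1 : ℝ)⁻¹ := by
  rw [weight, inv_pow, Real.sq_sqrt (M.n_pos _).le]

theorem weight_sq_le (a : (k : Fin 2) × Fin (M.n k)) : M.weight a ^ 2 ≤ (M.n0 : ℝ)⁻¹ := by
  rw [weight_sq]
  refine inv_anti₀ M.n0_pos (Nat.cast_le.2 ?_)
  rcases a with ⟨k, i⟩
  match k with
  | 0 => exact min_le_left _ _
  | 1 => exact min_le_right _ _

theorem sum_weight_sq_mul (f : Fin 2 → ℝ) : ∑ a, M.weight a ^ 2 * f a.1 = f 0 + f 1 := by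
  rw [Fintype.sum_sigma, Fin.sum_univ_two]
  simp [weight_sq, (M.n_pos _).ne']

/-- The kernel of `U_n / τ_n` in terms of whitened signs. -/
def kernel (α : ℝ) (Oh : Fin 2 → Matrix (Fin M.p) (Fin M.p) ℝ)
    (a b : (k : Fin 2) × Fin (M.n k)) : Matrix (Fin M.p) (Fin M.p) ℝ :=
  (M.weight a * M.weight b / M.τ α Oh) • (M.Bn α Oh).submatrix (blockIdx a.1) (blockIdx b.1)

/-- Squared Frobenius norm of a block of `B_n / τ_n`. -/
def blockMass (α : ℝ) (Oh : Fin 2 → Matrix (Fin M.p) (Fin M.p) ℝ) (k l : Fin 2) : ℝ :=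
  ∑ j, ∑ j', (M.Bn α Oh (blockIdx k j) (blockIdx l j') / M.τ α Oh) ^ 2

variable {M} {α : ℝ} {Oh : Fin 2 → Matrix (Fin M.p) (Fin M.p) ℝ}

theorem blockMass_nonneg (k l : Fin 2) : 0 ≤ M.blockMass α Oh k l :=
  Finset.sum_nonneg fun _ _ => Finset.sum_nonneg fun _ _ => sq_nonneg _

theorem kernel_mass (a b : (k : Fin 2) × Fin (M.n k)) :
    ∑ j, M.kernel α Oh a b j ⬝ᵥ M.kernel α Oh a b j
      = M.weight a ^ 2 * (M.weight b ^ 2 * M.blockMass α Oh a.1 b.1) := by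
  simp only [blockMass, Finset.mul_sum, dotProduct]
  refine Finset.sum_congr rfl fun j _ => Finset.sum_congr rfl fun j' _ => ?_
  simp only [kernel, Matrix.smul_apply, submatrix_apply, smul_eq_mul]
  ring

theorem sum_blockMass (hB : (M.Bn α Oh)ᵀ = M.Bn α Oh)
    (htr : 0 < (M.Bn α Oh * M.Bn α Oh).trace) :
    M.blockMass α Oh 0 0 + M.blockMass α Oh 0 1 +
      (M.blockMass α Oh 1 0 + M.blockMass α Oh 1 1) = 2⁻¹ := by
  have h : ∀ k, M.blockMass α Oh k 0 + M.blockMass α Oh k 1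
      = ∑ j, ∑ s, (M.Bn α Oh (blockIdx k j) s / M.τ α Oh) ^ 2 := fun k => by
    rw [blockMass, blockMass, ← Finset.sum_add_distrib]
    exact Finset.sum_congr rfl fun j _ =>
      sum_blockIdx fun s => (M.Bn α Oh (blockIdx k j) s / M.τ α Oh) ^ 2
  rw [h, h, sum_blockIdx fun s' => ∑ s, (M.Bn α Oh s' s / M.τ α Oh) ^ 2]
  have hτ : M.τ α Oh ^ 2 = 2 * (M.Bn α Oh * M.Bn α Oh).trace := by
    rw [τ, Real.sq_sqrt (by rw [τsq]; positivity), τsq]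
  simp only [div_pow, hτ]
  simp only [← Finset.sum_div]
  rw [← trace_mul_self_of_isSymm hB]
  field_simp

theorem kernel_row_le (hB : (M.Bn α Oh)ᵀ = M.Bn α Oh)
    (htr : 0 < (M.Bn α Oh * M.Bn α Oh).trace) (a : (k : Fin 2) × Fin (M.n k)) :
    ∑ b, ∑ j, M.kernel α Oh a b j ⬝ᵥ M.kernel α Oh a b j ≤ (M.n0 : ℝ)⁻¹ := by
  simp only [kernel_mass]
  rw [← Finset.mul_sum, M.sum_weight_sq_mul (M.blockMass α Oh a.1)]
  have hs := sum_blockMass hB htr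
  have h := blockMass_nonneg (M := M) (α := α) (Oh := Oh)
  have hle : M.blockMass α Oh a.1 0 + M.blockMass α Oh a.1 1 ≤ 1 := by
    rcases a with ⟨k, i⟩
    match k with
    | 0 => linarith [h 1 0, h 1 1]
    | 1 => linarith [h 0 0, h 0 1]
  calc _ ≤ M.weight a ^ 2 * 1 := mul_le_mul_of_nonneg_left hle (sq_nonneg _)
    _ ≤ _ := by rw [mul_one]; exact M.weight_sq_le a

theorem kernel_total_le (hB : (M.Bn α Oh)ᵀ = M.Bn α Oh)
    (htr : 0 < (M.Bn α Oh * M.Bn α Oh).trace) :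
    ∑ a, ∑ b, ∑ j, M.kernel α Oh a b j ⬝ᵥ M.kernel α Oh a b j ≤ 1 := by
  simp only [kernel_mass, ← Finset.mul_sum]
  simp only [M.sum_weight_sq_mul (M.blockMass α Oh _)]
  rw [M.sum_weight_sq_mul fun k => M.blockMass α Oh k 0 + M.blockMass α Oh k 1,
    sum_blockMass hB htr]
  norm_num

theorem kernel_diag_le (hB : (M.Bn α Oh)ᵀ = M.Bn α Oh)
    (htr : 0 < (M.Bn α Oh * M.Bn α Oh).trace) :
    ∑ a, ∑ j, M.kernel α Oh a a j ⬝ᵥ M.kernel α Oh a a j ≤ (M.n0 : ℝ)⁻¹ := by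
  have h := blockMass_nonneg (M := M) (α := α) (Oh := Oh)
  have hs := sum_blockMass hB htr
  have hinv : (0 : ℝ) < (M.n0 : ℝ)⁻¹ := inv_pos.2 M.n0_pos
  calc ∑ a, ∑ j, M.kernel α Oh a a j ⬝ᵥ M.kernel α Oh a a j
      ≤ ∑ a, (M.n0 : ℝ)⁻¹ * (M.weight a ^ 2 * M.blockMass α Oh a.1 a.1) := by
        refine Finset.sum_le_sum fun a _ => ?_
        rw [kernel_mass]
        exact mul_le_mul_of_nonneg_right (M.weight_sq_le a) (mul_nonneg (sq_nonneg _) (h _ _))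
    _ = (M.n0 : ℝ)⁻¹ * (M.blockMass α Oh 0 0 + M.blockMass α Oh 1 1) := by
        rw [← Finset.mul_sum, M.sum_weight_sq_mul fun k => M.blockMass α Oh k k]
    _ ≤ (M.n0 : ℝ)⁻¹ * 1 :=
        mul_le_mul_of_nonneg_left (by linarith [h 0 1, h 1 0]) hinv.le
    _ = _ := mul_one _

theorem dotProduct_whitened {p : ℕ} {A B K : Matrix (Fin p) (Fin p) ℝ} (hA : Aᵀ = A)
    (hAu : IsUnit A.det) (hBu : IsUnit B.det) (x y : Fin p → ℝ) :
    A⁻¹ *ᵥ x ⬝ᵥ (A * K * B) *ᵥ (B⁻¹ *ᵥ y) = x ⬝ᵥ K *ᵥ y := by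
  rw [mulVec_mulVec, Matrix.mul_assoc, mul_nonsing_inv _ hBu, Matrix.mul_one, ← mulVec_mulVec,
    dotProduct_mulVec, ← mulVec_transpose, hA, mulVec_mulVec, mul_nonsing_inv _ hAu, one_mulVec]

/-- The normalized statistic is an off-diagonal quadratic form in the whitened signs. -/
theorem Un_div_τ_eq (hOs : ∀ k, (Oh k)ᵀ = Oh k) (hOu : ∀ k, IsUnit (Oh k).det) (ω : Ω) :
    M.Un α ω / M.τ α Oh
      = offdiag (M.kernel α Oh) fun a => (Oh a.1)⁻¹ *ᵥ M.S α a.1 a.2 ω := by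
  have hn : ∀ k, (M.n k : ℝ) ≠ 0 := fun k => (M.n_pos k).ne'
  have hs : ∀ k, Real.sqrt (M.n k) * Real.sqrt (M.n k) = M.n k := fun k =>
    Real.mul_self_sqrt (M.n_pos k).le
  have hs0 : ∀ k, Real.sqrt (M.n k) ≠ 0 := fun k => (Real.sqrt_pos.2 (M.n_pos k)).ne'
  have hb00 : (M.Bn α Oh).submatrix (blockIdx 0) (blockIdx 0)
      = (M.n 0 : ℝ)⁻¹ • (Oh 0 * M.K1 α * Oh 0) := by
    ext i j; simp [Bn, blockIdx]
  have hb11 : (M.Bn α Oh).submatrix (blockIdx 1) (blockIdx 1)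
      = (M.n 1 : ℝ)⁻¹ • (Oh 1 * M.K2 α * Oh 1) := by
    ext i j; simp [Bn, blockIdx]
  have hb01 : (M.Bn α Oh).submatrix (blockIdx 0) (blockIdx 1)
      = (-(2 * Real.sqrt ((M.n 0 : ℝ) * (M.n 1 : ℝ)))⁻¹) • (Oh 0 * M.K3 α * Oh 1) := by
    ext i j; simp [Bn, blockIdx]
  have hb10 : (M.Bn α Oh).submatrix (blockIdx 1) (blockIdx 0)
      = (-(2 * Real.sqrt ((M.n 0 : ℝ) * (M.n 1 : ℝ)))⁻¹) • (Oh 1 * (M.K3 α)ᵀ * Oh 0) := by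
    ext i j; simp [Bn, blockIdx]
  have h00 : ∀ i j, (Oh 0)⁻¹ *ᵥ M.S α 0 i ω ⬝ᵥ M.kernel α Oh ⟨0, i⟩ ⟨0, j⟩ *ᵥ
      ((Oh 0)⁻¹ *ᵥ M.S α 0 j ω) = ((M.n 0 : ℝ) ^ 2)⁻¹ * (M.τ α Oh)⁻¹ *
        (M.S α 0 i ω ⬝ᵥ (M.K1 α) *ᵥ M.S α 0 j ω) := fun i j => by
    rw [kernel, hb00, smul_smul, smul_mulVec, dotProduct_smul,
      dotProduct_whitened (hOs 0) (hOu 0) (hOu 0), smul_eq_mul, weight, weight, ← mul_inv, hs]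
    field_simp [hn 0]
  have h11 : ∀ i j, (Oh 1)⁻¹ *ᵥ M.S α 1 i ω ⬝ᵥ M.kernel α Oh ⟨1, i⟩ ⟨1, j⟩ *ᵥ
      ((Oh 1)⁻¹ *ᵥ M.S α 1 j ω) = ((M.n 1 : ℝ) ^ 2)⁻¹ * (M.τ α Oh)⁻¹ *
        (M.S α 1 i ω ⬝ᵥ (M.K2 α) *ᵥ M.S α 1 j ω) := fun i j => by
    rw [kernel, hb11, smul_smul, smul_mulVec, dotProduct_smul,
      dotProduct_whitened (hOs 1) (hOu 1) (hOu 1), smul_eq_mul, weight, weight, ← mul_inv, hs]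
    field_simp [hn 1]
  have hw : ∀ x y : ℝ, x * x = M.n 0 → y * y = M.n 1 → x ≠ 0 → y ≠ 0 →
      x⁻¹ * y⁻¹ / M.τ α Oh * -(2 * (x * y))⁻¹
        = -(2⁻¹ * ((M.n 0 : ℝ) * M.n 1)⁻¹ * (M.τ α Oh)⁻¹) := by
    intro x y hx hy hx0 hy0
    rw [← hx, ← hy]
    field_simp
  have h01 : ∀ i j, (Oh 0)⁻¹ *ᵥ M.S α 0 i ω ⬝ᵥ M.kernel α Oh ⟨0, i⟩ ⟨1, j⟩ *ᵥ
      ((Oh 1)⁻¹ *ᵥ M.S α 1 j ω) = -(2⁻¹ * ((M.n 0 : ℝ) * M.n 1)⁻¹ * (M.τ α Oh)⁻¹) *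
        (M.S α 0 i ω ⬝ᵥ (M.K3 α) *ᵥ M.S α 1 j ω) := fun i j => by
    rw [kernel, hb01, smul_smul, smul_mulVec, dotProduct_smul,
      dotProduct_whitened (hOs 0) (hOu 0) (hOu 1), smul_eq_mul, weight, weight,
      Real.sqrt_mul (M.n_pos 0).le, hw _ _ (hs 0) (hs 1) (hs0 0) (hs0 1)]
  have h10 : ∀ i j, (Oh 1)⁻¹ *ᵥ M.S α 1 i ω ⬝ᵥ M.kernel α Oh ⟨1, i⟩ ⟨0, j⟩ *ᵥ
      ((Oh 0)⁻¹ *ᵥ M.S α 0 j ω) = -(2⁻¹ * ((M.n 0 : ℝ) * M.n 1)⁻¹ * (M.τ α Oh)⁻¹) *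
        (M.S α 0 j ω ⬝ᵥ (M.K3 α) *ᵥ M.S α 1 i ω) := fun i j => by
    rw [kernel, hb10, smul_smul, smul_mulVec, dotProduct_smul,
      dotProduct_whitened (hOs 1) (hOu 1) (hOu 0), smul_eq_mul, weight, weight,
      Real.sqrt_mul (M.n_pos 0).le, mul_comm (Real.sqrt (M.n 1))⁻¹,
      hw _ _ (hs 0) (hs 1) (hs0 0) (hs0 1), mulVec_transpose, dotProduct_comm,
      ← dotProduct_mulVec]
  have hne : ∀ (k : Fin 2) (i j : Fin (M.n k)),
      ((⟨k, i⟩ : (k : Fin 2) × Fin (M.n k)) ≠ ⟨k, j⟩) ↔ i ≠ j := fun k i j => by simp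
  have hne01 : ∀ (i : Fin (M.n 0)) (j : Fin (M.n 1)),
      (⟨0, i⟩ : (k : Fin 2) × Fin (M.n k)) ≠ ⟨1, j⟩ := fun i j h => by
    have := congrArg Sigma.fst h
    simp at this
  rw [offdiag]
  simp only [Fintype.sum_sigma, Fin.sum_univ_two, hne, hne01, (hne01 _ _).symm, h00, h11, h01,
    h10, ne_eq, not_false_eq_true, if_true, Finset.sum_add_distrib]
  rw [Finset.sum_comm (f := fun (i : Fin (M.n 1)) (j : Fin (M.n 0)) =>
    -(2⁻¹ * ((M.n 0 : ℝ) * M.n 1)⁻¹ * (M.τ α Oh)⁻¹) *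
        (M.S α 0 j ω ⬝ᵥ (M.K3 α) *ᵥ M.S α 1 i ω))]
  simp only [← mul_ite_zero, ← Finset.mul_sum]
  rw [Un]
  simp only [ne_eq]
  ring

end Model

namespace Model

variable {Ω : Type} [MeasurableSpace Ω] {M : Model Ω} {α : ℝ}
  {Oh : Fin 2 → Matrix (Fin M.p) (Fin M.p) ℝ}

theorem measurable_Un_div (M : Model Ω) (α c : ℝ) : Measurable fun ω => M.Un α ω / c := by
  have h : ∀ (k l : Fin 2) (i : Fin (M.n k)) (j : Fin (M.n l))
      (K : Matrix (Fin M.p) (Fin M.p) ℝ),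
      Measurable fun ω => M.S α k i ω ⬝ᵥ K *ᵥ M.S α l j ω := fun k l i j K => by
    have hc : Continuous fun z : (Fin M.p → ℝ) × (Fin M.p → ℝ) => z.1 ⬝ᵥ K *ᵥ z.2 :=
      continuous_fst.dotProduct (continuous_const.matrix_mulVec continuous_snd)
    exact hc.measurable.comp ((M.measurable_S α k i).prodMk (M.measurable_S α l j))
  have hite : ∀ (k : Fin 2) (i j : Fin (M.n k)) (K : Matrix (Fin M.p) (Fin M.p) ℝ),
      Measurable fun ω => if i ≠ j then M.S α k i ω ⬝ᵥ K *ᵥ M.S α k j ω else 0 :=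
    fun k i j K => by
      split_ifs
      · exact h k k i j K
      · exact measurable_const
  unfold Un
  refine Measurable.div_const (Measurable.sub (Measurable.add ?_ ?_) ?_) c
  all_goals
    refine Measurable.const_mul (Finset.measurable_sum _ fun i _ =>
      Finset.measurable_sum _ fun j _ => ?_) _
  · exact hite 0 i j _
  · exact hite 1 i j _
  · exact h 0 1 i j _

/-- Quantitative comparison of the characteristic functions of `U_n/τ_n` and `Γ_n/τ_n`. -/
theorem norm_charFun_Un_sub_GammaStat_le {MY κ : ℝ}
    (hOh : ∀ k, (Oh k).PosSemidef ∧ Oh k * Oh k = M.Omat α k)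
    {lam : Fin M.p ⊕ Fin M.p → ℝ}
    {Q : Matrix (Fin M.p ⊕ Fin M.p) (Fin M.p ⊕ Fin M.p) ℝ} (hQ : Q * Qᵀ = 1)
    (hB : M.Bn α Oh = Qᵀ * Matrix.diagonal lam * Q)
    (htr : 0 < (M.Bn α Oh * M.Bn α Oh).trace)
    (h3 : 3 ≤ κ) (h4 : gaussFour ≤ κ) (hκ : M.curv α MY Oh ≤ κ)
    {Ω' : Type} [MeasurableSpace Ω'] {μ' : Measure Ω'} [IsProbabilityMeasure μ']
    {g : ℕ → Ω' → ℝ} (hgm : ∀ r, Measurable (g r)) (hgi : iIndepFun g μ')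
    (hglaw : ∀ r, μ'.map (g r) = gaussianReal 0 1) (t : ℝ) :
    ‖∫ ω, Complex.exp (Complex.I * ((t * (M.Un α ω / M.τ α Oh) : ℝ) : ℂ)) ∂M.μ
        - ∫ ω', Complex.exp (Complex.I *
            ((t * (GammaStat lam g ω' / M.τ α Oh) : ℝ) : ℂ)) ∂μ'‖
      ≤ 80 * |t| ^ 3 * (κ * (Real.sqrt M.n0)⁻¹)
        + |t| * (Real.sqrt chiVar * (Real.sqrt M.n0)⁻¹) := by
  have := M.hμ
  have hOs : ∀ k, (Oh k)ᵀ = Oh k := fun k => by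
    rw [← conjTranspose_eq_transpose_of_trivial]; exact (hOh k).1.isHermitian.eq
  have hB0 : M.Bn α Oh ≠ 0 := fun h => by simp [h] at htr
  have hq := M.qA_ne_zero hOh hB0
  have hOu : ∀ k, IsUnit (Oh k).det := fun k => M.isUnit_sqrt_Omat (hq k) (hOh k).2
  have hBs : (M.Bn α Oh)ᵀ = M.Bn α Oh := by
    rw [hB, transpose_mul, transpose_mul, diagonal_transpose, transpose_transpose,
      Matrix.mul_assoc]
  have hδ : (0 : ℝ) < (Real.sqrt M.n0)⁻¹ := inv_pos.2 (Real.sqrt_pos.2 M.n0_pos)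
  have hδ2 : ((Real.sqrt M.n0)⁻¹) ^ 2 = (M.n0 : ℝ)⁻¹ := by
    rw [inv_pow, Real.sq_sqrt M.n0_pos.le]
  set V : (a : (k : Fin 2) × Fin (M.n k)) → Ω → Fin M.p → ℝ :=
    fun a ω => (Oh a.1)⁻¹ *ᵥ M.S α a.1 a.2 ω with hV
  have hmul : ∀ A : Matrix (Fin M.p) (Fin M.p) ℝ, Measurable fun x : Fin M.p → ℝ => A *ᵥ x :=
    fun A => (Continuous.matrix_mulVec continuous_const continuous_id).measurable
  have hVm : ∀ a, Measurable (V a) := fun a => (hmul _).comp (M.measurable_S α a.1 a.2)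
  have hVi : iIndepFun V M.μ :=
    (M.iIndepFun_S α).comp (fun a => fun x => (Oh a.1)⁻¹ *ᵥ x) fun a => hmul _
  have hVlaw := (iIndepFun_iff_map_fun_eq_pi_map fun a => (hVm a).aemeasurable).1 hVi
  have hVm' : Measurable fun ω a => V a ω := measurable_pi_lambda _ hVm
  have hgm' : Measurable fun ω' (r : Fin M.p ⊕ Fin M.p) => g (sumCode M.p r + 1) ω' :=
    measurable_pi_lambda _ fun r => hgm _
  have hgi' : iIndepFun (fun r : Fin M.p ⊕ Fin M.p => g (sumCode M.p r + 1)) μ' :=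
    hgi.precomp ((add_left_injective 1).comp (sumCode_injective M.p))
  have hglaw' := (iIndepFun_iff_map_fun_eq_pi_map fun r => (hgm _).aemeasurable).1 hgi'
  simp only [hglaw] at hglaw'
  change _ = stdPi _ at hglaw'
  have key := norm_charFun_offdiag_sub_chisq_le h3 h4
    (m := fun a => M.μ.map (V a)) (fun a => M.isotropic_whitened hOh (hq a.1) hκ a.2)
    (T := fun r a j => M.weight a * Q r (blockIdx a.1 j)) (l := fun r => lam r / M.τ α Oh)
    (H := M.kernel α Oh) (δ := (Real.sqrt M.n0)⁻¹) ?_ ?_ t hδ ?_ (kernel_total_le hBs htr) ?_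
  rotate_left
  · intro r s
    have h1 : ∀ a : (k : Fin 2) × Fin (M.n k), (fun j => M.weight a * Q r (blockIdx a.1 j)) ⬝ᵥ
        (fun j => M.weight a * Q s (blockIdx a.1 j))
        = M.weight a ^ 2 * ∑ j, Q r (blockIdx a.1 j) * Q s (blockIdx a.1 j) := fun a => by
      rw [dotProduct, Finset.mul_sum]
      exact Finset.sum_congr rfl fun j _ => by ring
    simp only [h1]
    rw [M.sum_weight_sq_mul fun k => ∑ j, Q r (blockIdx k j) * Q s (blockIdx k j),
      sum_blockIdx fun x => Q r x * Q s x]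
    have h2 := congrFun (congrFun hQ r) s
    rw [mul_apply, one_apply] at h2
    simpa using h2
  · intro a b j j'
    have h1 : M.Bn α Oh (blockIdx a.1 j) (blockIdx b.1 j')
        = ∑ r, lam r * (Q r (blockIdx a.1 j) * Q r (blockIdx b.1 j')) := by
      rw [hB, mul_apply]
      refine Finset.sum_congr rfl fun r _ => ?_
      rw [mul_diagonal, transpose_apply]
      ring
    rw [kernel, Matrix.smul_apply, submatrix_apply, h1, smul_eq_mul, Finset.mul_sum]
    exact Finset.sum_congr rfl fun r _ => by ring
  · rw [hδ2]; exact kernel_row_le hBs htr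
  · rw [hδ2]; exact kernel_diag_le hBs htr
  have hexp : Continuous fun x : ℝ => Complex.exp (Complex.I * (x : ℂ)) := by fun_prop
  rw [← hVlaw, integral_map (f := fun x =>
      Complex.exp (Complex.I * ((t * offdiag (M.kernel α Oh) x : ℝ) : ℂ))) hVm'.aemeasurable
      (hexp.comp (continuous_const.mul (continuous_offdiag _))).aestronglyMeasurable,
    ← hglaw', integral_map (f := fun z : Fin M.p ⊕ Fin M.p → ℝ => Complex.exp (Complex.I *
      ((t * ∑ r, lam r / M.τ α Oh * (z r ^ 2 - 1) : ℝ) : ℂ))) hgm'.aemeasurable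
      (hexp.comp (by fun_prop)).aestronglyMeasurable] at key
  have hG : ∀ ω', GammaStat lam g ω' / M.τ α Oh
      = ∑ r, lam r / M.τ α Oh * (g (sumCode M.p r + 1) ω' ^ 2 - 1) := fun ω' => by
    rw [GammaStat, Finset.sum_div]
    exact Finset.sum_congr rfl fun r _ => by ring
  simp only [hG, Un_div_τ_eq hOs hOu]
  exact key

theorem xN_nonneg (M : Model Ω) : 0 ≤ M.xN := by
  have hp := M.hp
  have hn := M.hn 0
  have h1 : 1 ≤ 8 * M.p * M.NN := Nat.mul_pos (by omega) (by rw [NN]; omega)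
  rw [xN]
  exact Real.log_nonneg (by exact_mod_cast h1)

theorem opNorm_nonneg {p q : ℕ} (A : Matrix (Fin p) (Fin q) ℝ) : 0 ≤ opNorm A := by
  refine Real.sSup_nonneg ?_
  rintro _ ⟨v, _, rfl⟩
  exact enorm_nonneg _

theorem curv_mul_inv_sqrt_sq_le (MY : ℝ) (htr : 0 < (M.Bn α Oh * M.Bn α Oh).trace) :
    (M.curv α MY Oh * (Real.sqrt M.n0)⁻¹) ^ 2 ≤ M.δH α MY Oh := by
  have hc : 0 ≤ M.curv α MY Oh := zero_le_one.trans (M.one_le_curv_and α MY Oh).1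
  have hn := M.n0_pos
  have hx := M.xN_nonneg
  have hD : 0 ≤ M.Δrow α Oh := by
    have h0 : 0 ≤ (M.τsq α Oh)⁻¹ := by rw [τsq]; positivity
    exact mul_nonneg h0 (le_max_of_le_left (div_nonneg (opNorm_nonneg _) (by positivity)))
  have hL : 1 ≤ M.LK α := by
    rw [LK]
    linarith [le_max_of_le_left (c := max (opNorm (M.K2 α)) (opNorm (M.K3 α)))
      (opNorm_nonneg (M.K1 α))]
  have hs : 0 ≤ (Real.sqrt M.n0)⁻¹ := by positivity
  have hle : M.curv α MY Oh * (Real.sqrt M.n0)⁻¹ ≤ M.aS α MY Oh := by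
    refine mul_le_mul_of_nonneg_left ?_ hc
    have h1 : 0 ≤ M.rD := Real.sqrt_nonneg _
    have h2 : 0 ≤ M.xN / M.n0 := by positivity
    linarith
  have h1 := pow_le_pow_left₀ (mul_nonneg hc hs) hle 2
  have h2 : M.aS α MY Oh ^ 2 ≤ M.LK α ^ 2 * M.aS α MY Oh ^ 2 :=
    le_mul_of_one_le_left (sq_nonneg _) (one_le_pow₀ hL)
  have h3 : (0 : ℝ) ≤ (M.n0 : ℝ)⁻¹ := by positivity
  rw [δH]
  linarith [sq_nonneg (M.aK α MY Oh)]

end Model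

/-- Pólya's theorem: pointwise convergence of distribution functions to a continuous
distribution function is uniform. -/
theorem eventually_abs_sub_le_of_tendsto {F : ℝ → ℝ} (hmono : Monotone F) (hcont : Continuous F)
    (hbot : Tendsto F atBot (nhds 0)) (htop : Tendsto F atTop (nhds 1)) {G : ℕ → ℝ → ℝ}
    (hG : ∀ ν, Monotone (G ν)) (hG0 : ∀ ν t, 0 ≤ G ν t) (hG1 : ∀ ν t, G ν t ≤ 1)
    (h : ∀ t, Tendsto (fun ν => G ν t) atTop (nhds (F t))) {ε : ℝ} (hε : 0 < ε) :
    ∀ᶠ ν in atTop, ∀ t, |G ν t - F t| ≤ ε := by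
  have hF0 : ∀ t, 0 ≤ F t := hmono.le_of_tendsto hbot
  have hF1 : ∀ t, F t ≤ 1 := hmono.ge_of_tendsto htop
  have hsurj : ∀ q : ℝ, ∃ x, 0 < q → q < 1 → F x = q := fun q => by
    by_cases hq : 0 < q ∧ q < 1
    · obtain ⟨x, hx⟩ := mem_range_of_exists_le_of_exists_ge hcont
        ((hbot.eventually (gt_mem_nhds hq.1)).exists.imp fun _ => le_of_lt)
        ((htop.eventually (lt_mem_nhds hq.2)).exists.imp fun _ => le_of_lt)
      exact ⟨x, fun _ _ => hx⟩
    · exact ⟨0, fun h0 h1 => absurd ⟨h0, h1⟩ hq⟩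
  choose x hx using hsurj
  obtain ⟨K, hK⟩ := exists_nat_gt (4 / ε)
  have hK0 : (0 : ℝ) < K := (by positivity : (0 : ℝ) < 4 / ε).trans hK
  have hKε : (K : ℝ)⁻¹ < ε / 4 := by
    rw [inv_lt_comm₀ hK0 (by positivity), inv_div]; exact hK
  have hev : ∀ᶠ ν in atTop, ∀ i ∈ Finset.range (K + 1),
      |G ν (x (i / K)) - F (x (i / K))| ≤ ε / 2 := by
    rw [Filter.eventually_all_finset]
    intro i _
    have h1 := (h (x (i / K))).sub_const (F (x (i / K)))
    rw [sub_self] at h1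
    filter_upwards [h1.abs.eventually (gt_mem_nhds (by simpa using half_pos hε :
      |(0 : ℝ)| < ε / 2))] with ν hν using hν.le
  filter_upwards [hev] with ν hν t
  set i : ℕ := ⌊K * F t⌋₊ with hi
  have hi1 : (i : ℝ) ≤ K * F t := Nat.floor_le (mul_nonneg hK0.le (hF0 t))
  have hi2 : K * F t < i + 1 := Nat.lt_floor_add_one _
  have hiK : (i : ℝ) / K ≤ F t := by rw [div_le_iff₀ hK0]; linarith
  have hiK' : F t < (i : ℝ) / K + (K : ℝ)⁻¹ := by
    have : (i : ℝ) / K + (K : ℝ)⁻¹ = (i + 1) / K := by field_simp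
    rw [this, lt_div_iff₀ hK0]; linarith
  rw [abs_le]
  constructor
  · by_cases h2 : 2 ≤ i
    · have hc : ((i - 1 : ℕ) : ℝ) = i - 1 := by rw [Nat.cast_sub (by omega)]; simp
      have h2' : (2 : ℝ) ≤ i := by exact_mod_cast h2
      have hlt : ((i - 1 : ℕ) : ℝ) / K = (i : ℝ) / K - (K : ℝ)⁻¹ := by rw [hc]; field_simp
      have hinv : (0 : ℝ) < (K : ℝ)⁻¹ := inv_pos.2 hK0
      have hFx := hx (((i - 1 : ℕ) : ℝ) / K) (by rw [hc]; exact div_pos (by linarith) hK0)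
        (by rw [hlt]; linarith [hF1 t])
      have hxt : x (((i - 1 : ℕ) : ℝ) / K) ≤ t := by
        by_contra hcon
        have := hmono (not_le.1 hcon).le
        rw [hFx, hlt] at this
        linarith
      have hmem : i - 1 ∈ Finset.range (K + 1) := by
        rw [Finset.mem_range]
        have : (i : ℝ) ≤ K := hi1.trans (mul_le_of_le_one_right hK0.le (hF1 t))
        have : i ≤ K := by exact_mod_cast this
        omega
      have h3 := (abs_le.1 (hν _ hmem)).1
      rw [hFx] at h3
      linarith [hG ν hxt]
    · have h2' : (i : ℝ) ≤ 1 := by exact_mod_cast (by omega : i ≤ 1)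
      have : (i : ℝ) / K ≤ (K : ℝ)⁻¹ := by
        rw [div_eq_mul_inv]; exact mul_le_of_le_one_left (inv_pos.2 hK0).le h2'
      linarith [hG0 ν t]
  · by_cases h2 : i + 1 < K
    · have hc : ((i + 1 : ℕ) : ℝ) = i + 1 := by push_cast; rfl
      have hlt : ((i + 1 : ℕ) : ℝ) / K = (i : ℝ) / K + (K : ℝ)⁻¹ := by rw [hc]; field_simp
      have hFx := hx (((i + 1 : ℕ) : ℝ) / K)
        (by rw [hlt]; linarith [hF0 t])
        (by rw [div_lt_one hK0]; exact_mod_cast h2)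
      have hxt : t ≤ x (((i + 1 : ℕ) : ℝ) / K) := by
        by_contra hcon
        have := hmono (not_le.1 hcon).le
        rw [hFx, hlt] at this
        linarith
      have h3 := (abs_le.1 (hν (i + 1) (by rw [Finset.mem_range]; omega))).2
      rw [hFx] at h3
      linarith [hG ν hxt]
    · have h2' : (K : ℝ) ≤ i + 1 := by exact_mod_cast not_lt.1 h2
      have : 1 - (K : ℝ)⁻¹ ≤ (i : ℝ) / K := by
        rw [le_div_iff₀ hK0, sub_mul, inv_mul_cancel₀ hK0.ne']; linarith
      linarith [hG1 ν t]

theorem continuous_cdf_of_noAtoms (P : Measure ℝ) [IsProbabilityMeasure P]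
    (h : ∀ t, P {t} = 0) : Continuous (cdf P) := by
  refine continuous_iff_continuousAt.2 fun t => ?_
  rw [(monotone_cdf P).continuousAt_iff_leftLim_eq_rightLim, StieltjesFunction.rightLim_eq]
  have h1 := StieltjesFunction.measure_singleton (cdf P) t
  rw [measure_cdf, h, eq_comm, ENNReal.ofReal_eq_zero] at h1
  exact le_antisymm ((monotone_cdf P).leftLim_le le_rfl) (by linarith)

section Convergence

variable {Ω Ω' : Type*} [MeasurableSpace Ω] [MeasurableSpace Ω'] {P : ℕ → Measure Ω}
  [hP : ∀ ν, IsProbabilityMeasure (P ν)] {μ' : Measure Ω'} [IsProbabilityMeasure μ']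
  {X : ℕ → Ω → ℝ} {W : Ω' → ℝ}

theorem charFun_map_eq {E : Type*} [MeasurableSpace E] {m : Measure E} {f : E → ℝ}
    (hf : AEMeasurable f m) (t : ℝ) :
    charFun (m.map f) t = ∫ e, Complex.exp (Complex.I * ((t * f e : ℝ) : ℂ)) ∂m := by
  rw [charFun_apply_real, integral_map hf (by fun_prop)]
  refine integral_congr_ae (ae_of_all _ fun e => ?_)
  simp only
  push_cast
  ring_nf

theorem tendsto_measure_le_of_tendsto_charFun (hX : ∀ ν, Measurable (X ν))
    (hW : AEMeasurable W μ') (hatom : ∀ t, μ' {ω | W ω = t} = 0)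
    (h : ∀ t : ℝ, Tendsto
      (fun ν => ∫ ω, Complex.exp (Complex.I * ((t * X ν ω : ℝ) : ℂ)) ∂(P ν)) atTop
      (nhds (∫ ω, Complex.exp (Complex.I * ((t * W ω : ℝ) : ℂ)) ∂μ'))) (t : ℝ) :
    Tendsto (fun ν => (P ν {ω | X ν ω ≤ t}).toReal) atTop
      (nhds (μ' {ω | W ω ≤ t}).toReal) := by
  let m : ℕ → ProbabilityMeasure ℝ := fun ν =>
    ⟨(P ν).map (X ν), Measure.isProbabilityMeasure_map (hX ν).aemeasurable⟩
  let m0 : ProbabilityMeasure ℝ := ⟨μ'.map W, Measure.isProbabilityMeasure_map hW⟩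
  have hlim : Tendsto m atTop (nhds m0) := by
    rw [ProbabilityMeasure.tendsto_iff_tendsto_charFun]
    intro s
    simp only [m, m0, ProbabilityMeasure.coe_mk]
    rw [charFun_map_eq hW]
    simp only [charFun_map_eq (hX _).aemeasurable]
    exact h s
  have hfr : (m0 : Measure ℝ) (frontier (Set.Iic t)) = 0 := by
    rw [frontier_Iic]
    simp only [m0, ProbabilityMeasure.coe_mk]
    rw [Measure.map_apply_of_aemeasurable hW (measurableSet_singleton t)]
    exact hatom t
  have h1 := ProbabilityMeasure.tendsto_measure_of_null_frontier_of_tendsto' hlim hfr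
  have h2 := (ENNReal.tendsto_toReal (measure_ne_top _ _)).comp h1
  simp only [m, m0, ProbabilityMeasure.coe_mk, Function.comp_def] at h2
  rw [Measure.map_apply_of_aemeasurable hW measurableSet_Iic] at h2
  simp only [Measure.map_apply (hX _) measurableSet_Iic] at h2
  exact h2

/-- Convergence of characteristic functions to that of a variable without atoms implies uniform
convergence of distribution functions. -/
theorem eventually_abs_measure_le_sub_le (hX : ∀ ν, Measurable (X ν))
    (hW : AEMeasurable W μ') (hatom : ∀ t, μ' {ω | W ω = t} = 0)
    (h : ∀ t : ℝ, Tendsto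
      (fun ν => ∫ ω, Complex.exp (Complex.I * ((t * X ν ω : ℝ) : ℂ)) ∂(P ν)) atTop
      (nhds (∫ ω, Complex.exp (Complex.I * ((t * W ω : ℝ) : ℂ)) ∂μ'))) {ε : ℝ} (hε : 0 < ε) :
    ∀ᶠ ν in atTop, ∀ t, |(P ν {ω | X ν ω ≤ t}).toReal - (μ' {ω | W ω ≤ t}).toReal| ≤ ε := by
  have := Measure.isProbabilityMeasure_map hW
  have hF : ∀ t, (μ' {ω | W ω ≤ t}).toReal = cdf (μ'.map W) t := fun t => by
    rw [cdf_eq_real, measureReal_def, Measure.map_apply_of_aemeasurable hW measurableSet_Iic]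
    rfl
  have hpt := tendsto_measure_le_of_tendsto_charFun hX hW hatom h
  simp only [hF] at hpt ⊢
  refine eventually_abs_sub_le_of_tendsto (monotone_cdf _) (continuous_cdf_of_noAtoms _ fun t => ?_)
    (tendsto_cdf_atBot _) (tendsto_cdf_atTop _)
    (G := fun ν t => (P ν {ω | X ν ω ≤ t}).toReal)
    (fun ν s t hst => ENNReal.toReal_mono (measure_ne_top _ _)
      (measure_mono fun ω (hω : X ν ω ≤ s) => hω.trans hst))
    (fun ν t => ENNReal.toReal_nonneg) (fun ν t => ?_) hpt hε
  · rw [Measure.map_apply_of_aemeasurable hW (measurableSet_singleton t)]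
    exact hatom t
  · exact ENNReal.toReal_le_of_le_ofReal zero_le_one (by simpa using prob_le_one)

end Convergence

section WeightedChiSq

variable {Ω' : Type*} [MeasurableSpace Ω'] {μ' : Measure Ω'} [IsProbabilityMeasure μ']
  {g : ℕ → Ω' → ℝ} {W : Ω' → ℝ} {ρ : ℕ → ℝ} {C : ℝ}

theorem gaussianReal_quadratic_eq_null {c : ℝ} (hc : c ≠ 0) (v t : ℝ) :
    gaussianReal 0 1 {x | v + c * (x ^ 2 - 1) = t} = 0 := by
  have := nullSingletonClass_gaussianReal (μ := 0) (v := 1) one_ne_zero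
  refine Set.Finite.measure_zero (Set.Finite.subset
    (Set.toFinite {Real.sqrt ((t - v) / c + 1), -Real.sqrt ((t - v) / c + 1)}) ?_) _
  intro x hx
  have h : x ^ 2 = (t - v) / c + 1 := by
    rw [← (hx : v + c * (x ^ 2 - 1) = t)]
    field_simp
    ring
  rw [← h, Real.sqrt_sq_eq_abs]
  rcases abs_choice x with h | h <;> simp [h]

/-- A nontrivial weighted chi-square series has no atoms. -/
theorem measure_eq_zero_of_weighted_chisq (hgm : ∀ r, Measurable (g r)) (hgi : iIndepFun g μ')
    (hglaw : ∀ r, μ'.map (g r) = gaussianReal 0 1) (hC : C ≠ 0)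
    (hW : ∀ᵐ ω ∂μ', Tendsto (fun m => C * ∑ r ∈ Finset.range m, ρ r * (g (r + 1) ω ^ 2 - 1))
      atTop (nhds (W ω))) {q : ℕ} (hq : ρ q ≠ 0) (t : ℝ) : μ' {ω | W ω = t} = 0 := by
  set rest : ℕ → Ω' → ℝ := fun m ω =>
    C * ∑ r ∈ (Finset.range m).erase q, ρ r * (g (r + 1) ω ^ 2 - 1) with hrest
  set V : Ω' → ℝ := fun ω => limsup (fun m => rest m ω) atTop with hV
  have hc : C * ρ q ≠ 0 := mul_ne_zero hC hq
  have hind : IndepFun V (g (q + 1)) μ' := by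
    have h1 := indep_iSup_of_disjoint (fun r => (hgm r).comap_le) hgi
      (S := {q + 1}ᶜ) (T := {q + 1}) disjoint_compl_left
    refine indep_of_indep_of_le_left (indep_of_indep_of_le_right h1 ?_) ?_
    · exact le_iSup₂_of_le (q + 1) rfl le_rfl
    · refine Measurable.comap_le ?_
      refine Measurable.limsup fun m => ?_
      refine Measurable.const_mul (Finset.measurable_sum _ fun r hr => ?_) C
      refine Measurable.const_mul (Measurable.sub_const (Measurable.pow_const ?_ 2) 1) (ρ r)
      have hne : r + 1 ∈ ({q + 1}ᶜ : Set ℕ) := by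
        have := Finset.ne_of_mem_erase hr
        simpa using this
      exact Measurable.mono (comap_measurable (g (r + 1)))
        (le_iSup₂_of_le (r + 1) hne le_rfl) le_rfl
  have hVm : Measurable V := by
    refine Measurable.limsup fun m => ?_
    exact (Finset.measurable_sum _ fun r _ =>
      (((hgm _).pow_const 2).sub_const 1).const_mul _).const_mul C
  have hae : ∀ᵐ ω ∂μ', W ω = V ω + C * ρ q * (g (q + 1) ω ^ 2 - 1) := by
    filter_upwards [hW] with ω hω
    have h1 : Tendsto (fun m => rest m ω) atTop
        (nhds (W ω - C * ρ q * (g (q + 1) ω ^ 2 - 1))) := by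
      refine (hω.sub_const (C * ρ q * (g (q + 1) ω ^ 2 - 1))).congr' ?_
      filter_upwards [eventually_gt_atTop q] with m hm
      rw [← Finset.add_sum_erase _ _ (Finset.mem_range.2 hm)]
      ring
    have h2 : V ω = W ω - C * ρ q * (g (q + 1) ω ^ 2 - 1) := h1.limsup_eq
    rw [h2]; ring
  have hset : MeasurableSet {z : ℝ × ℝ | z.1 + C * ρ q * (z.2 ^ 2 - 1) = t} :=
    (isClosed_eq (by fun_prop) continuous_const).measurableSet
  have hjoint : μ' {ω | V ω + C * ρ q * (g (q + 1) ω ^ 2 - 1) = t} = 0 := by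
    have hmap := (indepFun_iff_map_prod_eq_prod_map_map hVm.aemeasurable
      (hgm (q + 1)).aemeasurable).1 hind
    have h1 := Measure.map_apply (μ := μ') (hVm.prodMk (hgm (q + 1))) hset
    rw [hmap, hglaw] at h1
    refine h1.symm.trans ((Measure.measure_prod_null hset).2 (ae_of_all _ fun v => ?_))
    exact gaussianReal_quadratic_eq_null hc v t
  refine le_antisymm ((measure_mono_ae ?_).trans hjoint.le) zero_le
  filter_upwards [hae] with ω hω
  intro (h : W ω = t)
  change V ω + _ = t
  rw [← hω, h]

/-- Closeness of characteristic functions of weighted chi-square series in terms of the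
`ℓ²` distance of the weights. -/
theorem norm_charFun_weighted_chisq_sub_le (hgm : ∀ r, Measurable (g r)) (hgi : iIndepFun g μ')
    (hglaw : ∀ r, μ'.map (g r) = gaussianReal 0 1)
    (hW : ∀ᵐ ω ∂μ', Tendsto (fun m => C * ∑ r ∈ Finset.range m, ρ r * (g (r + 1) ω ^ 2 - 1))
      atTop (nhds (W ω))) {b : ℕ → ℝ} {N : ℕ} (hb : ∀ r, N ≤ r → b r = 0)
    (hs : Summable fun r => (b r - ρ r) ^ 2) (t : ℝ) :
    ‖∫ ω, Complex.exp (Complex.I * ((t * (C * ∑ r ∈ Finset.range N,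
          b r * (g (r + 1) ω ^ 2 - 1)) : ℝ) : ℂ)) ∂μ'
        - ∫ ω, Complex.exp (Complex.I * ((t * W ω : ℝ) : ℂ)) ∂μ'‖
      ≤ |t * C| * Real.sqrt (chiVar * ∑' r, (b r - ρ r) ^ 2) := by
  have hgi' : iIndepFun (fun r => g (r + 1)) μ' := hgi.precomp (add_left_injective 1)
  have hmeas : ∀ (c : ℕ → ℝ) m, Measurable fun ω =>
      t * (C * ∑ r ∈ Finset.range m, c r * (g (r + 1) ω ^ 2 - 1)) := fun c m =>
    ((Finset.measurable_sum _ fun r _ =>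
      (((hgm _).pow_const 2).sub_const 1).const_mul _).const_mul C).const_mul t
  have hlim : Tendsto (fun m => ∫ ω, Complex.exp (Complex.I * ((t * (C * ∑ r ∈ Finset.range m,
      ρ r * (g (r + 1) ω ^ 2 - 1)) : ℝ) : ℂ)) ∂μ') atTop
      (nhds (∫ ω, Complex.exp (Complex.I * ((t * W ω : ℝ) : ℂ)) ∂μ')) := by
    refine tendsto_integral_of_dominated_convergence (fun _ => 1)
      (fun m => (integrable_exp_I_mul (hmeas ρ m)).aestronglyMeasurable)
      (integrable_const _) (fun m => ae_of_all _ fun ω => ?_) ?_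
    · rw [mul_comm, Complex.norm_exp_ofReal_mul_I]
    · filter_upwards [hW] with ω hω
      have hc : Continuous fun x : ℝ => Complex.exp (Complex.I * ((t * x : ℝ) : ℂ)) := by fun_prop
      exact (hc.tendsto _).comp hω
  refine le_of_tendsto (tendsto_const_nhds.sub hlim).norm ?_
  filter_upwards [eventually_ge_atTop N] with m hm
  have hext : ∀ ω, ∑ r ∈ Finset.range N, b r * (g (r + 1) ω ^ 2 - 1)
      = ∑ r ∈ Finset.range m, b r * (g (r + 1) ω ^ 2 - 1) := fun ω =>
    Finset.sum_subset (Finset.range_mono hm) fun r _ hr => by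
      rw [hb r (by simpa using hr), zero_mul]
  have hdiff : ∀ ω, t * (C * ∑ r ∈ Finset.range m, b r * (g (r + 1) ω ^ 2 - 1))
      - t * (C * ∑ r ∈ Finset.range m, ρ r * (g (r + 1) ω ^ 2 - 1))
      = t * C * ∑ r ∈ Finset.range m, (b r - ρ r) * (g (r + 1) ω ^ 2 - 1) := fun ω => by
    rw [← mul_sub, ← mul_sub, ← Finset.sum_sub_distrib, mul_assoc]
    congr 2
    exact Finset.sum_congr rfl fun r _ => by ring
  have hL2 : MemLp (fun ω => ∑ r ∈ Finset.range m, (b r - ρ r) * (g (r + 1) ω ^ 2 - 1)) 2 μ' :=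
    memLp_finsetSum _ fun r _ => (memLp_sq_sub_one hgm hglaw (r + 1)).const_mul _
  have hD : 0 ≤ chiVar * ∑' r, (b r - ρ r) ^ 2 :=
    mul_nonneg chiVar_nonneg (tsum_nonneg fun _ => sq_nonneg _)
  have habs : ∫ ω, |∑ r ∈ Finset.range m, (b r - ρ r) * (g (r + 1) ω ^ 2 - 1)| ∂μ'
      ≤ Real.sqrt (chiVar * ∑' r, (b r - ρ r) ^ 2) := by
    refine integral_abs_le_of_integral_sq_le hL2 (Real.sqrt_nonneg _) ?_
    rw [Real.sq_sqrt hD, integral_weighted_chisq_sq hgi' (fun r => hgm _) (fun r => hglaw _)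
      (fun r => b r - ρ r)]
    exact mul_le_mul_of_nonneg_left (hs.sum_le_tsum _ fun _ _ => sq_nonneg _) chiVar_nonneg
  simp only [hext]
  rw [← integral_sub (integrable_exp_I_mul (hmeas b m)) (integrable_exp_I_mul (hmeas ρ m))]
  calc _ ≤ ∫ ω, |t * C| * |∑ r ∈ Finset.range m, (b r - ρ r) * (g (r + 1) ω ^ 2 - 1)| ∂μ' := by
        refine norm_integral_le_of_norm_le ((hL2.integrable one_le_two).abs.const_mul _)
          (ae_of_all _ fun ω => ?_)
        rw [← abs_mul, ← hdiff]
        exact norm_exp_I_mul_sub_le _ _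
    _ ≤ _ := by
        rw [integral_const_mul]
        exact mul_le_mul_of_nonneg_left habs (abs_nonneg _)

end WeightedChiSq

namespace Model

variable {Ω : Type} [MeasurableSpace Ω] (M : Model Ω) {α : ℝ}
  {Oh : Fin 2 → Matrix (Fin M.p) (Fin M.p) ℝ} {lam : Fin M.p ⊕ Fin M.p → ℝ}

theorem ρn_eq_zero {r : ℕ} (hr : M.p + M.p ≤ r) : M.ρn α Oh lam r = 0 := by
  rw [ρn, dif_neg (by omega), dif_neg (by omega)]

theorem sum_range_ρn (f : ℕ → ℝ → ℝ) :
    ∑ r ∈ Finset.range (M.p + M.p), f r (M.ρn α Oh lam r)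
      = ∑ s, f (sumCode M.p s) (lam s / Real.sqrt (M.Bn α Oh * M.Bn α Oh).trace) := by
  rw [Finset.sum_range_add, Fintype.sum_sum_type, Finset.sum_range, Finset.sum_range]
  simp [ρn, sumCode]

theorem sum_sq_eq_trace {Q : Matrix (Fin M.p ⊕ Fin M.p) (Fin M.p ⊕ Fin M.p) ℝ}
    (hQ : Q * Qᵀ = 1) (hB : M.Bn α Oh = Qᵀ * Matrix.diagonal lam * Q) :
    (M.Bn α Oh * M.Bn α Oh).trace = ∑ s, lam s ^ 2 := by
  have h : Qᵀ * Matrix.diagonal lam * Q * (Qᵀ * Matrix.diagonal lam * Q)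
      = Qᵀ * (Matrix.diagonal lam * Matrix.diagonal lam * Q) := by
    simp only [Matrix.mul_assoc]
    rw [← Matrix.mul_assoc Q, hQ, Matrix.one_mul]
  rw [hB, h, trace_mul_comm, Matrix.mul_assoc, hQ, Matrix.mul_one, diagonal_mul_diagonal,
    trace_diagonal]
  exact Finset.sum_congr rfl fun s _ => (sq _).symm

theorem sum_ρn_sq {Q : Matrix (Fin M.p ⊕ Fin M.p) (Fin M.p ⊕ Fin M.p) ℝ}
    (hQ : Q * Qᵀ = 1) (hB : M.Bn α Oh = Qᵀ * Matrix.diagonal lam * Q)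
    (htr : 0 < (M.Bn α Oh * M.Bn α Oh).trace) :
    ∑ r ∈ Finset.range (M.p + M.p), M.ρn α Oh lam r ^ 2 = 1 := by
  rw [M.sum_range_ρn fun _ x => x ^ 2]
  simp only [div_pow, Real.sq_sqrt htr.le]
  rw [← Finset.sum_div, ← M.sum_sq_eq_trace hQ hB, div_self htr.ne']

theorem GammaStat_div_τ {Ω' : Type} (g : ℕ → Ω' → ℝ) (ω' : Ω') :
    GammaStat lam g ω' / M.τ α Oh = (Real.sqrt 2)⁻¹ * ∑ r ∈ Finset.range (M.p + M.p),
      M.ρn α Oh lam r * (g (r + 1) ω' ^ 2 - 1) := by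
  rw [M.sum_range_ρn fun r x => x * (g (r + 1) ω' ^ 2 - 1), GammaStat, τ, τsq,
    Real.sqrt_mul zero_le_two, Finset.sum_div, Finset.mul_sum]
  exact Finset.sum_congr rfl fun s _ => by rw [div_eq_mul_inv, mul_inv]; ring

theorem summable_ρn_sub_sq {ρ : ℕ → ℝ} (hρ : Summable fun r => ρ r ^ 2) :
    Summable fun r => (M.ρn α Oh lam r - ρ r) ^ 2 := by
  rw [← summable_nat_add_iff (M.p + M.p)]
  refine ((summable_nat_add_iff (M.p + M.p)).2 hρ).congr fun r => ?_
  rw [M.ρn_eq_zero (Nat.le_add_left _ _)]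
  ring

/-- Total mass is at most a slight multiple of the limiting mass plus the `ℓ²` distance. -/
theorem one_le_tsum_sq_add {ρ : ℕ → ℝ} (hρ : Summable fun r => ρ r ^ 2)
    (hone : ∑ r ∈ Finset.range (M.p + M.p), M.ρn α Oh lam r ^ 2 = 1) {η : ℝ} (hη : 0 < η) :
    1 ≤ (1 + η) * ∑' r, ρ r ^ 2 + (1 + η⁻¹) * ∑' r, (M.ρn α Oh lam r - ρ r) ^ 2 := by
  have hη' : 0 < η⁻¹ := inv_pos.2 hη
  have hpt : ∀ a b : ℝ, a ^ 2 ≤ (1 + η) * b ^ 2 + (1 + η⁻¹) * (a - b) ^ 2 := fun a b => by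
    have h1 : (1 + η) * b ^ 2 + (1 + η⁻¹) * (a - b) ^ 2 - a ^ 2
        = η⁻¹ * (η * b - (a - b)) ^ 2 := by
      field_simp
      ring
    have h2 : 0 ≤ η⁻¹ * (η * b - (a - b)) ^ 2 := mul_nonneg hη'.le (sq_nonneg _)
    linarith
  calc (1 : ℝ) = ∑ r ∈ Finset.range (M.p + M.p), M.ρn α Oh lam r ^ 2 := hone.symm
    _ ≤ ∑ r ∈ Finset.range (M.p + M.p),
        ((1 + η) * ρ r ^ 2 + (1 + η⁻¹) * (M.ρn α Oh lam r - ρ r) ^ 2) :=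
        Finset.sum_le_sum fun r _ => hpt _ _
    _ ≤ _ := by
        rw [Finset.sum_add_distrib, ← Finset.mul_sum, ← Finset.mul_sum]
        refine add_le_add (mul_le_mul_of_nonneg_left ?_ (by positivity))
          (mul_le_mul_of_nonneg_left ?_ (by positivity))
        · exact hρ.sum_le_tsum _ fun _ _ => sq_nonneg _
        · exact (M.summable_ρn_sub_sq hρ).sum_le_tsum _ fun _ _ => sq_nonneg _

end Model

/-- The limiting sequence keeps the whole mass, so the Gaussian component vanishes. -/
theorem A5.one_le_tsum_sq {Ω : Type} [MeasurableSpace Ω] {α : ℝ} {Ms : ℕ → Model Ω}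
    {MY : ℕ → ℝ} {Oh : (ν : ℕ) → Fin 2 → Matrix (Fin (Ms ν).p) (Fin (Ms ν).p) ℝ}
    {lam : (ν : ℕ) → Fin (Ms ν).p ⊕ Fin (Ms ν).p → ℝ} {ρ : ℕ → ℝ} {ρ0 : ℝ}
    (h : A5 α Ms MY Oh lam ρ ρ0) : 1 ≤ ∑' r, ρ r ^ 2 := by
  obtain ⟨hspec, htr, hρ, -, -, hl2, -⟩ := h
  have hη : ∀ η : ℝ, 0 < η → 1 ≤ (1 + η) * ∑' r, ρ r ^ 2 := fun η hη => by
    have hlim := (hl2.const_mul (1 + η⁻¹)).const_add ((1 + η) * ∑' r, ρ r ^ 2)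
    rw [mul_zero, add_zero] at hlim
    refine ge_of_tendsto' hlim fun ν => ?_
    obtain ⟨Q, hQ, hB⟩ := hspec ν
    exact (Ms ν).one_le_tsum_sq_add hρ ((Ms ν).sum_ρn_sq hQ hB (htr ν)) hη
  have hcont : Tendsto (fun η : ℝ => (1 + η) * ∑' r, ρ r ^ 2) (nhdsWithin 0 (Set.Ioi 0))
      (nhds ((1 + 0) * ∑' r, ρ r ^ 2)) :=
    ((Continuous.tendsto (by fun_prop) 0).mono_left nhdsWithin_le_nhds)
  rw [add_zero, one_mul] at hcont
  exact ge_of_tendsto hcont (eventually_nhdsWithin_of_forall hη)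

theorem A5.tendsto_curv_mul_inv_sqrt {Ω : Type} [MeasurableSpace Ω] {α : ℝ} {Ms : ℕ → Model Ω}
    {MY : ℕ → ℝ} {Oh : (ν : ℕ) → Fin 2 → Matrix (Fin (Ms ν).p) (Fin (Ms ν).p) ℝ}
    {lam : (ν : ℕ) → Fin (Ms ν).p ⊕ Fin (Ms ν).p → ℝ} {ρ : ℕ → ℝ} {ρ0 : ℝ}
    (h : A5 α Ms MY Oh lam ρ ρ0) :
    Tendsto (fun ν => (Ms ν).curv α (MY ν) (Oh ν) * (Real.sqrt (Ms ν).n0)⁻¹) atTop (nhds 0) := by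
  obtain ⟨-, htr, -, -, -, -, -, -, -, -, -, hδ, -⟩ := h
  refine squeeze_zero (fun ν => mul_nonneg
    (zero_le_one.trans ((Ms ν).one_le_curv_and α (MY ν) (Oh ν)).1) (by positivity))
    (fun ν => Real.le_sqrt_of_sq_le (Model.curv_mul_inv_sqrt_sq_le (MY ν) (htr ν))) ?_
  simpa using hδ.sqrt

/-- oracle weighted chi-square null law.  Under the null `θ_1 = θ_2`
and Assumptions (A1), (A2), (A4), (A5):
`sup_t |P(U_n/τ_n ≤ t) − P(Γ_n/τ_n ≤ t)| → 0` where
`Γ_n = Σ_{r=1}^{2p} λ_{nr}(χ²_{1r} − 1)` with independent `χ²_1` variables; moreover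
`U_n/τ_n` converges in distribution to
`(1/√2) Σ_{r≥1} ρ_r (χ²_{1r} − 1) + ρ_0 Z` with `Z ~ N(0,1)` independent of the `χ²`'s
(realized here as the a.s. limit `W` of the partial sums built from a sequence of
i.i.d. standard Gaussians `g`, with `Z = g 0` and `χ²_{1r} = g_r²`). -/
theorem oracle_weighted_chisq_law
    {Ω : Type} [MeasurableSpace Ω] (α : ℝ) (hα : 0 < α ∧ α < 1)
    (Ms : ℕ → Model Ω)
    (hH0 : ∀ ν, (Ms ν).H0)
    (MY : ℕ → ℝ)
    (Oh : (ν : ℕ) → Fin 2 → Matrix (Fin (Ms ν).p) (Fin (Ms ν).p) ℝ)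
    (hOh : ∀ ν k, (Oh ν k).PosSemidef ∧ Oh ν k * Oh ν k = (Ms ν).Omat α k)
    (lam : (ν : ℕ) → Fin (Ms ν).p ⊕ Fin (Ms ν).p → ℝ)
    (ρ : ℕ → ℝ) (ρ0 : ℝ)
    (hA1 : A1 Ms) (hA2 : A2 Ms) (hA4 : A4 α Ms MY)
    (hA5 : A5 α Ms MY Oh lam ρ ρ0)
    (Ω' : Type) (_ : MeasurableSpace Ω') (μ' : Measure Ω') (hμ' : IsProbabilityMeasure μ')
    (g : ℕ → Ω' → ℝ)
    (hgm : ∀ r, Measurable (g r))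
    (hgi : iIndepFun g μ')
    (hglaw : ∀ r, μ'.map (g r) = gaussianReal 0 1)
    (W : Ω' → ℝ)
    (hW : ∀ᵐ ω' ∂μ', Tendsto (fun m =>
        (Real.sqrt 2)⁻¹ * ∑ r ∈ Finset.range m, ρ r * ((g (r + 1) ω') ^ 2 - 1)
          + ρ0 * g 0 ω')
      atTop (nhds (W ω'))) :
    Tendsto (fun ν => ⨆ t : ℝ,
        |((Ms ν).μ {ω | (Ms ν).Un α ω / (Ms ν).τ α (Oh ν) ≤ t}).toReal -
          (μ' {ω' | GammaStat (lam ν) g ω' / (Ms ν).τ α (Oh ν) ≤ t}).toReal|)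
      atTop (nhds 0) ∧
    ∀ t : ℝ, Tendsto (fun ν =>
        ((Ms ν).μ {ω | (Ms ν).Un α ω / (Ms ν).τ α (Oh ν) ≤ t}).toReal)
      atTop (nhds ((μ' {ω' | W ω' ≤ t}).toReal)) := by
  have hPν : ∀ ν, IsProbabilityMeasure (Ms ν).μ := fun ν => (Ms ν).hμ
  have hmass := hA5.one_le_tsum_sq
  have hcurv := hA5.tendsto_curv_mul_inv_sqrt
  obtain ⟨hspec, htr, hρ, -, hρ0, hl2, -⟩ := hA5
  have hρ0z : ρ0 = 0 := by
    rw [← sq_eq_zero_iff]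
    linarith [sq_nonneg ρ0]
  have hC : (Real.sqrt 2)⁻¹ ≠ 0 := by positivity
  simp only [hρ0z, zero_mul, add_zero] at hW
  obtain ⟨q, hq⟩ : ∃ q, ρ q ≠ 0 := by
    by_contra! hzero
    simp only [hzero, zero_pow two_ne_zero, tsum_zero] at hmass
    linarith
  have hatom := measure_eq_zero_of_weighted_chisq hgm hgi hglaw hC hW hq
  have hWm : AEMeasurable W μ' :=
    aemeasurable_of_tendsto_metrizable_ae atTop (fun m => by fun_prop) hW
  have hΓm : ∀ ν, Measurable fun ω' => GammaStat (lam ν) g ω' / (Ms ν).τ α (Oh ν) := fun ν => by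
    simp only [Model.GammaStat_div_τ]
    fun_prop
  have hinv : Tendsto (fun ν => (Real.sqrt (Ms ν).n0)⁻¹) atTop (nhds 0) :=
    squeeze_zero (fun ν => by positivity) (fun ν => le_mul_of_one_le_left (by positivity)
      ((Ms ν).one_le_curv_and α (MY ν) (Oh ν)).1) hcurv
  have hΓ : ∀ t : ℝ, Tendsto (fun ν => ∫ ω', Complex.exp (Complex.I *
      ((t * (GammaStat (lam ν) g ω' / (Ms ν).τ α (Oh ν)) : ℝ) : ℂ)) ∂μ') atTop
      (nhds (∫ ω', Complex.exp (Complex.I * ((t * W ω' : ℝ) : ℂ)) ∂μ')) := fun t => by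
    rw [tendsto_iff_norm_sub_tendsto_zero]
    have hlim := (hl2.const_mul chiVar).sqrt.const_mul |t * (Real.sqrt 2)⁻¹|
    rw [mul_zero, Real.sqrt_zero, mul_zero] at hlim
    refine squeeze_zero (fun ν => norm_nonneg _) (fun ν => ?_) hlim
    simp only [Model.GammaStat_div_τ]
    exact norm_charFun_weighted_chisq_sub_le hgm hgi hglaw hW
      (fun r hr => (Ms ν).ρn_eq_zero hr) ((Ms ν).summable_ρn_sub_sq hρ) t
  have hU : ∀ t : ℝ, Tendsto (fun ν => ∫ ω, Complex.exp (Complex.I *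
      ((t * ((Ms ν).Un α ω / (Ms ν).τ α (Oh ν)) : ℝ) : ℂ)) ∂(Ms ν).μ) atTop
      (nhds (∫ ω', Complex.exp (Complex.I * ((t * W ω' : ℝ) : ℂ)) ∂μ')) := fun t => by
    have hlim := ((hcurv.add (hinv.const_mul (3 + |gaussFour|))).const_mul (80 * |t| ^ 3)).add
      ((hinv.const_mul (Real.sqrt chiVar)).const_mul |t|)
    have hsum := hlim.add (tendsto_iff_norm_sub_tendsto_zero.1 (hΓ t))
    simp only [mul_zero, add_zero, ← add_mul] at hsum
    rw [tendsto_iff_norm_sub_tendsto_zero]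
    refine squeeze_zero (fun ν => norm_nonneg _) (fun ν =>
      (norm_sub_le_norm_sub_add_norm_sub _ _ _).trans (add_le_add_left ?_ _)) hsum
    obtain ⟨Q, hQ, hB⟩ := hspec ν
    have hc := ((Ms ν).one_le_curv_and α (MY ν) (Oh ν)).1
    have h4 := le_abs_self gaussFour
    have h4' := abs_nonneg gaussFour
    exact Model.norm_charFun_Un_sub_GammaStat_le (hOh ν) hQ hB (htr ν) (by linarith)
      (by linarith) (by linarith) hgm hgi hglaw t
  have hUm := fun ν => (Ms ν).measurable_Un_div α ((Ms ν).τ α (Oh ν))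
  refine ⟨?_, tendsto_measure_le_of_tendsto_charFun hUm hWm hatom hU⟩
  rw [Metric.tendsto_nhds]
  intro ε hε
  filter_upwards [eventually_abs_measure_le_sub_le hUm hWm hatom hU (by positivity : 0 < ε / 3),
    eventually_abs_measure_le_sub_le (P := fun _ => μ') hΓm hWm hatom hΓ
      (by positivity : 0 < ε / 3)] with ν h1 h2
  rw [Real.dist_0_eq_abs, abs_of_nonneg (Real.iSup_nonneg fun t => abs_nonneg _)]
  refine (ciSup_le fun t => ?_ : _ ≤ 2 * (ε / 3)).trans_lt (by linarith)
  have h1t := abs_le.1 (h1 t)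
  have h2t := abs_le.1 (h2 t)
  exact abs_le.2 ⟨by linarith [h1t.1, h2t.2], by linarith [h1t.2, h2t.1]⟩

end PDQ

end
end

section
/- Let X_1,…,X_n (n ≥ 2) be independent random variables, h a symmetric measurable kernel with 0 ≤ h(x,y) ≤ 1, U_n = C(n,2)^{−1} Σ_{1≤i<j≤n} h(X_i,X_j), and θ = E h(X_1,X_2). Then for every x > 0, P(|U_n − θ| > x) ≤ 2 exp(−2⌊n/2⌋ x²); in particular P(|U_n − θ| > x) ≤ 2 exp(−c n x²) for a universal constant c > 0. -/
open MeasureTheory ProbabilityTheory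

noncomputable section

/-- If the random variables `X i j` are jointly independent over all pairs `(i, j)`, then the
families `(X i j)ⱼ` are independent over `i`. -/
lemma ProbabilityTheory.iIndepFun.curry {Ω ι : Type*} {κ : ι → Type*} {𝓧 : (i : ι) → κ i → Type*}
    [MeasurableSpace Ω] {μ : Measure Ω} [∀ i j, MeasurableSpace (𝓧 i j)]
    {X : (i : ι) → (j : κ i) → Ω → 𝓧 i j} (mX : ∀ i j, Measurable (X i j))
    (hX : iIndepFun (fun (p : (i : ι) × κ i) ω ↦ X p.1 p.2 ω) μ) :
    iIndepFun (fun i ω ↦ (X i · ω)) μ := by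
  have := hX.isProbabilityMeasure
  have : ∀ i j, IsProbabilityMeasure (μ.map (X i j)) :=
    fun i j ↦ Measure.isProbabilityMeasure_map (mX i j).aemeasurable
  have : ∀ i, IsProbabilityMeasure (μ.map (fun ω ↦ (X i · ω))) :=
    fun i ↦ Measure.isProbabilityMeasure_map (Measurable.aemeasurable (by fun_prop))
  have hcomp : (MeasurableEquiv.piCurry 𝓧) ∘ (fun ω p ↦ X p.1 p.2 ω) = fun ω i j ↦ X i j ω := by
    ext; simp [Sigma.curry]
  have hrow (i : ι) : iIndepFun (X i) μ := hX.precomp (g := fun j ↦ ⟨i, j⟩) sigma_mk_injective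
  rw [iIndepFun_iff_map_fun_eq_infinitePi_map (by fun_prop), ← hcomp,
    ← Measure.map_map (by fun_prop) (by fun_prop),
    (iIndepFun_iff_map_fun_eq_infinitePi_map (by fun_prop)).1 hX,
    Measure.infinitePi_map_piCurry (fun i j ↦ μ.map (X i j))]
  congrm Measure.infinitePi fun i ↦ ?_
  rw [(iIndepFun_iff_map_fun_eq_infinitePi_map (by fun_prop)).1 (hrow i)]

/-- Without any independence, a sum of `k` sub-Gaussian random variables with parameter `c` is
sub-Gaussian with parameter `k ^ 2 * c`. -/
lemma ProbabilityTheory.HasSubgaussianMGF.sum {Ω ι : Type*} [MeasurableSpace Ω] {μ : Measure Ω}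
    [IsZeroOrProbabilityMeasure μ] {Y : ι → Ω → ℝ} {c : NNReal} (s : Finset ι)
    (hY : ∀ i ∈ s, HasSubgaussianMGF (Y i) c μ) :
    HasSubgaussianMGF (fun ω ↦ ∑ i ∈ s, Y i ω) ((s.card : NNReal) ^ 2 * c) μ := by
  classical
  induction s using Finset.induction_on with
  | empty => simp
  | insert a s ha ih =>
    have hadd := (hY a (s.mem_insert_self a)).add
      (ih fun i hi ↦ hY i (Finset.mem_insert_of_mem hi))
    have hc : (NNReal.sqrt c + NNReal.sqrt ((s.card : NNReal) ^ 2 * c)) ^ 2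
        = ((insert a s).card : NNReal) ^ 2 * c := by
      rw [NNReal.sqrt_mul, NNReal.sqrt_sq, Finset.card_insert_of_notMem ha]
      push_cast
      rw [← one_add_mul, mul_pow, NNReal.sq_sqrt, add_comm]
    rw [hc] at hadd
    simpa only [Finset.sum_insert ha] using hadd

/-- Averaging a function of two arguments over all permutations of a fixed pair of distinct
indices is the same as averaging it over all pairs of distinct indices. -/
lemma card_offDiag_mul_sum_perm {ι : Type*} [Fintype ι] [DecidableEq ι] (f : ι → ι → ℝ)
    {i j : ι} (hij : i ≠ j) :
    ((Finset.univ : Finset ι).offDiag.card : ℝ) * ∑ σ : Equiv.Perm ι, f (σ i) (σ j)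
      = (Fintype.card ι).factorial * ∑ p ∈ (Finset.univ : Finset ι).offDiag, f p.1 p.2 := by
  have hpair : ∀ p ∈ (Finset.univ : Finset ι).offDiag,
      ∑ σ : Equiv.Perm ι, f (σ p.1) (σ p.2) = ∑ σ : Equiv.Perm ι, f (σ i) (σ j) := by
    intro p hp
    obtain ⟨τ, hi, hj⟩ := MulAction.is_two_pretransitive_iff.1
      (Equiv.Perm.isMultiplyPretransitive ι 2) hij (Finset.mem_offDiag.1 hp).2.2
    rw [← hi, ← hj]
    exact Equiv.sum_comp (Equiv.mulRight τ) fun σ : Equiv.Perm ι ↦ f (σ i) (σ j)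
  have hperm (σ : Equiv.Perm ι) : ∑ p ∈ (Finset.univ : Finset ι).offDiag, f (σ p.1) (σ p.2)
      = ∑ p ∈ (Finset.univ : Finset ι).offDiag, f p.1 p.2 :=
    Finset.sum_equiv (σ.prodCongr σ) (by simp) (by simp)
  rw [← nsmul_eq_mul, ← Finset.sum_const, ← Finset.sum_congr rfl hpair, Finset.sum_comm,
    Finset.sum_congr rfl fun σ _ ↦ hperm σ, Finset.sum_const, nsmul_eq_mul, Finset.card_univ,
    Fintype.card_perm]

/-- For a symmetric function, the sum over pairs of distinct indices is twice the sum over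
increasing pairs. -/
lemma sum_offDiag_eq_two_mul_sum_lt {ι : Type*} [Fintype ι] [LinearOrder ι] (f : ι → ι → ℝ)
    (hf : ∀ i j, f i j = f j i) :
    ∑ p ∈ (Finset.univ : Finset ι).offDiag, f p.1 p.2
      = 2 * ∑ i, ∑ j, if i < j then f i j else 0 := by
  have hsplit : ∑ p ∈ (Finset.univ : Finset ι).offDiag, f p.1 p.2
      = ∑ i, ∑ j, ((if i < j then f i j else 0) + if j < i then f j i else 0) := by
    rw [← Fintype.sum_prod_type', ← Finset.sum_subset (Finset.subset_univ Finset.univ.offDiag)]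
    · refine Finset.sum_congr rfl fun p hp ↦ ?_
      rcases lt_or_gt_of_ne (Finset.mem_offDiag.1 hp).2.2 with hlt | hlt
      · simp [hlt, hlt.not_gt]
      · simp [hlt, hlt.not_gt, hf p.1 p.2]
    · intro p _ hp
      have heq : p.1 = p.2 := by simpa using hp
      simp [heq]
  simp_rw [hsplit, Finset.sum_add_distrib, two_mul]
  congr 1
  exact Finset.sum_comm

/-- Hoeffding's permutation identity for the sum defining a U-statistic of order two. -/
lemma choose_two_mul_sum_perm {n : ℕ} (f : Fin n → Fin n → ℝ) (hf : ∀ i j, f i j = f j i)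
    {i j : Fin n} (hij : i ≠ j) :
    (n.choose 2 : ℝ) * ∑ σ : Equiv.Perm (Fin n), f (σ i) (σ j)
      = n.factorial * ∑ i, ∑ j, if i < j then f i j else 0 := by
  have hperm := card_offDiag_mul_sum_perm f hij
  have hcard : ((Finset.univ : Finset (Fin n)).offDiag.card : ℝ) = 2 * n.choose 2 := by
    rw [Finset.offDiag_card, Nat.cast_choose_two, Finset.card_univ, Fintype.card_fin,
      Nat.cast_sub (Nat.le_mul_self n)]
    push_cast
    ring
  rw [hcard, sum_offDiag_eq_two_mul_sum_lt f hf, Fintype.card_fin] at hperm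
  linarith

/-- A sum of `m` kernel evaluations at disjoint pairs of independent variables, centred at the
common mean, is sub-Gaussian with parameter `m / 4`. -/
lemma hasSubgaussianMGF_sum_disjoint_pairs {Ω α ι : Type*} [MeasurableSpace Ω]
    [MeasurableSpace α] {μ : Measure Ω} [IsProbabilityMeasure μ] {X : ι → Ω → α}
    {h : α → α → ℝ} (hm : Measurable (fun q : α × α ↦ h q.1 q.2))
    (hb : ∀ a b, 0 ≤ h a b ∧ h a b ≤ 1) (mX : ∀ i, Measurable (X i)) (hX : iIndepFun X μ)
    {θ : ℝ} (hθ : ∀ i j, i ≠ j → ∫ ω, h (X i ω) (X j ω) ∂μ = θ) {m : ℕ}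
    {e : (_ : Fin m) × Fin 2 → ι} (he : Function.Injective e) :
    HasSubgaussianMGF (fun ω ↦ ∑ k, (h (X (e ⟨k, 0⟩) ω) (X (e ⟨k, 1⟩) ω) - θ)) (m / 4) μ := by
  have hpairs : iIndepFun (fun k ω ↦ h (X (e ⟨k, 0⟩) ω) (X (e ⟨k, 1⟩) ω) - θ) μ := by
    have hcurry := iIndepFun.curry (X := fun k l ↦ X (e ⟨k, l⟩)) (fun _ _ ↦ mX _)
      (hX.precomp he)
    refine hcurry.comp (fun _ v ↦ h (v 0) (v 1) - θ) fun _ ↦ ?_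
    have hev : Measurable (fun v : Fin 2 → α ↦ (v 0, v 1)) := by fun_prop
    exact (hm.comp hev).sub_const θ
  have hterm (k : Fin m) : HasSubgaussianMGF
      (fun ω ↦ h (X (e ⟨k, 0⟩) ω) (X (e ⟨k, 1⟩) ω) - θ) (1 / 4) μ := by
    have hne : e ⟨k, 0⟩ ≠ e ⟨k, 1⟩ := fun heq ↦ by simpa using he heq
    have hoeffding := hasSubgaussianMGF_of_mem_Icc (μ := μ) (a := 0) (b := 1)
      (X := fun ω ↦ h (X (e ⟨k, 0⟩) ω) (X (e ⟨k, 1⟩) ω))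
      (hm.comp ((mX _).prodMk (mX _))).aemeasurable (ae_of_all _ fun ω ↦ hb _ _)
    rw [hθ _ _ hne] at hoeffding
    convert hoeffding using 1
    norm_num
  have hsum := HasSubgaussianMGF.sum_of_iIndepFun hpairs (s := Finset.univ) fun k _ ↦ hterm k
  convert hsum using 1
  simp [div_eq_mul_inv]

/-- The centred U-statistic of order two with kernel in `[0, 1]` is sub-Gaussian with parameter
`(4 ⌊n / 2⌋)⁻¹`. -/
lemma hasSubgaussianMGF_ustat {Ω α : Type*} [MeasurableSpace Ω]
    [MeasurableSpace α] {μ : Measure Ω} [IsProbabilityMeasure μ] {n : ℕ} (hn : 2 ≤ n)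
    {X : Fin n → Ω → α} {h : α → α → ℝ} (hm : Measurable (fun q : α × α ↦ h q.1 q.2))
    (hs : ∀ a b, h a b = h b a) (hb : ∀ a b, 0 ≤ h a b ∧ h a b ≤ 1)
    (mX : ∀ i, Measurable (X i)) (hX : iIndepFun X μ)
    {θ : ℝ} (hθ : ∀ i j, i ≠ j → ∫ ω, h (X i ω) (X j ω) ∂μ = θ) :
    HasSubgaussianMGF (fun ω ↦ ((n.choose 2 : ℝ))⁻¹ *
      (∑ i : Fin n, ∑ j : Fin n, if i < j then h (X i ω) (X j ω) else 0) - θ)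
      (4 * (n / 2 : ℕ))⁻¹ μ := by
  let e : (_ : Fin (n / 2)) × Fin 2 → Fin n := fun p ↦ ⟨2 * p.1 + p.2, by omega⟩
  have he : Function.Injective e := by
    rintro ⟨k, a⟩ ⟨l, b⟩ hkl
    have hval : 2 * (k : ℕ) + a = 2 * l + b := congrArg Fin.val hkl
    obtain rfl : k = l := Fin.ext (by omega)
    obtain rfl : a = b := Fin.ext (by omega)
    rfl
  have hchoose : (n.choose 2 : ℝ) ≠ 0 := by exact_mod_cast (Nat.choose_pos hn).ne'
  have hfact : (n.factorial : ℝ) ≠ 0 := by exact_mod_cast n.factorial_ne_zero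
  have hhalf : ((n / 2 : ℕ) : ℝ) ≠ 0 := by
    have : n / 2 ≠ 0 := by omega
    exact_mod_cast this
  have hsum := HasSubgaussianMGF.sum (Finset.univ : Finset (Equiv.Perm (Fin n))) fun σ _ ↦
    hasSubgaussianMGF_sum_disjoint_pairs hm hb mX hX hθ (σ.injective.comp he)
  have hscaled := hsum.const_mul ((n.factorial * (n / 2 : ℕ) : ℝ)⁻¹)
  convert hscaled using 1
  · funext ω
    have hpair (k : Fin (n / 2)) : ∑ σ : Equiv.Perm (Fin n),
        h (X (σ (e ⟨k, 0⟩)) ω) (X (σ (e ⟨k, 1⟩)) ω) = (n.choose 2 : ℝ)⁻¹ * (n.factorial *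
          ∑ i : Fin n, ∑ j : Fin n, if i < j then h (X i ω) (X j ω) else 0) := by
      rw [eq_inv_mul_iff_mul_eq₀ hchoose]
      exact choose_two_mul_sum_perm (fun i j ↦ h (X i ω) (X j ω)) (fun _ _ ↦ hs _ _)
        fun heq ↦ by simpa using he heq
    rw [Finset.sum_comm (s := (Finset.univ : Finset (Equiv.Perm (Fin n))))]
    simp only [Function.comp_apply, Finset.sum_sub_distrib, hpair, Finset.sum_const,
      Finset.card_univ, Fintype.card_perm, Fintype.card_fin, nsmul_eq_mul]
    field_simp
  · apply NNReal.eq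
    rw [Finset.card_univ, Fintype.card_perm, Fintype.card_fin]
    change (((4 * (n / 2 : ℕ))⁻¹ : NNReal) : ℝ) = ((n.factorial * (n / 2 : ℕ) : ℝ)⁻¹) ^ 2 *
      (((n.factorial : NNReal) ^ 2 * ((n / 2 : ℕ) / 4) : NNReal) : ℝ)
    push_cast
    field_simp

/-- Two-sided Chernoff bound for a sub-Gaussian random variable. -/
lemma ProbabilityTheory.HasSubgaussianMGF.measure_abs_gt_le {Ω : Type*} [MeasurableSpace Ω] {μ : Measure Ω}
    [IsFiniteMeasure μ] {Y : Ω → ℝ} {c : NNReal} (hY : HasSubgaussianMGF Y c μ) {x : ℝ}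
    (hx : 0 ≤ x) :
    μ {ω | |Y ω| > x} ≤ ENNReal.ofReal (2 * Real.exp (-x ^ 2 / (2 * c))) := by
  have hsub : {ω | |Y ω| > x} ⊆ {ω | x ≤ Y ω} ∪ {ω | x ≤ (-Y) ω} := fun ω hω ↦
    (lt_abs.1 (Set.mem_ofPred.1 hω)).imp (fun hlt ↦ hlt.le) (fun hlt ↦ hlt.le)
  rw [← ofReal_measureReal]
  refine ENNReal.ofReal_le_ofReal ?_
  calc μ.real {ω | |Y ω| > x}
      ≤ μ.real {ω | x ≤ Y ω} + μ.real {ω | x ≤ (-Y) ω} :=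
        (measureReal_mono hsub).trans (measureReal_union_le _ _)
    _ ≤ 2 * Real.exp (-x ^ 2 / (2 * c)) := by
        rw [two_mul]
        exact add_le_add (hY.measure_ge_le hx) (hY.neg.measure_ge_le hx)

/-- Hoeffding tail bound for bounded-kernel U-statistics.
There is a universal constant `c > 0` such that: for independent and identically
distributed random variables `X_1, …, X_n` (`n ≥ 2`), a symmetric measurable kernel
`h` with `0 ≤ h ≤ 1`, `U_n = C(n,2)⁻¹ Σ_{i<j} h(X_i, X_j)` and `θ = E h(X_1, X_2)`,
for every `x > 0`,
`P(|U_n − θ| > x) ≤ 2 exp(−2⌊n/2⌋ x²)` and `P(|U_n − θ| > x) ≤ 2 exp(−c n x²)`. -/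
theorem ustat_hoeffding_tail :
    ∃ c : ℝ, 0 < c ∧
      ∀ (Ω : Type) (_ : MeasurableSpace Ω) (μ : Measure Ω), IsProbabilityMeasure μ →
      ∀ (α : Type) (_ : MeasurableSpace α) (n : ℕ) (hn : 2 ≤ n),
      ∀ (X : Fin n → Ω → α) (h : α → α → ℝ),
        Measurable (fun q : α × α => h q.1 q.2) →
        (∀ a b, h a b = h b a) →
        (∀ a b, 0 ≤ h a b ∧ h a b ≤ 1) →
        (∀ i, Measurable (X i)) →
        iIndepFun X μ →
        (∀ i j : Fin n, IdentDistrib (X i) (X j) μ μ) →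
        ∀ x : ℝ, 0 < x →
          (μ {ω | |((n.choose 2 : ℝ))⁻¹ *
                (∑ i : Fin n, ∑ j : Fin n, if i < j then h (X i ω) (X j ω) else 0)
              - ∫ ω', h (X ⟨0, by omega⟩ ω') (X ⟨1, by omega⟩ ω') ∂μ| > x}
            ≤ ENNReal.ofReal (2 * Real.exp (-2 * (n / 2 : ℕ) * x ^ 2))) ∧
          (μ {ω | |((n.choose 2 : ℝ))⁻¹ *
                (∑ i : Fin n, ∑ j : Fin n, if i < j then h (X i ω) (X j ω) else 0)
              - ∫ ω', h (X ⟨0, by omega⟩ ω') (X ⟨1, by omega⟩ ω') ∂μ| > x}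
            ≤ ENNReal.ofReal (2 * Real.exp (-c * n * x ^ 2))) := by
  refine ⟨1 / 2, by norm_num, ?_⟩
  intro Ω _ μ _ α _ n hn X h hm hs hb mX hX hid x hx
  have hθ : ∀ i j : Fin n, i ≠ j → ∫ ω, h (X i ω) (X j ω) ∂μ
      = ∫ ω, h (X ⟨0, by omega⟩ ω) (X ⟨1, by omega⟩ ω) ∂μ := fun i j hij ↦
    (((hid i ⟨0, by omega⟩).prodMk (hid j ⟨1, by omega⟩) (hX.indepFun hij)
      (hX.indepFun (by simp))).comp hm).integral_eq
  have htail := (hasSubgaussianMGF_ustat hn hm hs hb mX hX hθ).measure_abs_gt_le hx.le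
  have hhalf : (n : ℝ) ≤ 4 * (n / 2 : ℕ) := by
    have : n ≤ 4 * (n / 2) := by omega
    exact_mod_cast this
  have hexp : -x ^ 2 / (2 * (((4 * (n / 2 : ℕ))⁻¹ : NNReal) : ℝ))
      = -2 * (n / 2 : ℕ) * x ^ 2 := by
    push_cast
    rw [mul_inv]
    field_simp
    ring
  rw [hexp] at htail
  refine ⟨htail, htail.trans (ENNReal.ofReal_le_ofReal ?_)⟩
  gcongr 2 * Real.exp (?_ * _)
  linarith

end
end
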